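/- Let q be a prime power, t ≥ 1, and let f(x) = Σ_{j=0}^{k} a_j x^{q^j} ∈ F_{q^n}[x] be an F_q-linearized polynomial of q-degree k < n with a_t = 0 and a_0 ≠ 0. Set d = max{k, t}, and for i ≥ 1 let N_i = #{ m ∈ F_{q^n} : dim_{F_q} ker(f(x) − m·x^{q^t}) = i }. Then for every i ≥ 1, either N_i = 0 or N_i > (q^n + 1)/q^{d²} − (2(d−1)·q^{d²}/(q^d − 1))·√(q^n) − 1. -/

import Mathlib

namespace Chb
open PowerSeries

section PS
variable {Ω : Type*} [Field Ω]

lemma ps_fixed (Φ : PowerSeries Ω → PowerSeries Ω)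
    (hΦ : ∀ m z z', (X : PowerSeries Ω) ^ m ∣ z - z' → (X : PowerSeries Ω) ^ (m + 1) ∣ Φ z - Φ z') :
    ∃ z, Φ z = z := by
  have key : ∀ m z z', (X : PowerSeries Ω) ^ m ∣ Φ^[m] z - Φ^[m] z' := by
    intro m
    induction m with
    | zero => intro z z'; simp
    | succ m ih =>
      intro z z'
      rw [Function.iterate_succ_apply', Function.iterate_succ_apply']
      exact hΦ _ _ _ (ih z z')
  have key2 : ∀ m k, m ≤ k → (X : PowerSeries Ω) ^ m ∣ Φ^[k] 0 - Φ^[m] 0 := by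
    intro m k hk
    obtain ⟨j, rfl⟩ := Nat.exists_eq_add_of_le hk
    rw [Function.iterate_add_apply]
    exact key _ _ _
  let z : PowerSeries Ω := PowerSeries.mk fun k => coeff k (Φ^[k+1] 0)
  have hz : ∀ m, (X : PowerSeries Ω) ^ m ∣ z - Φ^[m] 0 := by
    intro m
    rw [X_pow_dvd_iff]
    intro k hk
    have := (X_pow_dvd_iff.1 (key2 (k+1) m hk)) k (Nat.lt_succ_self k)
    rw [map_sub, sub_eq_zero] at this ⊢
    rw [this]
    simp [z]
  refine ⟨z, ?_⟩
  rw [← sub_eq_zero]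
  ext k
  have h1 := hΦ _ _ _ (hz k)
  have h2 := hz (k+1)
  rw [Function.iterate_succ_apply'] at h2
  have h3 := dvd_sub h1 h2
  rw [sub_sub_sub_cancel_right] at h3
  simpa using (X_pow_dvd_iff.1 h3) k (Nat.lt_succ_self k)

/-- lifting of roots of linearized equations -/
lemma ps_lift (p q e : ℕ) [Fact p.Prime] [CharP Ω p] (hq : q = p ^ e) (he : 1 ≤ e)
    (N : ℕ) (A : ℕ → PowerSeries Ω) (hA : IsUnit (A 0)) (y0 : Ω)
    (h0 : ∑ j ∈ Finset.range (N + 1), constantCoeff (A j) * y0 ^ q ^ j = 0) :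
    ∃ y : PowerSeries Ω, constantCoeff y = y0 ∧ ∑ j ∈ Finset.range (N + 1), A j * y ^ q ^ j = 0 := by
  have : CharP (PowerSeries Ω) p := charP_of_injective_algebraMap (algebraMap Ω (PowerSeries Ω)).injective p
  have hp : p.Prime := Fact.out
  have hq2 : 2 ≤ q := by
    rw [hq]; exact hp.two_le.trans (Nat.le_self_pow (by omega) p)
  obtain ⟨u, hu⟩ := hA
  have hX : (X : PowerSeries Ω) ∣ ∑ j ∈ Finset.range (N + 1), A j * (C y0) ^ q ^ j := by
    rw [X_dvd_iff, map_sum, ← h0]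
    simp
  obtain ⟨g, hg⟩ := hX
  let Φ : PowerSeries Ω → PowerSeries Ω := fun z =>
    (↑u⁻¹ : PowerSeries Ω) * (- g - ∑ j ∈ Finset.range N, A (j+1) * X ^ (q ^ (j+1) - 1) * z ^ q ^ (j+1))
  have addp : ∀ (x y : PowerSeries Ω) j, (x + y) ^ q ^ j = x ^ q ^ j + y ^ q ^ j := by
    intro x y j; rw [hq, ← pow_mul]; exact add_pow_char_pow (p := p) x y _
  have subp : ∀ (x y : PowerSeries Ω) j, (x - y) ^ q ^ j = x ^ q ^ j - y ^ q ^ j := by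
    intro x y j; rw [hq, ← pow_mul]; exact sub_pow_char_pow x y _
  have hqj : ∀ j, 2 ≤ q ^ (j+1) := fun j => hq2.trans (Nat.le_self_pow (by omega) q)
  obtain ⟨z, hz⟩ := ps_fixed Φ (by
    intro m z z' hzz
    simp only [Φ]
    rw [← mul_sub]
    apply Dvd.dvd.mul_left
    rw [sub_sub_sub_cancel_left, ← Finset.sum_sub_distrib]
    apply Finset.dvd_sum
    intro j _
    rw [← mul_sub, ← subp, mul_assoc]
    apply Dvd.dvd.mul_left
    rw [add_comm m 1, pow_add]
    apply mul_dvd_mul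
    · exact pow_dvd_pow _ (by have := hqj j; omega)
    · exact dvd_pow (dvd_sub_comm.1 hzz) (by have := hqj j; omega))
  refine ⟨C y0 + X * z, by simp, ?_⟩
  have e1 : ∀ j, A j * (C y0 + X * z) ^ q ^ j = A j * (C y0) ^ q ^ j + A j * (X * z) ^ q ^ j := by
    intro j; rw [addp]; ring
  simp_rw [e1]
  rw [Finset.sum_add_distrib, hg, Finset.sum_range_succ']
  have e2 : ∀ j, A (j+1) * (X * z) ^ q ^ (j+1) = X * (A (j+1) * X ^ (q ^ (j+1) - 1) * z ^ q ^ (j+1)) := by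
    intro j
    have : q ^ (j+1) = (q ^ (j+1) - 1) + 1 := by have := hqj j; omega
    rw [mul_pow]
    nth_rewrite 1 [this]
    rw [pow_succ]; ring
  simp_rw [e2]
  rw [← Finset.mul_sum]
  have e3 : (u : PowerSeries Ω) * z = - g - ∑ j ∈ Finset.range N, A (j+1) * X ^ (q ^ (j+1) - 1) * z ^ q ^ (j+1) := by
    conv_lhs => rw [← hz]
    simp [Φ]
  rw [← hu]
  simp only [pow_zero, pow_one]
  linear_combination X * e3

/-- vanishing order from iterated derivations -/
lemma ps_order (p : ℕ) [Fact p.Prime] [CharP Ω p] (lam : PowerSeries Ω) (hl : IsUnit lam) :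
    ∀ (ℓ : ℕ), ℓ ≤ p → ∀ z : PowerSeries Ω,
      (∀ l < ℓ, constantCoeff ((fun y => lam * derivative Ω y)^[l] z) = 0) → (X : PowerSeries Ω) ^ ℓ ∣ z := by
  intro ℓ
  induction ℓ with
  | zero => intros; simp
  | succ ℓ ih =>
    intro hℓ z hz
    have h1 := ih (by omega) (lam * derivative Ω z) (by
      intro l hl'
      have := hz (l+1) (by omega)
      rwa [Function.iterate_succ_apply] at this)
    have h2 : (X : PowerSeries Ω) ^ ℓ ∣ derivative Ω z := by
      rwa [hl.dvd_mul_left] at h1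
    rw [X_pow_dvd_iff] at h2 ⊢
    intro k hk
    cases k with
    | zero => simpa using hz 0 (by omega)
    | succ k =>
      have := h2 k (by omega)
      rw [coeff_derivative] at this
      rcases mul_eq_zero.1 this with h | h
      · exact h
      · exfalso
        have h' : ((k + 1 : ℕ) : Ω) = 0 := by exact_mod_cast h
        rw [CharP.cast_eq_zero_iff Ω p] at h'
        have := Nat.le_of_dvd (by omega) h'
        omega

lemma ps_pow_mod (p b : ℕ) [Fact p.Prime] [CharP Ω p] (z : PowerSeries Ω) :
    (X : PowerSeries Ω) ^ (p ^ b) ∣ z ^ (p ^ b) - C (constantCoeff z ^ p ^ b) := by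
  have : CharP (PowerSeries Ω) p := charP_of_injective_algebraMap (algebraMap Ω (PowerSeries Ω)).injective p
  rw [map_pow, ← sub_pow_char_pow]
  apply pow_dvd_pow_of_dvd
  rw [X_dvd_iff]; simp

/-- common factor of power of X -/
lemma ps_common {E : Type*} [Fintype E] (β : E → PowerSeries Ω) (h : ∃ e, β e ≠ 0) :
    ∃ (m : ℕ) (γ : E → PowerSeries Ω), (∀ e, β e = X ^ m * γ e) ∧ ∃ e, constantCoeff (γ e) ≠ 0 := by
  classical
  have hP : ∃ m, ∃ e, coeff m (β e) ≠ 0 := by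
    obtain ⟨e, he⟩ := h
    by_contra hc
    push Not at hc
    exact he (by ext m; simpa using hc m e)
  let m := Nat.find hP
  have hm : ∀ e, (X : PowerSeries Ω) ^ m ∣ β e := by
    intro e
    rw [X_pow_dvd_iff]
    intro k hk
    have := Nat.find_min hP hk
    push Not at this
    exact this e
  choose γ hγ using hm
  refine ⟨m, γ, hγ, ?_⟩
  obtain ⟨e, he⟩ := Nat.find_spec hP
  refine ⟨e, ?_⟩
  change coeff m (β e) ≠ 0 at he
  rw [hγ e] at he
  have := coeff_X_pow_mul (γ e) m 0
  rw [zero_add] at this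
  rw [this] at he
  simpa using he
end PS
end Chb

namespace Chb

section Der
variable {Ω : Type*} [Field Ω] {Vt : Type*}

noncomputable def mon (Ω : Type*) [Field Ω] {Vt : Type*} (M : Multiset Vt) : MvPolynomial Vt Ω :=
  (M.map MvPolynomial.X).prod

lemma mon_add (M M' : Multiset Vt) : mon Ω (M + M') = mon Ω M * mon Ω M' := by
  simp [mon]

lemma mon_nsmul_single (n : ℕ) (t : Vt) : mon Ω (n • ({t} : Multiset Vt)) = MvPolynomial.X t ^ n := by
  simp [mon, Multiset.nsmul_singleton]

noncomputable def Sp (Ω : Type*) [Field Ω] {Vt : Type*} (M : Multiset Vt) :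
    Submodule Ω (MvPolynomial Vt Ω) :=
  Submodule.span Ω {g | ∃ M' ≤ M, g = mon Ω M'}

lemma mon_mem_Sp {M M' : Multiset Vt} (h : M' ≤ M) : mon Ω M' ∈ Sp Ω M :=
  Submodule.subset_span ⟨M', h, rfl⟩

lemma Sp_mono {M M' : Multiset Vt} (h : M' ≤ M) : Sp Ω M' ≤ Sp Ω M := by
  apply Submodule.span_mono
  rintro g ⟨M'', h', rfl⟩
  exact ⟨M'', h'.trans h, rfl⟩

lemma X_mul_Sp (t : Vt) {M : Multiset Vt} {g : MvPolynomial Vt Ω} (hg : g ∈ Sp Ω M) :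
    MvPolynomial.X t * g ∈ Sp Ω (t ::ₘ M) := by
  induction hg using Submodule.span_induction with
  | mem x hx =>
    obtain ⟨M', h', rfl⟩ := hx
    have : MvPolynomial.X t * mon Ω M' = mon Ω (t ::ₘ M') := by simp [mon]
    rw [this]
    exact mon_mem_Sp (Multiset.cons_le_cons _ h')
  | zero => simp
  | add x y _ _ hx hy => rw [mul_add]; exact add_mem hx hy
  | smul c x _ hx => rw [mul_smul_comm]; exact Submodule.smul_mem _ _ hx

noncomputable def DD (q d : ℕ) (w : ℕ → Ω) :
    Derivation Ω (MvPolynomial Vt Ω) (MvPolynomial Vt Ω) :=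
  MvPolynomial.mkDerivation Ω fun t => ∑ j ∈ Finset.range d, w j • (MvPolynomial.X t ^ q ^ j)

lemma DD_mon [DecidableEq Vt] (q d : ℕ) (hq : 1 ≤ q) (w : ℕ → Ω) (Z : Multiset Vt) (M : Multiset Vt)
    (hM : ∀ t ∈ M, t ∈ Z) : DD q d w (mon Ω M) ∈ Sp Ω (M + q ^ (d - 1) • Z) := by
  induction M using Multiset.induction with
  | empty => simp [mon]
  | cons t M ih =>
    have h1 : mon Ω (t ::ₘ M) = MvPolynomial.X t * mon Ω M := by simp [mon]
    rw [h1, Derivation.leibniz]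
    apply add_mem
    · rw [smul_eq_mul, Multiset.cons_add]
      exact X_mul_Sp _ (ih fun t ht => hM t (Multiset.mem_cons_of_mem ht))
    · rw [DD, MvPolynomial.mkDerivation_X, Finset.smul_sum]
      apply Submodule.sum_mem
      intro j hj
      rw [smul_comm]
      apply Submodule.smul_mem
      rw [smul_eq_mul, ← mon_nsmul_single, ← mon_add]
      apply mon_mem_Sp
      apply add_le_add (Multiset.le_cons_self _ _)
      have hjd : q ^ j ≤ q ^ (d-1) := Nat.pow_le_pow_right hq (by have := Finset.mem_range.1 hj; omega)
      calc q ^ j • ({t} : Multiset Vt) ≤ q ^ (d-1) • {t} := nsmul_le_nsmul_left (Multiset.zero_le _) hjd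
        _ ≤ _ := nsmul_le_nsmul_right (Multiset.singleton_le.2 (hM t (Multiset.mem_cons_self _ _))) _

lemma DD_Sp [DecidableEq Vt] (q d : ℕ) (hq : 1 ≤ q) (w : ℕ → Ω) (Z : Multiset Vt) (M : Multiset Vt)
    (hM : ∀ t ∈ M, t ∈ Z) {g : MvPolynomial Vt Ω} (hg : g ∈ Sp Ω M) :
    DD q d w g ∈ Sp Ω (M + q ^ (d - 1) • Z) := by
  induction hg using Submodule.span_induction with
  | mem x hx =>
    obtain ⟨M', h', rfl⟩ := hx
    exact Sp_mono (by gcongr) (DD_mon q d hq w Z M' fun t ht => hM t (Multiset.mem_of_le h' ht))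
  | zero => simp
  | add x y _ _ hx hy => rw [map_add]; exact add_mem hx hy
  | smul c x _ hx => rw [Derivation.map_smul]; exact Submodule.smul_mem _ _ hx

lemma DD_iter [DecidableEq Vt] (q d : ℕ) (hq : 1 ≤ q) (w : ℕ → Ω) (Z : Multiset Vt) (M : Multiset Vt)
    (hM : ∀ t ∈ M, t ∈ Z) {g : MvPolynomial Vt Ω} (hg : g ∈ Sp Ω M) (l : ℕ) :
    (DD q d w)^[l] g ∈ Sp Ω (M + l • q ^ (d - 1) • Z) := by
  induction l with
  | zero => simpa using hg
  | succ l ih =>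
    rw [Function.iterate_succ_apply', succ_nsmul, ← add_assoc]
    apply DD_Sp q d hq w Z _ _ ih
    intro t ht
    rw [Multiset.mem_add] at ht
    rcases ht with ht | ht
    · exact hM t ht
    · exact Multiset.mem_of_mem_nsmul (Multiset.mem_of_mem_nsmul ht)

lemma DD_eval (q d : ℕ) (w : ℕ → Ω) (y : Vt → PowerSeries Ω) (lam : PowerSeries Ω)
    (hy : ∀ t, lam * PowerSeries.derivative Ω (y t) = ∑ j ∈ Finset.range d, w j • (y t) ^ q ^ j)
    (g : MvPolynomial Vt Ω) :
    MvPolynomial.aeval y (DD q d w g) = lam * PowerSeries.derivative Ω (MvPolynomial.aeval y g) := by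
  induction g using MvPolynomial.induction_on with
  | C a => 
    simp [DD]
  | add g h hg hh => simp [hg, hh, mul_add]
  | mul_X g t hg =>
    rw [Derivation.leibniz, map_add, smul_eq_mul, smul_eq_mul, map_mul, map_mul, map_mul, hg,
      Derivation.leibniz, MvPolynomial.aeval_X, smul_eq_mul, smul_eq_mul, mul_add]
    have : MvPolynomial.aeval y (DD q d w (MvPolynomial.X t)) = lam * PowerSeries.derivative Ω (y t) := by
      rw [hy, DD, MvPolynomial.mkDerivation_X, map_sum]
      simp
    rw [this]; ring

lemma DD_eval_iter (q d : ℕ) (w : ℕ → Ω) (y : Vt → PowerSeries Ω) (lam : PowerSeries Ω)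
    (hy : ∀ t, lam * PowerSeries.derivative Ω (y t) = ∑ j ∈ Finset.range d, w j • (y t) ^ q ^ j)
    (g : MvPolynomial Vt Ω) (l : ℕ) :
    MvPolynomial.aeval y ((DD q d w)^[l] g) =
      (fun z => lam * PowerSeries.derivative Ω z)^[l] (MvPolynomial.aeval y g) := by
  induction l with
  | zero => simp
  | succ l ih =>
    rw [Function.iterate_succ_apply', Function.iterate_succ_apply', DD_eval q d w y lam hy, ih]
end Der
end Chb

namespace Chb
open PowerSeries

set_option linter.unusedSectionVars false
section Step
variable {Ω : Type*} [Field Ω] [IsAlgClosed Ω] {O : Type*} [CommRing O] [IsDomain O] [Algebra Ω O]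
  {I : Type*} [Infinite I] {Vt : Type*} [DecidableEq Vt]

lemma LL_mon (v : Vt → O) (LL : Multiset Vt → Submodule Ω O)
    (h1 : 1 ∈ LL 0) (hmul : ∀ M M' x y, x ∈ LL M → y ∈ LL M' → x * y ∈ LL (M + M'))
    (hgen : ∀ t, v t ∈ LL {t}) (M : Multiset Vt) : (M.map v).prod ∈ LL M := by
  induction M using Multiset.induction with
  | empty => simpa using h1
  | cons t M ih =>
    rw [Multiset.map_cons, Multiset.prod_cons, ← Multiset.singleton_add]
    exact hmul _ _ _ _ (hgen t) ih

lemma LL_pow (LL : Multiset Vt → Submodule Ω O)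
    (h1 : 1 ∈ LL 0) (hmul : ∀ M M' x y, x ∈ LL M → y ∈ LL M' → x * y ∈ LL (M + M'))
    (M : Multiset Vt) (x : O) (hx : x ∈ LL M) (n : ℕ) : x ^ n ∈ LL (n • M) := by
  induction n with
  | zero => simpa using h1
  | succ n ih => rw [pow_succ, succ_nsmul]; exact hmul _ _ _ _ ih hx

lemma LL_Sp (v : Vt → O) (LL : Multiset Vt → Submodule Ω O)
    (h1 : 1 ∈ LL 0) (hmul : ∀ M M' x y, x ∈ LL M → y ∈ LL M' → x * y ∈ LL (M + M'))
    (hmono : ∀ M M', M ≤ M' → LL M ≤ LL M')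
    (hgen : ∀ t, v t ∈ LL {t}) (M : Multiset Vt) (g : MvPolynomial Vt Ω) (hg : g ∈ Sp Ω M) :
    MvPolynomial.aeval v g ∈ LL M := by
  induction hg using Submodule.span_induction with
  | mem x hx =>
    obtain ⟨M', h', rfl⟩ := hx
    apply hmono _ _ h'
    have : MvPolynomial.aeval v (mon Ω M') = (M'.map v).prod := by
      simp [mon, map_multiset_prod]
    rw [this]
    exact LL_mon v LL h1 hmul hgen M'
  | zero => simp
  | add x y _ _ hx hy => rw [map_add]; exact add_mem hx hy
  | smul c x _ hx => rw [map_smul]; exact Submodule.smul_mem _ _ hx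

/-- linear algebra: find nontrivial solution of linear conditions -/
lemma exists_sol (P : I → O →ₐ[Ω] PowerSeries Ω)
    (LL : Multiset Vt → Submodule Ω O) (h : ℕ)
    (hC1 : ∀ M, ∀ x ∈ LL M, x ≠ 0 → ∀ (T : Finset I) (ℓ : ℕ), (∀ i ∈ T, (X : PowerSeries Ω) ^ ℓ ∣ P i x) →
      ℓ * T.card ≤ h * Multiset.card M)
    {E : Type*} [Fintype E] (ℓ : ℕ) (M : ℕ → Multiset Vt) (y : ℕ → E → O)
    (hy : ∀ l < ℓ, ∀ e, y l e ∈ LL (M l))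
    (hcard : ∑ l ∈ Finset.range ℓ, (h * Multiset.card (M l) + 1) < Fintype.card E) :
    ∃ c : E → Ω, c ≠ 0 ∧ ∀ l < ℓ, ∑ e, c e • y l e = 0 := by
  classical
  obtain ⟨pt⟩ : Nonempty (ℕ ↪ I) := ⟨Infinite.natEmbedding I⟩
  let Ix := Σ l : Fin ℓ, Fin (h * Multiset.card (M l) + 1)
  let f : (E → Ω) →ₗ[Ω] (Ix → Ω) :=
    LinearMap.pi fun i => ∑ e, (LinearMap.proj e : (E → Ω) →ₗ[Ω] Ω).smulRight
      (constantCoeff (P (pt i.2) (y i.1 e)))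
  have hf : ∀ c i, f c i = constantCoeff (P (pt i.2) (∑ e, c e • y i.1 e)) := by
    intro c i
    simp [f, LinearMap.sum_apply]
  have hlt : Module.finrank Ω (Ix → Ω) < Module.finrank Ω (E → Ω) := by
    rw [Module.finrank_fintype_fun_eq_card, Module.finrank_fintype_fun_eq_card]
    simp only [Ix, Fintype.card_sigma, Fintype.card_fin]
    rwa [Finset.sum_fin_eq_sum_range, Finset.sum_congr rfl (g := fun l => h * Multiset.card (M l) + 1)]
    intro l hl
    simp [Finset.mem_range.1 hl]
  have hk := LinearMap.ker_ne_bot_of_finrank_lt (f := f) hlt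
  obtain ⟨c, hc, hc0⟩ := Submodule.exists_mem_ne_zero_of_ne_bot hk
  refine ⟨c, hc0, ?_⟩
  intro l hl
  by_contra hne
  have hmem : ∑ e, c e • y l e ∈ LL (M l) :=
    Submodule.sum_mem _ fun e _ => Submodule.smul_mem _ _ (hy l hl e)
  have := hC1 _ _ hmem hne ((Finset.range (h * Multiset.card (M l) + 1)).map pt) 1 (by
    intro i hi
    rw [Finset.mem_map] at hi
    obtain ⟨k, hk, rfl⟩ := hi
    rw [pow_one, X_dvd_iff, ← hf c ⟨⟨l, hl⟩, ⟨k, Finset.mem_range.1 hk⟩⟩]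
    rw [LinearMap.mem_ker.1 hc]; rfl)
  simp at this

theorem stepanov (p : ℕ) [Fact p.Prime] [CharP Ω p] (P : I → O →ₐ[Ω] PowerSeries Ω) (v : Vt → O)
    (LL : Multiset Vt → Submodule Ω O)
    (h1 : 1 ∈ LL 0) (hmul : ∀ M M' x y, x ∈ LL M → y ∈ LL M' → x * y ∈ LL (M + M'))
    (hmono : ∀ M M', M ≤ M' → LL M ≤ LL M')
    (hgen : ∀ t, v t ∈ LL {t}) (h : ℕ)
    (hC1 : ∀ M, ∀ x ∈ LL M, x ≠ 0 → ∀ (T : Finset I) (ℓ : ℕ), (∀ i ∈ T, (X : PowerSeries Ω) ^ ℓ ∣ P i x) →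
      ℓ * T.card ≤ h * Multiset.card M)
    (q d : ℕ) (hq : 1 ≤ q) (w : ℕ → Ω) (lam : I → PowerSeries Ω) (hlam : ∀ i, IsUnit (lam i))
    (hder : ∀ i t, lam i * derivative Ω (P i (v t)) = ∑ j ∈ Finset.range d, w j • (P i (v t)) ^ q ^ j)
    (ℓ R S ra sb : ℕ) (hR : R = p ^ ra) (hS : S = p ^ sb) (hℓ : ℓ = 1 ∨ (ℓ ≤ p ∧ 1 ≤ sb))
    (ψ : O →+* O) (hψc : ∀ c : Ω, ψ (algebraMap Ω O c) = algebraMap Ω O (c ^ (R * S)))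
    (π : Vt → Vt) (hψv : ∀ t, ψ (v t) = v (π t))
    (t1 : Vt) (Z : Multiset Vt) {J : Type*} [Fintype J] (ex : J → Multiset Vt) (m z : ℕ)
    (hz : Multiset.card Z = z)
    (hex : ∀ j, ex j ≤ m • Z)
    (hind : ∀ A, LinearIndependent Ω (fun e : Fin A × J => v t1 ^ (e.1 : ℕ) * ((ex e.2).map v).prod))
    (A B : ℕ) (hyp1 : h * (A + m * z) < S)
    (hyp2 : ∑ l ∈ Finset.range ℓ, (h * (R * (A + m * z + l * (q ^ (d - 1) * (z + 1))) + (B + m * z)) + 1)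
      < ((A + 1) * Fintype.card J) * ((B + 1) * Fintype.card J))
    (T : Finset I) (hT : ∀ i ∈ T, ∀ x, constantCoeff (P i x) ^ (R * S) = constantCoeff (P i (ψ x))) :
    ℓ * T.card ≤ h * (A + m * z) + S * (h * (B + m * z)) := by
  classical
  have hp : p.Prime := Fact.out
  have : CharP (PowerSeries Ω) p := charP_of_injective_algebraMap (algebraMap Ω (PowerSeries Ω)).injective p
  let Z' := t1 ::ₘ Z
  let MA := A • ({t1} : Multiset Vt) + m • Z
  let MB := B • ({t1} : Multiset Vt) + m • Z
  have cMA : Multiset.card MA = A + m * z := by simp [MA, hz]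
  have cMB : Multiset.card MB = B + m * z := by simp [MB, hz]
  have hMAZ : ∀ t ∈ MA, t ∈ Z' := by
    intro t ht
    simp only [MA, Multiset.mem_add] at ht
    rcases ht with ht | ht
    · have := Multiset.mem_of_mem_nsmul ht
      simp at this
      simp [Z', this]
    · exact Multiset.mem_cons_of_mem (Multiset.mem_of_mem_nsmul ht)
  let mm : ∀ n, Fin (n + 1) × J → Multiset Vt := fun n e => (e.1 : ℕ) • {t1} + ex e.2
  have hmm : ∀ n e, mm n e ≤ n • ({t1} : Multiset Vt) + m • Z := by
    intro n e
    exact add_le_add (nsmul_le_nsmul_left (Multiset.zero_le _) (Nat.lt_succ_iff.1 e.1.2)) (hex _)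
  have hmv : ∀ n e, ((mm n e).map v).prod = v t1 ^ (e.1 : ℕ) * ((ex e.2).map v).prod := by
    intro n e
    simp [mm, Multiset.map_nsmul, Multiset.prod_nsmul]
  have hind' : ∀ n, LinearIndependent Ω (fun e : Fin (n+1) × J => ((mm n e).map v).prod) := by
    intro n
    simpa only [hmv] using hind (n+1)
  have haev : ∀ M : Multiset Vt, MvPolynomial.aeval v (mon Ω M) = (M.map v).prod := by
    intro M; simp [mon, map_multiset_prod]
  let a : ℕ → Fin (A+1) × J → O := fun l e => MvPolynomial.aeval v ((DD q d w)^[l] (mon Ω (mm A e)))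
  let b : Fin (B+1) × J → O := fun e => ((mm B e).map v).prod
  have ha : ∀ l e, a l e ∈ LL (MA + l • q ^ (d-1) • Z') := by
    intro l e
    apply LL_Sp v LL h1 hmul hmono hgen
    exact DD_iter q d hq w Z' MA hMAZ (mon_mem_Sp (hmm A e)) l
  have hb : ∀ e, b e ∈ LL MB := fun e => hmono _ _ (hmm B e) (LL_mon v LL h1 hmul hgen _)
  have hψb : ∀ e, ψ (b e) ∈ LL (MB.map π) := by
    intro e
    have : ψ (b e) = (((mm B e).map π).map v).prod := by
      simp [b, map_multiset_prod, hψv]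
    rw [this]
    exact hmono _ _ (Multiset.map_le_map (hmm B e)) (LL_mon v LL h1 hmul hgen _)
  obtain ⟨c, hc0, hc⟩ := exists_sol P LL h hC1 (E := (Fin (A+1) × J) × (Fin (B+1) × J)) ℓ
    (fun l => R • (MA + l • q ^ (d-1) • Z') + MB.map π)
    (fun l e => (a l e.1) ^ R * ψ (b e.2))
    (by
      intro l _ e
      exact hmul _ _ _ _ (LL_pow LL h1 hmul _ _ (ha l e.1) R) (hψb _))
    (by
      convert hyp2 using 1
      · apply Finset.sum_congr rfl
        intro l _
        simp only [Multiset.card_add, Multiset.card_nsmul, Multiset.card_map, cMA, cMB, Z', Multiset.card_cons, hz]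
      · simp)
  have hQ : 0 < R * S := by rw [hR, hS]; exact Nat.mul_pos (pow_pos hp.pos _) (pow_pos hp.pos _)
  have hrt : ∀ x : Ω, ∃ y : Ω, y ^ (R * S) = x := fun x => IsAlgClosed.exists_pow_nat_eq x hQ
  choose r hr using hrt
  let be : Fin (A+1) × J → O := fun e => ∑ e', r (c (e, e')) • b e'
  have hbe : ∀ e, be e ∈ LL MB := fun e => Submodule.sum_mem _ fun e' _ => Submodule.smul_mem _ _ (hb e')
  have hψbe : ∀ e, ψ (be e) = ∑ e', c (e, e') • ψ (b e') := by
    intro e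
    simp only [be, map_sum]
    apply Finset.sum_congr rfl
    intro e' _
    rw [Algebra.smul_def, map_mul, hψc, hr, ← Algebra.smul_def]
  have hlin : ∀ l < ℓ, ∑ e, (a l e) ^ R * ψ (be e) = 0 := by
    intro l hl
    rw [← hc l hl, Fintype.sum_prod_type (f := fun e : (Fin (A+1) × J) × (Fin (B+1) × J) => c e • (a l e.1 ^ R * ψ (b e.2)))]
    apply Finset.sum_congr rfl
    intro e _
    rw [hψbe, Finset.mul_sum]
    apply Finset.sum_congr rfl
    intro e' _
    rw [mul_smul_comm]
  let H := ∑ e, a 0 e * (be e) ^ S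
  have hHmem : H ∈ LL (MA + S • MB) := by
    apply Submodule.sum_mem
    intro e _
    exact hmul _ _ _ _ (by simpa using ha 0 e) (LL_pow LL h1 hmul _ _ (hbe e) S)
  have ha0 : ∀ e, a 0 e = ((mm A e).map v).prod := fun e => haev _
  have hH0 : H ≠ 0 := by
    intro hH
    obtain ⟨i⟩ : Nonempty I := inferInstance
    have hex1 : ∃ e, P i (be e) ≠ 0 := by
      obtain ⟨⟨e, e'⟩, hce⟩ := Function.ne_iff.1 hc0
      refine ⟨e, fun h0 => ?_⟩
      have hne : be e ≠ 0 := by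
        intro hbe0
        have := Fintype.linearIndependent_iff.1 (hind' B) (fun e' => r (c (e, e'))) hbe0 e'
        apply hce
        rw [← hr (c (e, e')), this, zero_pow hQ.ne']; rfl
      have := hC1 _ _ (hbe e) hne {i} (h * Multiset.card MB + 1) (by
        intro i' hi'
        rw [Finset.mem_singleton.1 hi', h0]; exact dvd_zero _)
      simp at this
    obtain ⟨n, γ, hγ, e0, he0⟩ := ps_common (fun e => P i (be e)) hex1
    have hsum : ∑ e, P i (a 0 e) * γ e ^ S = 0 := by
      have h3 : (X : PowerSeries Ω) ^ (n * S) * ∑ e, P i (a 0 e) * γ e ^ S = 0 := by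
        rw [← map_zero (P i), ← hH, map_sum, Finset.mul_sum]
        apply Finset.sum_congr rfl
        intro e _
        rw [map_mul, map_pow, hγ e, mul_pow, ← pow_mul]; ring
      exact (mul_eq_zero.1 h3).resolve_left (pow_ne_zero _ X_ne_zero)
    let x := ∑ e, (constantCoeff (γ e) ^ S) • a 0 e
    have hxm : x ∈ LL MA := Submodule.sum_mem _ fun e _ => Submodule.smul_mem _ _ (by simpa using ha 0 e)
    have hx0 : x ≠ 0 := by
      intro hx
      have := Fintype.linearIndependent_iff.1 (hind' A) (fun e => constantCoeff (γ e) ^ S)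
        (by simpa only [x, ha0] using hx) e0
      exact he0 (eq_zero_of_pow_eq_zero this)
    have := hC1 _ _ hxm hx0 {i} S (by
      intro i' hi'
      rw [Finset.mem_singleton.1 hi']
      have h4 : P i x = - ∑ e, P i (a 0 e) * (γ e ^ S - C (constantCoeff (γ e) ^ S)) := by
        simp only [mul_sub, Finset.sum_sub_distrib, hsum, x, map_sum, map_smul]
        rw [zero_sub, neg_neg]
        apply Finset.sum_congr rfl
        intro e _
        rw [mul_comm, smul_eq_C_mul]
      rw [h4, dvd_neg]
      apply Finset.dvd_sum
      intro e _
      apply Dvd.dvd.mul_left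
      rw [hS]
      exact ps_pow_mod p sb (γ e))
    rw [cMA] at this
    simp at this
    omega
  have hfin := hC1 _ H hHmem hH0 T ℓ (by
    intro i hi
    apply ps_order p (lam i) (hlam i) ℓ (by rcases hℓ with h | h; · rw [h]; exact hp.one_le
                                            · exact h.1)
    intro l hl
    have e1 : (fun y => lam i * derivative Ω y)^[l] (P i H) = ∑ e, P i (a l e) * (P i (be e)) ^ S := by
      have hPa : ∀ l e, P i (a l e) = (fun y => lam i * derivative Ω y)^[l] (P i (a 0 e)) := by
        intro l e
        have h5 : ∀ g : MvPolynomial Vt Ω, P i (MvPolynomial.aeval v g) = MvPolynomial.aeval (fun t => P i (v t)) g := by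
          intro g
          rw [← AlgHom.comp_apply, MvPolynomial.comp_aeval]
        simp only [a, h5]
        rw [DD_eval_iter q d w (fun t => P i (v t)) (lam i) (hder i)]
        rfl
      rcases hℓ with h6 | h6
      · have : l = 0 := by omega
        subst this
        simp [H]
      · have hd0 : ∀ e, derivative Ω ((P i (be e)) ^ S) = 0 := by
          intro e
          rw [derivative_pow]
          have : ((S : ℕ) : PowerSeries Ω) = 0 := by
            rw [CharP.cast_eq_zero_iff _ p, hS]
            exact dvd_pow_self _ (by omega)
          rw [this]; simp
        clear hl
        induction l with
        | zero => simp [H]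
        | succ l ih =>
          rw [Function.iterate_succ_apply', ih, map_sum, Finset.mul_sum]
          apply Finset.sum_congr rfl
          intro e _
          rw [Derivation.leibniz, hd0, hPa (l+1), Function.iterate_succ_apply', ← hPa l]
          simp only [smul_eq_mul]
          ring
    have hRne : R ≠ 0 := by rw [hR]; exact pow_ne_zero _ hp.ne_zero
    rw [← pow_eq_zero_iff hRne, e1, map_sum, hR, sum_pow_char_pow]
    have := congrArg (fun x => constantCoeff (P i x)) (hlin l hl)
    simp only [map_sum, map_mul, map_zero, map_pow] at this
    rw [← this]
    apply Finset.sum_congr rfl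
    intro e _
    rw [map_mul, map_pow, mul_pow, ← hR, ← pow_mul, mul_comm S R, hT i hi])
  simp only [Multiset.card_add, Multiset.card_nsmul, cMA, cMB] at hfin
  calc _ ≤ _ := hfin
    _ = _ := by ring
end Step
end Chb

namespace Chb
open Polynomial

section Gauss
variable {L : Type*} [Field L] {Γ₀ : Type*} [LinearOrderedCommGroupWithZero Γ₀] (w : Valuation L Γ₀)

lemma gauss1 (g : L[X]) (v : L) (B : Γ₀) (h : ∀ i, w (((X - C v) * g).coeff i) ≤ B) (i : ℕ) :
    w (g.coeff i) * max 1 (w v) ≤ B := by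
  have hs : ∀ i, ((X - C v) * g).coeff (i+1) = g.coeff i - v * g.coeff (i+1) := by
    intro i; rw [sub_mul, coeff_sub, coeff_X_mul, coeff_C_mul]
  have h0 : ((X - C v) * g).coeff 0 = - (v * g.coeff 0) := by
    rw [sub_mul, coeff_sub, coeff_X_mul_zero, coeff_C_mul, zero_sub]
  rcases le_or_gt (w v) 1 with hv | hv
  · rw [max_eq_left hv, mul_one]
    have key : ∀ k i, g.natDegree < i + k → w (g.coeff i) ≤ B := by
      intro k
      induction k with
      | zero =>
        intro i hi
        rw [coeff_eq_zero_of_natDegree_lt (by omega), map_zero]; exact zero_le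
      | succ k ih =>
        intro i hi
        have h1 := ih (i+1) (by omega)
        have h2 : g.coeff i = ((X - C v) * g).coeff (i+1) + v * g.coeff (i+1) := by rw [hs]; ring
        rw [h2]
        refine (w.map_add _ _).trans (max_le (h _) ?_)
        rw [map_mul]
        exact (mul_le_of_le_one_left' hv).trans h1
    exact key (g.natDegree + 1) i (by omega)
  · rw [max_eq_right hv.le, mul_comm, ← map_mul]
    induction i with
    | zero => have := h 0; rw [h0, Valuation.map_neg] at this; exact this
    | succ i ih =>
      have h2 : v * g.coeff (i+1) = g.coeff i - ((X - C v) * g).coeff (i+1) := by rw [hs]; ring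
      rw [h2]
      refine (w.map_sub _ _).trans (max_le ?_ (h _))
      refine le_trans ?_ ih
      rw [map_mul]
      exact le_mul_of_one_le_left' hv.le

lemma gauss2 (M : Multiset L) (g : L[X]) (B : Γ₀)
    (h : ∀ i, w (((M.map fun v => X - C v).prod * g).coeff i) ≤ B) (i : ℕ) :
    w (g.coeff i) * (M.map fun v => max 1 (w v)).prod ≤ B := by
  induction M using Multiset.induction generalizing B with
  | empty => simpa using h i
  | cons v M ih =>
    rw [Multiset.map_cons, Multiset.prod_cons]
    have hpos : 0 < max 1 (w v) := lt_of_lt_of_le zero_lt_one (le_max_left _ _)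
    have h1 := gauss1 w ((M.map fun v => X - C v).prod * g) v B (by
      intro i
      have := h i
      rwa [Multiset.map_cons, Multiset.prod_cons, mul_assoc] at this)
    have h2 := ih (B / max 1 (w v)) (by
      intro i
      rw [le_div_iff₀ hpos]
      exact h1 i)
    rw [le_div_iff₀ hpos] at h2
    calc _ = _ := by rw [mul_comm (max 1 (w v)), mul_assoc]
      _ ≤ _ := h2
end Gauss

section Height
variable {𝕜 F L : Type*} [Field 𝕜] [Field F] [Field L] [Algebra 𝕜[X] F] [IsFractionRing 𝕜[X] F]
  [Algebra F L] [FiniteDimensional F L] [IsGalois F L] [Algebra 𝕜[X] L] [IsScalarTower 𝕜[X] F L]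
  [Algebra 𝕜 L] [IsScalarTower 𝕜 𝕜[X] L]
  {Γ₀ : Type*} [LinearOrderedCommGroupWithZero Γ₀] (w : Valuation L Γ₀)

lemma w_poly (hc : ∀ c : 𝕜, c ≠ 0 → w (algebraMap 𝕜 L c) = 1) (hs : 1 < w (algebraMap 𝕜[X] L X))
    (g : 𝕜[X]) (hg : g ≠ 0) : w (algebraMap 𝕜[X] L g) = w (algebraMap 𝕜[X] L X) ^ g.natDegree := by
  have hC : ∀ c : 𝕜, algebraMap 𝕜[X] L (C c) = algebraMap 𝕜 L c := by
    intro c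
    rw [IsScalarTower.algebraMap_apply 𝕜 𝕜[X] L]; rfl
  have hw : ∀ (c : 𝕜) i, w (algebraMap 𝕜[X] L (C c * X ^ i)) ≤ w (algebraMap 𝕜[X] L X) ^ i := by
    intro c i
    rw [map_mul, map_pow, map_mul, map_pow, hC]
    by_cases h : c = 0
    · simp [h]
    · rw [hc c h, one_mul]
  have h1 : w (algebraMap 𝕜[X] L (C g.leadingCoeff * X ^ g.natDegree)) =
      w (algebraMap 𝕜[X] L X) ^ g.natDegree := by
    rw [map_mul, map_pow, map_mul, map_pow, hC, hc _ (leadingCoeff_ne_zero.2 hg), one_mul]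
  have h2 : w (algebraMap 𝕜[X] L g.eraseLead) < w (algebraMap 𝕜[X] L X) ^ g.natDegree := by
    rw [g.eraseLead.as_sum_support_C_mul_X_pow, map_sum]
    apply Valuation.map_sum_lt
    · exact pow_ne_zero _ (zero_lt_one.trans hs).ne'
    · intro i hi
      refine (hw _ i).trans_lt ?_
      apply pow_lt_pow_right₀ hs
      exact lt_of_le_of_ne ((le_natDegree_of_mem_supp _ hi).trans (eraseLead_natDegree_le_aux))
        (by rintro rfl; simp at hi)
  conv_lhs => rw [← eraseLead_add_C_mul_X_pow g, map_add]
  rw [Valuation.map_add_eq_of_lt_right w (by rwa [h1]), h1]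

open scoped Classical in
lemma norm_deg (hc : ∀ c : 𝕜, c ≠ 0 → w (algebraMap 𝕜 L c) = 1) (hs : 1 < w (algebraMap 𝕜[X] L X))
    (x : L) (hx : IsIntegral 𝕜[X] x) (hx0 : x ≠ 0) (b : (L ≃ₐ[F] L) → Γ₀) (hb : ∀ σ, w (σ x) ≤ b σ)
    (k : ℕ) (hk : ∏ σ, b σ ≤ w (algebraMap 𝕜[X] L X) ^ k) :
    ∃ n : 𝕜[X], n ≠ 0 ∧ n.natDegree ≤ k ∧ algebraMap 𝕜[X] L n = ∏ σ : L ≃ₐ[F] L, σ x := by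
  have h1 : IsIntegral 𝕜[X] (Algebra.norm F x) := Algebra.isIntegral_norm F hx
  obtain ⟨n, hn⟩ := IsIntegrallyClosed.isIntegral_iff.1 h1
  have h2 : algebraMap 𝕜[X] L n = ∏ σ : L ≃ₐ[F] L, σ x := by
    rw [IsScalarTower.algebraMap_apply 𝕜[X] F L, hn, Algebra.norm_eq_prod_automorphisms]
  have hn0 : n ≠ 0 := by
    rintro rfl
    rw [map_zero] at h2
    obtain ⟨σ, _, hσ⟩ := Finset.prod_eq_zero_iff.1 h2.symm
    exact hx0 (by simpa using hσ)
  refine ⟨n, hn0, ?_, h2⟩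
  have h3 : w (algebraMap 𝕜[X] L X) ^ n.natDegree ≤ w (algebraMap 𝕜[X] L X) ^ k := by
    rw [← w_poly w hc hs n hn0, h2, map_prod]
    refine le_trans ?_ hk
    exact Finset.prod_le_prod' fun σ _ => hb σ
  exact (pow_le_pow_iff_right₀ hs).1 h3

end Height

section Pts
lemma C1_pts {𝕜 : Type*} [Field 𝕜] {g : Type*} (s : g → 𝕜) (hsinj : Function.Injective s)
    {Gt : Type*} [Fintype Gt]
    (P : g × Gt → PowerSeries 𝕜) (k : ℕ) (n : 𝕜[X]) (hn0 : n ≠ 0)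
    (hnk : n.natDegree ≤ k)
    (hP : ∀ i, (Polynomial.taylor (s i) n : PowerSeries 𝕜) = ∏ σ : Gt, P (i, σ))
    (T : Finset (g × Gt)) (ℓ : ℕ)
    (hT : ∀ i ∈ T, (PowerSeries.X : PowerSeries 𝕜) ^ ℓ ∣ P i) : ℓ * T.card ≤ k := by
  classical
  have key : ∀ i, ℓ * (T.filter fun a => a.1 = i).card ≤ n.roots.count (s i) := by
    intro i
    rw [count_roots, le_rootMultiplicity_iff hn0]
    have h1 : (PowerSeries.X : PowerSeries 𝕜) ^ (ℓ * (T.filter fun a => a.1 = i).card) ∣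
        (Polynomial.taylor (s i) n : PowerSeries 𝕜) := by
      rw [hP]
      let S : Finset Gt := (T.filter fun a => a.1 = i).image Prod.snd
      have hS : S.card = (T.filter fun a => a.1 = i).card := by
        apply Finset.card_image_of_injOn
        rintro ⟨a, b⟩ ha ⟨c, d⟩ hc (h : b = d)
        simp only [Finset.coe_filter, Set.mem_ofPred_eq] at ha hc
        rw [ha.2, hc.2, h]
      have h2 : (PowerSeries.X : PowerSeries 𝕜) ^ (ℓ * (T.filter fun a => a.1 = i).card) ∣ ∏ σ ∈ S, P (i, σ) := by
        rw [pow_mul, ← hS, ← Finset.prod_const]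
        apply Finset.prod_dvd_prod_of_dvd
        intro σ hσ
        apply hT
        simp only [S, Finset.mem_image, Finset.mem_filter] at hσ
        obtain ⟨a, ⟨ha, rfl⟩, rfl⟩ := hσ
        exact ha
      exact h2.trans (Finset.prod_dvd_prod_of_subset _ _ _ (Finset.subset_univ _))
    have h3 : (X : 𝕜[X]) ^ (ℓ * (T.filter fun a => a.1 = i).card) ∣ Polynomial.taylor (s i) n := by
      rw [Polynomial.X_pow_dvd_iff]
      intro d hd
      have := PowerSeries.X_pow_dvd_iff.1 h1 d hd
      simpa using this
    have h4 : (X : 𝕜[X]) ^ (ℓ * (T.filter fun a => a.1 = i).card) =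
        Polynomial.taylorEquiv (s i) ((X - C (s i)) ^ (ℓ * (T.filter fun a => a.1 = i).card)) := by
      have : Polynomial.taylorEquiv (s i) (X - C (s i)) = X := by
        change Polynomial.taylor (s i) (X - C (s i)) = X
        simp
      rw [map_pow, this]
    have h5 : Polynomial.taylor (s i) n = Polynomial.taylorEquiv (s i) n := rfl
    rw [h4, h5] at h3
    exact (map_dvd_iff (Polynomial.taylorEquiv (s i))).1 h3
  calc ℓ * T.card = ∑ i ∈ T.image Prod.fst, ℓ * (T.filter fun a => a.1 = i).card := by
        rw [← Finset.mul_sum, Finset.card_eq_sum_card_image Prod.fst T]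
    _ ≤ ∑ i ∈ T.image Prod.fst, n.roots.count (s i) := Finset.sum_le_sum fun i _ => key i
    _ = ∑ a ∈ (T.image Prod.fst).image s, n.roots.count a := by
        rw [Finset.sum_image (f := fun a => n.roots.count a) (g := s)]
        intro a _ b _ h; exact hsinj h
    _ ≤ ∑ a ∈ (T.image Prod.fst).image s ∪ n.roots.toFinset, n.roots.count a :=
        Finset.sum_le_sum_of_subset Finset.subset_union_left
    _ = Multiset.card n.roots := Multiset.sum_count_eq_card (by
        intro a ha; exact Finset.mem_union_right _ (Multiset.mem_toFinset.2 ha))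
    _ ≤ n.natDegree := card_roots' n
    _ ≤ k := hnk
end Pts
end Chb

namespace Chb
open Polynomial
set_option linter.unusedSectionVars false

section Lin
variable {𝕜 : Type*} [Field 𝕜]

noncomputable def lp1 (q : ℕ) (c : ℕ → 𝕜) (N : ℕ) : 𝕜[X] :=
  ∑ j ∈ Finset.range N, C (c j) * X ^ (q ^ j - 1)

structure Hyp (𝕜 : Type*) [Field 𝕜] (p e q d : ℕ) (u w : ℕ → 𝕜) : Prop where
  hp : p.Prime
  he : 1 ≤ e
  hq : q = p ^ e
  hd : 1 ≤ d
  ch : CharP 𝕜 p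
  hud : u d = 1
  cop : IsCoprime (lp1 q u (d+1)) (lp1 q w d)
  hW : lp1 q w d ≠ 0
  h0 : u 0 ≠ 0 ∨ w 0 ≠ 0

variable {p e q d : ℕ} {u w : ℕ → 𝕜}

lemma Hyp.q2 (H : Hyp 𝕜 p e q d u w) : 2 ≤ q := by
  rw [H.hq]; exact H.hp.two_le.trans (Nat.le_self_pow (by have := H.he; omega) p)

lemma Hyp.qd2 (H : Hyp 𝕜 p e q d u w) : q ≤ q ^ d := Nat.le_self_pow (by have := H.hd; omega) q

noncomputable def BB (q d : ℕ) (u w : ℕ → 𝕜) : 𝕜[X][X] :=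
  (lp1 q u (d+1)).map C - C X * (lp1 q w d).map C

lemma lp1_deg (hq : 2 ≤ q) (c : ℕ → 𝕜) : (lp1 q c d).degree < ((q ^ d - 1 : ℕ) : WithBot ℕ) := by
  rw [← mem_degreeLT]
  apply Submodule.sum_mem
  intro j hj
  rw [mem_degreeLT]
  refine (degree_C_mul_X_pow_le _ _).trans_lt ?_
  norm_cast
  have h1 : q ^ j < q ^ d := Nat.pow_lt_pow_right (by omega) (Finset.mem_range.1 hj)
  have h2 : 1 ≤ q ^ j := Nat.one_le_pow _ _ (by omega)
  omega

lemma BB_eq (H : Hyp 𝕜 p e q d u w) :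
    BB q d u w = X ^ (q ^ d - 1) + ((lp1 q u d).map C - C X * (lp1 q w d).map C) := by
  rw [BB]
  have : lp1 q u (d+1) = lp1 q u d + X ^ (q ^ d - 1) := by
    rw [lp1, Finset.sum_range_succ, H.hud, C_1, one_mul]; rfl
  rw [this]
  simp only [Polynomial.map_add, Polynomial.map_pow, map_X]
  ring

lemma BB_low (H : Hyp 𝕜 p e q d u w) :
    ((lp1 q u d).map C - C X * (lp1 q w d).map C : 𝕜[X][X]).degree < ((q ^ d - 1 : ℕ) : WithBot ℕ) := by
  refine (degree_sub_le _ _).trans_lt (max_lt ?_ ?_)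
  · exact degree_map_le.trans_lt (lp1_deg H.q2 u)
  · rw [← mem_degreeLT, C_mul']
    exact Submodule.smul_mem _ _ (mem_degreeLT.2 (degree_map_le.trans_lt (lp1_deg H.q2 w)))

lemma BB_monic (H : Hyp 𝕜 p e q d u w) : (BB q d u w).Monic := by
  rw [BB_eq H]
  exact monic_X_pow_add (BB_low H)

lemma BB_natDegree (H : Hyp 𝕜 p e q d u w) : (BB q d u w).natDegree = q ^ d - 1 := by
  apply natDegree_eq_of_degree_eq_some
  rw [BB_eq H, degree_add_eq_left_of_degree_lt, degree_X_pow]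
  rw [degree_X_pow]; exact BB_low H

lemma BB_irr (H : Hyp 𝕜 p e q d u w) : Irreducible (BB q d u w) := by
  have h1 : Irreducible (C (lp1 q w d) * X + C (-(lp1 q u (d+1))) : 𝕜[X][X]) :=
    irreducible_C_mul_X_add_C H.hW (H.cop.symm.neg_right.isRelPrime)
  have h2 : Bivariate.swap (BB q d u w) = - (C (lp1 q w d) * X + C (-(lp1 q u (d+1))) : 𝕜[X][X]) := by
    rw [BB, map_sub, map_mul, Bivariate.swap_map_C, Bivariate.swap_map_C, Bivariate.swap_X]
    simp only [C_neg]; ring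
  rw [← MulEquiv.irreducible_iff (Bivariate.swap (R := 𝕜)), h2]
  exact (Associated.neg_left (Associated.refl _)).irreducible_iff.2 h1

section
variable {F L : Type*} [Field F] [Field L] [Algebra 𝕜[X] F] [IsFractionRing 𝕜[X] F]
  [Algebra F L] [Algebra 𝕜[X] L] [IsScalarTower 𝕜[X] F L]
  [Algebra 𝕜 L] [IsScalarTower 𝕜 𝕜[X] L]

noncomputable def PF (F : Type*) [Field F] [Algebra 𝕜[X] F] (q d : ℕ) (u w : ℕ → 𝕜) : F[X] :=
  (BB q d u w).map (algebraMap 𝕜[X] F)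

lemma PF_irr (H : Hyp 𝕜 p e q d u w) : Irreducible (PF F q d u w) :=
  ((BB_monic H).irreducible_iff_irreducible_map_fraction_map (K := F)).1 (BB_irr H)

lemma PF_monic (H : Hyp 𝕜 p e q d u w) : (PF F q d u w).Monic := (BB_monic H).map _

lemma PF_natDegree (H : Hyp 𝕜 p e q d u w) : (PF F q d u w).natDegree = q ^ d - 1 := by
  rw [PF, (BB_monic H).natDegree_map, BB_natDegree H]

/-- linearized evaluation -/
def ev {A : Type*} [CommRing A] [Algebra 𝕜 A] (q : ℕ) (c : ℕ → 𝕜) (N : ℕ) (x : A) : A :=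
  ∑ j ∈ Finset.range N, c j • x ^ q ^ j

lemma mul_lp1 {A : Type*} [CommRing A] [Algebra 𝕜 A] (hq : 1 ≤ q) (c : ℕ → 𝕜) (N : ℕ) (x : A) :
    x * aeval x (lp1 q c N) = ev q c N x := by
  rw [lp1, ev, map_sum, Finset.mul_sum]
  apply Finset.sum_congr rfl
  intro j _
  have : q ^ j = q ^ j - 1 + 1 := (Nat.sub_add_cancel (Nat.one_le_pow _ _ hq)).symm
  rw [map_mul, aeval_C, map_pow, aeval_X]
  nth_rewrite 2 [this]
  rw [pow_succ, Algebra.smul_def]; ring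

/-- evaluating BB through a ring hom to `A` -/
lemma eval_BB {A : Type*} [CommRing A] [Algebra 𝕜 A] (χ : 𝕜[X] →+* A)
    (hχ : ∀ c, χ (C c) = algebraMap 𝕜 A c) (hq : 1 ≤ q) (x : A) :
    x * ((BB q d u w).map χ).eval x = ev q u (d+1) x - χ X * ev q w d x := by
  have hC : χ.comp C = algebraMap 𝕜 A := RingHom.ext hχ
  rw [BB, Polynomial.map_sub, Polynomial.map_mul, map_C, map_map, map_map, hC, eval_sub, eval_mul, eval_C,
    ← mul_lp1 hq, ← mul_lp1 hq, aeval_def, aeval_def, eval_map, eval_map]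
  ring

lemma eval_PF (hq : 1 ≤ q) (x : L) :
    x * aeval x (PF F q d u w) = ev q u (d+1) x - algebraMap 𝕜[X] L X * ev q w d x := by
  rw [← eval_BB (algebraMap 𝕜[X] L) (fun c => (IsScalarTower.algebraMap_apply 𝕜 𝕜[X] L c).symm) hq,
    PF, aeval_map_algebraMap, eval_map, aeval_def]

lemma BB_coeff0 (hq : 2 ≤ q) (hd : 1 ≤ d) : (BB q d u w).coeff 0 = C (u 0) - X * C (w 0) := by
  have h : ∀ (c : ℕ → 𝕜) N, 1 ≤ N → (lp1 q c N).coeff 0 = c 0 := by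
    intro c N hN
    rw [lp1, finsetSum_coeff, Finset.sum_eq_single 0]
    · simp
    · intro j _ hj
      rw [coeff_C_mul, coeff_X_pow, if_neg, mul_zero]
      have := Nat.one_lt_pow hj hq
      omega
    · intro h; simp at h; omega
  rw [BB, coeff_sub, coeff_C_mul, coeff_map, coeff_map, h _ _ (by omega), h _ _ hd]

lemma root_ne_zero (H : Hyp 𝕜 p e q d u w) (x : L) (hx : aeval x (PF F q d u w) = 0) : x ≠ 0 := by
  rintro rfl
  rw [PF, aeval_map_algebraMap, aeval_def, eval₂_at_zero, BB_coeff0 H.q2 H.hd] at hx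
  have hinj : Function.Injective (algebraMap 𝕜[X] L) := by
    rw [IsScalarTower.algebraMap_eq 𝕜[X] F L]
    exact (algebraMap F L).injective.comp (IsFractionRing.injective 𝕜[X] F)
  rw [map_eq_zero_iff _ hinj] at hx
  have h1 := congrArg (fun g => coeff g 0) hx
  have h2 := congrArg (fun g => coeff g 1) hx
  simp at h1 h2
  rcases H.h0 with h | h
  · exact h h1
  · exact h (by simpa [coeff_C] using h2)

lemma root_iff (H : Hyp 𝕜 p e q d u w) (x : L) : aeval x (PF F q d u w) = 0 ↔
    x ≠ 0 ∧ ev q u (d+1) x = algebraMap 𝕜[X] L X * ev q w d x := by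
  constructor
  · intro h
    refine ⟨root_ne_zero H x h, ?_⟩
    rw [← sub_eq_zero, ← eval_PF (F := F) (by have := H.q2; omega), h, mul_zero]
  · rintro ⟨h1, h2⟩
    rw [← sub_eq_zero, ← eval_PF (F := F) (by have := H.q2; omega)] at h2
    exact (mul_eq_zero.1 h2).resolve_left h1

lemma PF_sep (H : Hyp 𝕜 p e q d u w) : (PF F q d u w).Separable := by
  have := H.ch
  have hq1 : 1 ≤ q := by have := H.q2; omega
  -- consider X * PF
  have hX : X * PF F q d u w = ∑ j ∈ Finset.range (d+1),
      C (algebraMap 𝕜[X] F (C (u j))) * X ^ q ^ j -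
      C (algebraMap 𝕜[X] F X) * ∑ j ∈ Finset.range d, C (algebraMap 𝕜[X] F (C (w j))) * X ^ q ^ j := by
    have hh : ∀ (c : ℕ → 𝕜) N, X * ((lp1 q c N).map (C : 𝕜 →+* 𝕜[X])).map (algebraMap 𝕜[X] F) =
        ∑ j ∈ Finset.range N, C (algebraMap 𝕜[X] F (C (c j))) * X ^ q ^ j := by
      intro c N
      rw [lp1, Polynomial.map_sum, Polynomial.map_sum, Finset.mul_sum]
      apply Finset.sum_congr rfl
      intro j _
      have : q ^ j = q ^ j - 1 + 1 := (Nat.sub_add_cancel (Nat.one_le_pow _ _ hq1)).symm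
      simp only [Polynomial.map_mul, Polynomial.map_pow, map_C, map_X]
      nth_rewrite 2 [this]
      rw [pow_succ]; ring
    rw [PF, BB, Polynomial.map_sub, Polynomial.map_mul, mul_sub, hh, map_C, mul_left_comm, hh]
  have hqF : ((q : ℕ) : F[X]) = 0 := by
    have h1 : ((q : ℕ) : 𝕜) = 0 := by
      rw [CharP.cast_eq_zero_iff 𝕜 p, H.hq]; exact dvd_pow_self _ (by have := H.he; omega)
    have h2 := congrArg (fun c => (C (algebraMap 𝕜[X] F (C c)) : F[X])) h1
    simpa using h2
  have hder : ∀ (c : ℕ → F) N, 1 ≤ N → derivative (∑ j ∈ Finset.range N, C (c j) * X ^ q ^ j) = C (c 0) := by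
    intro c N hN
    obtain ⟨N, rfl⟩ : ∃ N', N = N' + 1 := ⟨N - 1, by omega⟩
    rw [Finset.sum_range_succ', derivative_add, derivative_sum, Finset.sum_eq_zero]
    · simp
    · intro j _
      rw [derivative_C_mul, derivative_X_pow]
      have : ((q ^ (j+1) : ℕ) : F) = 0 := by
        have h3 : ((q : ℕ) : F) = 0 := by
          have := congrArg (fun g => coeff g 0) hqF
          simpa using this
        rw [Nat.cast_pow, h3]; simp
      rw [this]; simp
  apply Separable.of_mul_right (f := X)
  have hd' : derivative (X * PF F q d u w) = C (algebraMap 𝕜[X] F (C (u 0) - X * C (w 0))) := by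
    rw [hX, derivative_sub, derivative_C_mul, hder _ _ (by omega), hder _ _ H.hd]
    simp only [map_sub, map_mul]
  rw [separable_def, hd']
  apply IsCoprime.symm
  have hne : C (u 0) - X * C (w 0) ≠ (0 : 𝕜[X]) := by
    intro hx
    have h1 := congrArg (fun g => coeff g 0) hx
    have h2 := congrArg (fun g => coeff g 1) hx
    simp at h1 h2
    rcases H.h0 with h | h
    · exact h h1
    · exact h (by simpa [coeff_C] using h2)
  have hne' : algebraMap 𝕜[X] F (C (u 0) - X * C (w 0)) ≠ 0 := by
    rwa [Ne, map_eq_zero_iff _ (IsFractionRing.injective 𝕜[X] F)]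
  exact ⟨C (algebraMap 𝕜[X] F (C (u 0) - X * C (w 0)))⁻¹, 0, by rw [← C_mul, inv_mul_cancel₀ hne']; simp⟩
end
end Lin
end Chb

namespace Chb
open Polynomial
set_option linter.unusedSectionVars false

section Box
universe uL
variable {𝕜 : Type*} [Field 𝕜] {L : Type uL} [Field L] [Algebra 𝕜 L]

lemma deg_bd {E : Type uL} [Field E] [Algebra E L] (B : Set L)
    (hB : B ⊆ Set.range (algebraMap E L)) (PP : L[X]) (h0 : PP ≠ 0) (hc : ∀ i, PP.coeff i ∈ B)
    (v : L) (hv : PP.eval v = 0) : (minpoly E v).natDegree ≤ PP.natDegree := by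
  have : PP ∈ lifts (algebraMap E L) := by
    rw [lifts_iff_coeff_lifts]
    intro n; exact hB (hc n)
  obtain ⟨g, hg⟩ := (mem_lifts _).1 this
  have hg0 : g ≠ 0 := by rintro rfl; simp at hg; exact h0 hg.symm
  rw [← hg, natDegree_map]
  apply natDegree_le_of_dvd _ hg0
  apply minpoly.dvd
  rw [aeval_def, ← eval_map, hg, hv]

lemma box (V0 : Set L) (hfin : V0.Finite) (q d D : ℕ) (hV : ∀ c : 𝕜, c ^ q = c → ∀ x ∈ V0, ∀ y ∈ V0, c • x + y ∈ V0)
    (Cq : Finset 𝕜) (hCq : ∀ c ∈ Cq, c ^ q = c) (hCc : Cq.card = q) (hcard : V0.ncard = q ^ d)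
    (hq : 2 ≤ q)
    (B : Set L) (hBk : ∀ c : 𝕜, algebraMap 𝕜 L c ∈ B)
    (hBgen : ∀ S : Subfield L, B ⊆ S → V0 ⊆ S → S = ⊤)
    (PP : L[X]) (h0 : PP ≠ 0) (hc : ∀ i, PP.coeff i ∈ B) (hD : PP.natDegree = D)
    (hroot : ∀ v ∈ V0, v ≠ 0 → PP.eval v = 0)
    {Vt : Type*} (v : Vt → L) (hvt : ∀ x ∈ V0, x ≠ 0 → ∃ t, v t = x) :
    ∀ (r : ℕ) (E : Type uL) [Field E] [Algebra E L] [FiniteDimensional E L]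
      (_ : B ⊆ Set.range (algebraMap E L))
      (_ : q ^ d ≤ q ^ r * (V0 ∩ Set.range (algebraMap E L)).ncard),
      ∃ (Z : Multiset Vt) (J : Type) (_ : Fintype J) (ex : J → Multiset Vt),
        Multiset.card Z ≤ r ∧ (∀ j, ex j ≤ (D - 1) • Z) ∧ Fintype.card J ≤ D ^ (Multiset.card Z) ∧
        Fintype.card J = Module.finrank E L ∧
        LinearIndependent E (fun j => ((ex j).map v).prod) := by
  intro r
  induction r with
  | zero =>
    intro E _ _ _ hB h
    have h1 : V0 ∩ Set.range (algebraMap E L) = V0 := by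
      apply Set.eq_of_subset_of_ncard_le Set.inter_subset_left _ hfin
      rw [hcard]; simpa using h
    have h2 : (algebraMap E L).fieldRange = ⊤ := hBgen _ (by simpa using hB)
      (by rw [RingHom.coe_fieldRange]; exact Set.inter_eq_left.1 h1)
    refine ⟨0, Unit, inferInstance, fun _ => 0, by simp, by simp, by simp, ?_, ?_⟩
    · symm
      rw [Fintype.card_unit, finrank_eq_one_iff_of_nonzero' (1 : L) one_ne_zero]
      intro w
      have : w ∈ (algebraMap E L).fieldRange := by rw [h2]; trivial
      obtain ⟨c, hc⟩ := this
      exact ⟨c, by rw [Algebra.smul_def, hc, mul_one]⟩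
    · rw [linearIndependent_unique_iff]; simp
  | succ r ih =>
    intro E _ _ _ hB h
    by_cases hsub : V0 ⊆ Set.range (algebraMap E L)
    · obtain ⟨Z, J, i1, ex, a1, a2⟩ := ih E hB (by
        rw [Set.inter_eq_left.2 hsub, hcard]
        exact Nat.le_mul_of_pos_left _ (by positivity))
      exact ⟨Z, J, i1, ex, by omega, a2⟩
    rw [Set.not_subset] at hsub
    obtain ⟨x, hxV, hxE⟩ := hsub
    have hx0 : x ≠ 0 := by
      rintro rfl; exact hxE ⟨0, by simp⟩
    obtain ⟨t, ht⟩ := hvt x hxV hx0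
    let E' := IntermediateField.adjoin E ({x} : Set L)
    have hxE' : x ∈ E' := IntermediateField.mem_adjoin_simple_self E x
    have hEE : Set.range (algebraMap E L) ⊆ Set.range (algebraMap E' L) := by
      rintro _ ⟨c, rfl⟩; exact ⟨algebraMap E E' c, rfl⟩
    have hE'm : ∀ y, y ∈ Set.range (algebraMap E' L) ↔ y ∈ E' := by
      intro y; constructor
      · rintro ⟨c, rfl⟩; exact c.2
      · intro hy; exact ⟨⟨y, hy⟩, rfl⟩
    have hcount : q * (V0 ∩ Set.range (algebraMap E L)).ncard ≤ (V0 ∩ Set.range (algebraMap E' L)).ncard := by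
      have e1 : q * (V0 ∩ Set.range (algebraMap E L)).ncard =
          ((Cq : Set 𝕜) ×ˢ (V0 ∩ Set.range (algebraMap E L))).ncard := by
        rw [Set.ncard_prod, Set.ncard_coe_finset, hCc]
      rw [e1]
      apply Set.ncard_le_ncard_of_injOn (fun z : 𝕜 × L => z.1 • x + z.2)
        (ht := hfin.subset Set.inter_subset_left)
      · rintro ⟨c, y⟩ ⟨h1, h2, h3⟩
        refine ⟨hV c (hCq c h1) x hxV y h2, ?_⟩
        rw [hE'm]
        simp only
        rw [Algebra.smul_def]
        exact add_mem (mul_mem ((hE'm _).1 (hEE (hB (hBk c)))) hxE') ((hE'm _).1 (hEE h3))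
      · rintro ⟨c, y⟩ ⟨h1, h2, h3⟩ ⟨c', y'⟩ ⟨h1', h2', h3'⟩ hh
        simp only at hh h3 h3'
        have hcc : c = c' := by
          by_contra hne
          apply hxE
          have hne' : algebraMap 𝕜 L (c - c') ≠ 0 := by
            rw [Ne, map_eq_zero, sub_eq_zero]; exact hne
          have : x = (algebraMap 𝕜 L (c - c'))⁻¹ * (y' - y) := by
            rw [eq_inv_mul_iff_mul_eq₀ hne', ← Algebra.smul_def, sub_smul]
            linear_combination hh
          rw [this]
          have hm : ∀ z, z ∈ Set.range (algebraMap E L) ↔ z ∈ (algebraMap E L).fieldRange := fun z => Iff.rfl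
          rw [hm] at *
          exact mul_mem (inv_mem ((hm _).1 (hB (hBk _)))) (sub_mem h3' h3)
        subst hcc
        simpa using hh
    obtain ⟨Z, J, i1, ex, a1, a2, a3, a4, a5⟩ := ih E' (hB.trans hEE) (by
      refine h.trans ?_
      rw [pow_succ, mul_assoc]
      exact Nat.mul_le_mul_left _ hcount)
    have hint : IsIntegral E x := IsIntegral.of_finite E x
    let pb := IntermediateField.adjoin.powerBasis hint
    have hpbdim : pb.dim = (minpoly E x).natDegree := rfl
    have hdim : pb.dim ≤ D := by
      rw [hpbdim, ← hD]; exact deg_bd B hB PP h0 hc x (hroot x hxV hx0)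
    refine ⟨t ::ₘ Z, Fin pb.dim × J, inferInstance, fun z => (z.1 : ℕ) • {t} + ex z.2, ?_, ?_, ?_, ?_, ?_⟩
    · simp; exact a1
    · rintro ⟨i, j⟩
      rw [← Multiset.singleton_add, nsmul_add]
      apply add_le_add _ (a2 j)
      apply nsmul_le_nsmul_left (Multiset.zero_le _)
      have := i.2
      simp only
      omega
    · rw [Fintype.card_prod, Fintype.card_fin, Multiset.card_cons, pow_succ, mul_comm]
      exact Nat.mul_le_mul a3 hdim
    · rw [Fintype.card_prod, Fintype.card_fin, a4, ← Module.finrank_mul_finrank E E' L]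
      congr 1
      exact pb.finrank.symm
    · have := linearIndependent_smul pb.basis.linearIndependent a5
      have e : (fun z : Fin pb.dim × J => (Multiset.map v ((z.1 : ℕ) • {t} + ex z.2)).prod) =
          fun p => pb.basis p.1 • (Multiset.map v (ex p.2)).prod := by
        funext z
        rw [Multiset.map_add, Multiset.prod_add, Multiset.map_nsmul, Multiset.prod_nsmul, pb.coe_basis]
        simp only [Multiset.map_singleton, Multiset.prod_singleton, ht]
        rfl
      rw [e]
      exact this
end Box
end Chb

namespace Chb
open Polynomial
set_option linter.unusedSectionVars false
set_option linter.style.haveILetI false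
set_option linter.unusedVariables false

section EvLemmas
variable {𝕜 : Type*} [Field 𝕜] {p e q d : ℕ} {A : Type*} [CommRing A] [Algebra 𝕜 A]

lemma ev_lin (hp : p.Prime) [CharP A p] (hq : q = p ^ e) (c : ℕ → 𝕜) (N : ℕ) (b : 𝕜) (hb : b ^ q = b) (x y : A) :
    ev q c N (b • x + y) = b • ev q c N x + ev q c N y := by
  haveI := Fact.mk hp
  simp only [ev]
  rw [Finset.smul_sum, ← Finset.sum_add_distrib]
  apply Finset.sum_congr rfl
  intro j _
  have hbj : b ^ q ^ j = b := by
    clear * - hb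
    induction j with
    | zero => simp
    | succ j ih => rw [pow_succ, pow_mul, ih, hb]
  have : (b • x + y) ^ q ^ j = (b • x) ^ q ^ j + y ^ q ^ j := by
    rw [hq, ← pow_mul]; exact add_pow_char_pow _ _ _ _
  rw [this, _root_.smul_pow, hbj, smul_add, smul_comm]

lemma exists_Cq [IsAlgClosed 𝕜] [CharP 𝕜 p] (hp : p.Prime) (he : 1 ≤ e) (hq : q = p ^ e) :
    ∃ Cq : Finset 𝕜, (∀ c ∈ Cq, c ^ q = c) ∧ Cq.card = q := by
  classical
  have hq1 : 1 < q := by rw [hq]; exact Nat.one_lt_pow (by omega) hp.one_lt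
  have hsep : Separable (X ^ q - X : 𝕜[X]) := galois_poly_separable p q (by
    rw [hq]; exact dvd_pow_self _ (by omega))
  refine ⟨(X ^ q - X : 𝕜[X]).roots.toFinset, ?_, ?_⟩
  · intro c hc
    have := isRoot_of_mem_roots (Multiset.mem_toFinset.1 hc)
    simpa [sub_eq_zero] using this
  · rw [Multiset.toFinset_card_of_nodup (nodup_roots hsep),
      ← (IsAlgClosed.splits (X ^ q - X : 𝕜[X])).natDegree_eq_card_roots,
      FiniteField.X_pow_card_sub_X_natDegree_eq _ hq1]
end EvLemmas

section Setting
universe uL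
variable {𝕜 F : Type*} {L : Type uL} [Field 𝕜] [IsAlgClosed 𝕜] [Field F] [Field L] [Algebra 𝕜[X] F]
  [IsFractionRing 𝕜[X] F]
  [Algebra F L] [Algebra 𝕜[X] L] [IsScalarTower 𝕜[X] F L]
  [Algebra 𝕜 L] [IsScalarTower 𝕜 𝕜[X] L]
  {p e q d : ℕ} {u w : ℕ → 𝕜}

/-- nonzero roots -/
def Vt (F L : Type*) [Field F] [Field L] [Algebra 𝕜[X] F] [Algebra F L] (q d : ℕ) (u w : ℕ → 𝕜) : Type _ :=
  {x : L // aeval x (PF F q d u w) = 0}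

def V0 (L : Type*) [Field L] [Algebra 𝕜[X] L] [Algebra 𝕜 L] (q d : ℕ) (u w : ℕ → 𝕜) : Set L :=
  {x | ev q u (d+1) x = algebraMap 𝕜[X] L X * ev q w d x}

lemma ev_zero {A : Type*} [CommRing A] [Algebra 𝕜 A] (hq : 1 ≤ q) (c : ℕ → 𝕜) (N : ℕ) : ev q c N (0 : A) = 0 := by
  rw [← mul_lp1 hq, zero_mul]

lemma V0_zero (H : Hyp 𝕜 p e q d u w) : (0 : L) ∈ V0 L q d u w := by
  have := H.q2
  simp only [V0, Set.mem_ofPred_eq]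
  rw [ev_zero (by omega), ev_zero (by omega), mul_zero]

lemma V0_eq (H : Hyp 𝕜 p e q d u w) : V0 L q d u w = insert 0 ((PF F q d u w).rootSet L) := by
  ext x
  rw [Set.mem_insert_iff, mem_rootSet, root_iff H]
  constructor
  · intro h
    by_cases hx : x = 0
    · exact Or.inl hx
    · exact Or.inr ⟨(PF_monic H).ne_zero, hx, h⟩
  · rintro (rfl | ⟨_, _, h⟩)
    · exact V0_zero H
    · exact h

lemma V0_closed (H : Hyp 𝕜 p e q d u w) : ∀ c : 𝕜, c ^ q = c → ∀ x ∈ V0 L q d u w, ∀ y ∈ V0 L q d u w,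
    c • x + y ∈ V0 L q d u w := by
  intro c hc x hx y hy
  have := H.ch
  haveI : CharP L p := (Algebra.charP_iff 𝕜 L p).1 inferInstance
  simp only [V0, Set.mem_ofPred_eq] at *
  rw [ev_lin H.hp H.hq _ _ _ hc, ev_lin H.hp H.hq _ _ _ hc, hx, hy, mul_add, mul_smul_comm]

lemma injX [IsSplittingField F L (PF F q d u w)] : Function.Injective (algebraMap 𝕜[X] L) := by
    rw [IsScalarTower.algebraMap_eq 𝕜[X] F L]
    exact (algebraMap F L).injective.comp (IsFractionRing.injective 𝕜[X] F)

lemma rootSet_card [hsp : IsSplittingField F L (PF F q d u w)] (H : Hyp 𝕜 p e q d u w) : ((PF F q d u w).rootSet L).ncard = q ^ d - 1 := by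
  rw [← PF_natDegree (F := F) H, ← card_rootSet_eq_natDegree (PF_sep H) hsp.splits', ← Nat.card_eq_fintype_card]
  rfl

variable (F) in
lemma V0_fin [hsp : IsSplittingField F L (PF F q d u w)] (H : Hyp 𝕜 p e q d u w) : (V0 L q d u w).Finite := by
  rw [V0_eq (F := F) H]
  exact (rootSet_finite _ _).insert _

variable (F) in
lemma V0_card [hsp : IsSplittingField F L (PF F q d u w)] (H : Hyp 𝕜 p e q d u w) : (V0 L q d u w).ncard = q ^ d := by
  rw [V0_eq (F := F) H, Set.ncard_insert_of_notMem _ (rootSet_finite _ _), rootSet_card (F := F) H]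
  · have := Nat.one_le_pow d q (by have := H.q2; omega)
    omega
  · rw [mem_rootSet, root_iff H]
    simp

variable [hsp : IsSplittingField F L (PF F q d u w)]

lemma galois (H : Hyp 𝕜 p e q d u w) : IsGalois F L := IsGalois.of_separable_splitting_field (PF_sep (F := F) H)

lemma findim (H : Hyp 𝕜 p e q d u w) : FiniteDimensional F L := IsSplittingField.finiteDimensional L (PF F q d u w)

lemma minpoly_root (H : Hyp 𝕜 p e q d u w) (x : L) (hx : aeval x (PF F q d u w) = 0) :
    minpoly F x = PF F q d u w :=
  (minpoly.eq_of_irreducible_of_monic (PF_irr H) hx (PF_monic H)).symm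

lemma transitive (H : Hyp 𝕜 p e q d u w) (x y : Vt F L q d u w) : ∃ σ : L ≃ₐ[F] L, σ x.1 = y.1 := by
  haveI := galois (F := F) (L := L) H
  haveI := findim (F := F) (L := L) H
  apply minpoly.exists_algEquiv_of_root (IsAlgebraic.of_finite F _)
  rw [minpoly_root H _ y.2]; exact x.2

lemma map_root (σ : L ≃ₐ[F] L) (x : L) (hx : aeval x (PF F q d u w) = 0) :
    aeval (σ x) (PF F q d u w) = 0 := by
  have := aeval_algHom_apply σ.toAlgHom x (PF F q d u w)
  rw [hx, map_zero] at this; exact this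

lemma Vt_finite (H : Hyp 𝕜 p e q d u w) : Finite (Vt F L q d u w) := by
  have h : {x : L | aeval x (PF F q d u w) = 0} = (PF F q d u w).rootSet L := by
    ext x; rw [mem_rootSet]; simp [(PF_monic (F := F) H).ne_zero]
  have h2 : {x : L | aeval x (PF F q d u w) = 0}.Finite := by rw [h]; exact rootSet_finite _ _
  exact h2.to_subtype

lemma Vt_card (H : Hyp 𝕜 p e q d u w) : Nat.card (Vt F L q d u w) = q ^ d - 1 := by
  have h : {x : L | aeval x (PF F q d u w) = 0} = (PF F q d u w).rootSet L := by
    ext x; rw [mem_rootSet]; simp [(PF_monic (F := F) H).ne_zero]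
  rw [← rootSet_card (F := F) (L := L) H, ← h]; rfl

lemma fiber (H : Hyp 𝕜 p e q d u w) (x y : Vt F L q d u w) :
    Nat.card {σ : L ≃ₐ[F] L // σ x.1 = y.1} * (q ^ d - 1) = Nat.card (L ≃ₐ[F] L) := by
  classical
  haveI := findim (F := F) (L := L) H
  haveI := Vt_finite (F := F) (L := L) H
  have e1 : ∀ z : Vt F L q d u w, Nat.card {σ : L ≃ₐ[F] L // σ x.1 = z.1} = Nat.card {σ : L ≃ₐ[F] L // σ x.1 = y.1} := by
    intro z
    obtain ⟨τ, hτ⟩ := transitive H z y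
    apply Nat.card_congr
    refine (Equiv.mulLeft τ).subtypeEquiv ?_
    intro σ
    simp only [Equiv.coe_mulLeft, AlgEquiv.mul_apply]
    rw [← hτ]
    exact τ.injective.eq_iff.symm
  let f : (L ≃ₐ[F] L) → Vt F L q d u w := fun σ => ⟨σ x.1, map_root σ _ x.2⟩
  haveI := Fintype.ofFinite (Vt F L q d u w)
  have e2 : Nat.card (L ≃ₐ[F] L) = ∑ z : Vt F L q d u w, Nat.card {σ : L ≃ₐ[F] L // σ x.1 = z.1} := by
    rw [Nat.card_congr (Equiv.sigmaFiberEquiv f).symm, Nat.card_sigma]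
    apply Finset.sum_congr rfl
    intro z _
    apply Nat.card_congr
    exact Equiv.subtypeEquivRight (fun σ => Subtype.ext_iff)
  rw [e2, Finset.sum_congr rfl (fun z _ => e1 z), Finset.sum_const, Finset.card_univ, ← Nat.card_eq_fintype_card,
    Vt_card H, smul_eq_mul, mul_comm]

lemma transc (H : Hyp 𝕜 p e q d u w) (x : Vt F L q d u w) : Transcendental 𝕜 x.1 := by
  intro halg
  have hx := x.2
  have h0 := (root_iff H x.1).1 hx
  have h1 : aeval x.1 (lp1 q u (d+1)) = algebraMap 𝕜[X] L X * aeval x.1 (lp1 q w d) := by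
    apply mul_left_cancel₀ h0.1
    rw [mul_lp1 (by have := H.q2; omega), h0.2, mul_left_comm, mul_lp1 (by have := H.q2; omega)]
  have h2 : aeval x.1 (lp1 q w d) ≠ 0 := by
    intro h2
    rw [h2, mul_zero] at h1
    obtain ⟨a, b, hab⟩ := H.cop
    have := congrArg (aeval x.1) hab
    simp [h1, h2] at this
  have h3 : algebraMap 𝕜[X] L X = aeval x.1 (lp1 q u (d+1)) / aeval x.1 (lp1 q w d) := by
    rw [eq_div_iff h2, h1]
  have h4 : IsAlgebraic 𝕜 (algebraMap 𝕜[X] L X) := by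
    rw [h3]
    have hm : ∀ g : 𝕜[X], aeval x.1 g ∈ algebraicClosure 𝕜 L := by
      intro g
      exact Algebra.adjoin_le (S := (algebraicClosure 𝕜 L).toSubalgebra)
        (Set.singleton_subset_iff.2 ((mem_algebraicClosure_iff).2 halg)) (aeval_mem_adjoin_singleton 𝕜 x.1)
    exact (mem_algebraicClosure_iff).1 (div_mem (hm _) (hm _))
  have h5 := (isAlgebraic_algebraMap_iff (R := 𝕜) (injX (F := F) (q := q) (d := d) (u := u) (w := w) : Function.Injective (algebraMap 𝕜[X] L))).1 h4
  exact transcendental_X 𝕜 h5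

lemma li_pow {R A : Type*} [CommRing R] [CommRing A] [Algebra R A] (x : A) (hx : Transcendental R x) :
    LinearIndependent R (fun n : ℕ => x ^ n) := by
  have h := (basisMonomials R).linearIndependent.map' (aeval x).toLinearMap
    (by rw [LinearMap.ker_eq_bot]; exact transcendental_iff_injective.1 hx)
  have e : (fun n : ℕ => x ^ n) = (aeval x).toLinearMap ∘ (basisMonomials R) := by
    funext n
    simp
  rw [e]; exact h

lemma li_aux {𝕜 E L : Type*} [Field 𝕜] [Field E] [Field L] [Algebra 𝕜 L] [Algebra E L] (χ : 𝕜 →+* E)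
    (hχ : ∀ c, algebraMap E L (χ c) = algebraMap 𝕜 L c) (y : E) (hy : Transcendental 𝕜 (algebraMap E L y))
    {J : Type*} (c : J → L) (hc : LinearIndependent E c) :
    LinearIndependent 𝕜 (fun a : ℕ × J => (algebraMap E L y) ^ a.1 * c a.2) := by
  letI : Algebra 𝕜 E := χ.toAlgebra
  haveI : IsScalarTower 𝕜 E L := IsScalarTower.of_algebraMap_eq (fun c => (hχ c).symm)
  have hli : LinearIndependent 𝕜 (fun n : ℕ => y ^ n) := by
    apply li_pow
    intro halg
    exact hy (halg.algebraMap (A := L))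
  have := linearIndependent_smul hli hc
  have e : (fun a : ℕ × J => (algebraMap E L y) ^ a.1 * c a.2) = fun p => y ^ p.1 • c p.2 := by
    funext a
    rw [Algebra.smul_def, map_pow]
  rw [e]; exact this

lemma hbox (H : Hyp 𝕜 p e q d u w) (t1 : Vt F L q d u w) :
    ∃ (Z : Multiset (Vt F L q d u w)) (J : Type) (_ : Fintype J) (ex : J → Multiset (Vt F L q d u w)),
        Multiset.card Z ≤ d - 1 ∧ (∀ j, ex j ≤ (q ^ d - 2) • Z) ∧
        Fintype.card J ≤ (q ^ d - 1) ^ (Multiset.card Z) ∧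
        Fintype.card J * (q ^ d - 1) = Nat.card (L ≃ₐ[F] L) ∧
        LinearIndependent 𝕜 (fun a : ℕ × J => t1.1 ^ a.1 * ((ex a.2).map (fun t => t.1)).prod) := by
  haveI := findim (F := F) (L := L) H
  haveI := galois (F := F) (L := L) H
  have := H.ch
  have hq2 := H.q2
  have hd1 := H.hd
  obtain ⟨Cq, hCq, hCc⟩ := exists_Cq (𝕜 := 𝕜) H.hp H.he H.hq
  let E := IntermediateField.adjoin F ({t1.1} : Set L)
  have ht1E : t1.1 ∈ E := IntermediateField.mem_adjoin_simple_self F _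
  have hk : ∀ c : 𝕜, algebraMap 𝕜 L c ∈ Set.range (algebraMap F L) := by
    intro c
    exact ⟨algebraMap 𝕜[X] F (C c), by
      rw [← IsScalarTower.algebraMap_apply 𝕜[X] F L, IsScalarTower.algebraMap_apply 𝕜 𝕜[X] L]; rfl⟩
  have hFE : Set.range (algebraMap F L) ⊆ Set.range (algebraMap E L) := by
    rintro _ ⟨c, rfl⟩; exact ⟨algebraMap F E c, rfl⟩
  have ht1V : t1.1 ∈ V0 L q d u w := ((root_iff H t1.1).1 t1.2).2
  have ht10 : t1.1 ≠ 0 := ((root_iff H t1.1).1 t1.2).1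
  have hcount : q ≤ (V0 L q d u w ∩ Set.range (algebraMap E L)).ncard := by
    refine (hCc.symm.trans (Set.ncard_coe_finset Cq).symm).le.trans ?_
    apply Set.ncard_le_ncard_of_injOn (fun c : 𝕜 => c • t1.1)
      (ht := (V0_fin F H).subset Set.inter_subset_left)
    · intro c hc
      refine ⟨by simpa using V0_closed H c (hCq c hc) _ ht1V _ (V0_zero H), ?_⟩
      obtain ⟨y, hy⟩ := hFE (hk c)
      exact ⟨y * ⟨t1.1, ht1E⟩, by rw [map_mul, hy, Algebra.smul_def]; rfl⟩
    · intro c hc c' hc' hh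
      exact smul_left_injective 𝕜 ht10 hh
  have hBgen : ∀ S : Subfield L, Set.range (algebraMap F L) ⊆ S → V0 L q d u w ⊆ S → S = ⊤ := by
    intro S h1 h2
    have h3 := hsp.adjoin_rootSet'
    let S' : Subalgebra F L := { S.toSubring with algebraMap_mem' := fun c => h1 ⟨c, rfl⟩ }
    have h4 : (⊤ : Subalgebra F L) ≤ S' := by
      rw [← h3, Algebra.adjoin_le_iff]
      intro y hy
      exact h2 (by rw [V0_eq (F := F) H]; exact Or.inr hy)
    rw [eq_top_iff]
    intro y _
    exact h4 (Algebra.mem_top : y ∈ (⊤ : Subalgebra F L))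
  obtain ⟨Z, J, i1, ex, a1, a2, a3, a4, a5⟩ := box (𝕜 := 𝕜) (V0 L q d u w) (V0_fin F H) q d (q ^ d - 1)
    (V0_closed H) Cq hCq hCc (V0_card F H) H.q2 (Set.range (algebraMap F L)) hk hBgen
    ((PF F q d u w).map (algebraMap F L)) ((PF_monic H).map _).ne_zero
    (by intro i; rw [coeff_map]; exact ⟨_, rfl⟩)
    (by rw [natDegree_map, PF_natDegree H])
    (by intro v hv hv0
        rw [eval_map, ← aeval_def, root_iff H]
        exact ⟨hv0, hv⟩)
    (fun t : Vt F L q d u w => t.1)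
    (by intro x hx hx0
        exact ⟨⟨x, (root_iff H x).2 ⟨hx0, hx⟩⟩, rfl⟩)
    (d - 1) E hFE (by
      calc q ^ d = q ^ (d - 1) * q := by rw [← pow_succ]; congr 1; omega
        _ ≤ _ := Nat.mul_le_mul_left _ hcount)
  refine ⟨Z, J, i1, ex, a1, by simpa [Nat.sub_sub] using a2, a3, ?_, ?_⟩
  · rw [a4, IsGalois.card_aut_eq_finrank, ← Module.finrank_mul_finrank F E L, mul_comm]
    congr 1
    rw [IntermediateField.adjoin.finrank (IsIntegral.of_finite F _), minpoly_root H _ t1.2, PF_natDegree H]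
  · have hχ : ∀ c, algebraMap E L (algebraMap F E (algebraMap 𝕜[X] F (C c))) = algebraMap 𝕜 L c := by
      intro c
      rw [← IsScalarTower.algebraMap_apply F E L, ← IsScalarTower.algebraMap_apply 𝕜[X] F L,
        IsScalarTower.algebraMap_apply 𝕜 𝕜[X] L]; rfl
    exact li_aux (((algebraMap F E).comp (algebraMap 𝕜[X] F)).comp C) hχ ⟨t1.1, ht1E⟩ (transc H t1) _ a5
end Setting
end Chb

namespace Chb
open Polynomial
set_option linter.unusedSectionVars false
set_option linter.style.haveILetI false
set_option linter.unusedVariables false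

lemma exists_vs {R L : Type*} [CommRing R] [Field L] (χ : R →+* L) (hχ : Function.Injective χ) (a : R)
    (ha : ¬ IsUnit a) : ∃ V : ValuationSubring L, (∀ r, V.valuation (χ r) ≤ 1) ∧ V.valuation (χ a) < 1 := by
  let b : χ.range := ⟨χ a, a, rfl⟩
  have hI : Ideal.span {b} ≠ ⊤ := by
    intro h
    rw [Ideal.span_singleton_eq_top] at h
    obtain ⟨⟨_, c, rfl⟩, hc⟩ := isUnit_iff_exists_inv.1 h
    have h2 : χ a * χ c = 1 := congrArg Subtype.val hc
    rw [← map_mul, ← map_one χ] at h2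
    exact ha (IsUnit.of_mul_eq_one _ (hχ h2))
  obtain ⟨V, h1, h2⟩ := Ideal.image_subset_nonunits_valuationSubring _ hI
  refine ⟨V, fun r => (V.valuation_le_one_iff _).2 (h1 ⟨r, rfl⟩), ?_⟩
  rw [← V.mem_nonunits_iff]
  exact h2 ⟨b, Ideal.subset_span rfl, rfl⟩

lemma exists_vs_inf {𝕜 L : Type*} [Field 𝕜] [Field L] [Algebra 𝕜 L] (y : L) (hy : Transcendental 𝕜 y) :
    ∃ V : ValuationSubring L, (∀ c : 𝕜, c ≠ 0 → V.valuation (algebraMap 𝕜 L c) = 1) ∧ 1 < V.valuation y := by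
  have hy0 : y ≠ 0 := by
    rintro rfl; exact hy isAlgebraic_zero
  have hy' : Transcendental 𝕜 y⁻¹ := fun h => hy (by simpa using h.inv)
  obtain ⟨V, h1, h2⟩ := exists_vs (aeval (R := 𝕜) y⁻¹).toRingHom (transcendental_iff_injective.1 hy') X not_isUnit_X
  refine ⟨V, ?_, ?_⟩
  · intro c hc
    have a1 := h1 (C c)
    have a2 := h1 (C c⁻¹)
    simp only [AlgHom.toRingHom_eq_coe, RingHom.coe_coe, aeval_C] at a1 a2
    apply le_antisymm a1
    rw [map_inv₀, map_inv₀] at a2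
    by_contra hlt
    push Not at hlt
    have hne : V.valuation (algebraMap 𝕜 L c) ≠ 0 := by simpa using hc
    exact absurd a2 (not_le.2 ((one_lt_inv₀ (zero_lt_iff.2 hne)).2 hlt))
  · simp only [AlgHom.toRingHom_eq_coe, RingHom.coe_coe, aeval_X, map_inv₀] at h2
    have hne : V.valuation y ≠ 0 := by simpa using hy0
    exact (inv_lt_one₀ (zero_lt_iff.2 hne)).1 h2

section Setting
universe uL
variable {𝕜 F : Type*} {L : Type uL} [Field 𝕜] [IsAlgClosed 𝕜] [Field F] [Field L] [Algebra 𝕜[X] F]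
  [IsFractionRing 𝕜[X] F]
  [Algebra F L] [Algebra 𝕜[X] L] [IsScalarTower 𝕜[X] F L]
  [Algebra 𝕜 L] [IsScalarTower 𝕜 𝕜[X] L]
  {p e q d : ℕ} {u w : ℕ → 𝕜}


variable (F) in
lemma exists_V [hsp : IsSplittingField F L (PF F q d u w)] (H : Hyp 𝕜 p e q d u w) :
    ∃ V : ValuationSubring L, (∀ c : 𝕜, c ≠ 0 → V.valuation (algebraMap 𝕜 L c) = 1) ∧
      1 < V.valuation (algebraMap 𝕜[X] L X) := by
  apply exists_vs_inf
  intro h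
  exact transcendental_X 𝕜 ((isAlgebraic_algebraMap_iff (R := 𝕜)
    (injX (F := F) (q := q) (d := d) (u := u) (w := w) : Function.Injective (algebraMap 𝕜[X] L))).1 h)

variable [hsp : IsSplittingField F L (PF F q d u w)]

lemma BB_coeff (q d : ℕ) (u w : ℕ → 𝕜) (i : ℕ) :
    (BB q d u w).coeff i = C ((lp1 q u (d+1)).coeff i) - X * C ((lp1 q w d).coeff i) := by
  rw [BB, coeff_sub, coeff_C_mul, coeff_map, coeff_map]

lemma height (H : Hyp 𝕜 p e q d u w) {Γ : Type*} [LinearOrderedCommGroupWithZero Γ] (v : Valuation L Γ)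
    (hc : ∀ c : 𝕜, c ≠ 0 → v (algebraMap 𝕜 L c) = 1) (hs : 1 < v (algebraMap 𝕜[X] L X)) [Fintype (Vt F L q d u w)] :
    ∏ x : Vt F L q d u w, max 1 (v x.1) ≤ v (algebraMap 𝕜[X] L X) := by
  classical
  have hc' : ∀ c : 𝕜, v (algebraMap 𝕜[X] L (C c)) ≤ 1 := by
    intro c
    have : algebraMap 𝕜[X] L (C c) = algebraMap 𝕜 L c := by
      rw [IsScalarTower.algebraMap_apply 𝕜 𝕜[X] L]; rfl
    rw [this]
    by_cases h : c = 0
    · simp [h]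
    · exact (hc c h).le
  have hfac : ((((PF F q d u w).map (algebraMap F L)).roots.map fun v => X - C v).prod : L[X]) =
      (PF F q d u w).map (algebraMap F L) := by
    exact (hsp.splits'.eq_prod_roots_of_monic ((PF_monic H).map _)).symm
  have h := gauss2 v ((PF F q d u w).map (algebraMap F L)).roots 1 (v (algebraMap 𝕜[X] L X)) (by
    intro i
    rw [hfac, mul_one, coeff_map, PF, coeff_map, ← IsScalarTower.algebraMap_apply 𝕜[X] F L, BB_coeff,
      map_sub, map_mul]
    refine (v.map_sub _ _).trans (max_le ((hc' _).trans hs.le) ?_)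
    rw [map_mul]
    exact mul_le_of_le_one_right' (hc' _)) 0
  rw [coeff_one_zero, map_one, one_mul] at h
  refine le_trans (le_of_eq ?_) h
  have hnd : ((PF F q d u w).map (algebraMap F L)).roots.Nodup := nodup_roots ((PF_sep H).map)
  have e1 : (((PF F q d u w).map (algebraMap F L)).roots.map fun x => max 1 (v x)).prod =
      ∏ x ∈ ((PF F q d u w).map (algebraMap F L)).roots.toFinset, max 1 (v x) := by
    rw [Finset.prod, Multiset.toFinset_val, hnd.dedup]
  rw [e1]
  refine (Finset.prod_subtype _ (fun x => ?_) (fun x => max 1 (v x))).symm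
  rw [Multiset.mem_toFinset, mem_roots ((PF_monic H).map _).ne_zero, IsRoot.def, eval_map_algebraMap]

def LLs (H : Hyp 𝕜 p e q d u w) {Γ : Type*} [LinearOrderedCommGroupWithZero Γ] (v : Valuation L Γ)
    (hc : ∀ c : 𝕜, c ≠ 0 → v (algebraMap 𝕜 L c) = 1) (M : Multiset (Vt F L q d u w)) :
    Submodule 𝕜 (integralClosure 𝕜[X] L) where
  carrier := {x | ∀ σ : L ≃ₐ[F] L, v (σ x.1) ≤ (M.map fun t : Vt F L q d u w => max 1 (v (σ t.1))).prod}
  add_mem' := by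
    intro a b ha hb σ
    have : σ (a + b : integralClosure 𝕜[X] L).1 = σ a.1 + σ b.1 := by
      rw [← map_add]; rfl
    rw [this]
    exact (v.map_add _ _).trans (max_le (ha σ) (hb σ))
  zero_mem' := by
    intro σ
    have : σ (0 : integralClosure 𝕜[X] L).1 = 0 := by
      rw [← map_zero σ]; rfl
    rw [this, map_zero]; exact zero_le
  smul_mem' := by
    intro c a ha σ
    have : σ (c • a : integralClosure 𝕜[X] L).1 = algebraMap 𝕜 L c * σ a.1 := by
      have h1 : (c • a : integralClosure 𝕜[X] L).1 = algebraMap F L (algebraMap 𝕜[X] F (C c)) * a.1 := by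
        rw [← IsScalarTower.algebraMap_apply 𝕜[X] F L]
        change c • a.1 = _
        rw [Algebra.smul_def, IsScalarTower.algebraMap_apply 𝕜 𝕜[X] L]; rfl
      rw [h1, map_mul, AlgEquiv.commutes, ← IsScalarTower.algebraMap_apply 𝕜[X] F L, IsScalarTower.algebraMap_apply 𝕜 𝕜[X] L]; rfl
    rw [this, map_mul]
    by_cases h : c = 0
    · simp [h]
    · rw [hc c h, one_mul]; exact ha σ

lemma LLs_norm (H : Hyp 𝕜 p e q d u w) {Γ : Type*} [LinearOrderedCommGroupWithZero Γ] (v : Valuation L Γ)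
    (hc : ∀ c : 𝕜, c ≠ 0 → v (algebraMap 𝕜 L c) = 1) (hs : 1 < v (algebraMap 𝕜[X] L X)) (h : ℕ)
    (hh : h * (q ^ d - 1) = Nat.card (L ≃ₐ[F] L)) (M : Multiset (Vt F L q d u w))
    (x : integralClosure 𝕜[X] L) (hx : x ∈ LLs H v hc M) (hx0 : x ≠ 0) [Fintype (L ≃ₐ[F] L)] :
    ∃ n : 𝕜[X], n ≠ 0 ∧ n.natDegree ≤ h * Multiset.card M ∧ algebraMap 𝕜[X] L n = ∏ σ : L ≃ₐ[F] L, σ x.1 := by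
  classical
  haveI := findim (F := F) (L := L) H
  haveI := galois (F := F) (L := L) H
  haveI := Vt_finite (F := F) (L := L) H
  haveI := Fintype.ofFinite (Vt F L q d u w)
  have key : ∀ t : Vt F L q d u w, ∏ σ : L ≃ₐ[F] L, max 1 (v (σ t.1)) ≤ v (algebraMap 𝕜[X] L X) ^ h := by
    intro t
    let f : (L ≃ₐ[F] L) → Vt F L q d u w := fun σ => ⟨σ t.1, map_root σ _ t.2⟩
    rw [← Finset.prod_fiberwise_of_maps_to (t := Finset.univ) (g := f) (fun _ _ => Finset.mem_univ _)]
    refine le_trans (le_of_eq ?_) (pow_le_pow_left' (height (F := F) H v hc hs) h)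
    rw [← Finset.prod_pow]
    apply Finset.prod_congr rfl
    intro y _
    have e1 : ∀ σ ∈ Finset.univ.filter (fun σ => f σ = y), max 1 (v (σ t.1)) = max 1 (v y.1) := by
      intro σ hσ
      rw [← (Finset.mem_filter.1 hσ).2]
    rw [Finset.prod_congr rfl e1, Finset.prod_const]
    congr 1
    have e2 := fiber H t y
    have e3 : Nat.card {σ : L ≃ₐ[F] L // σ t.1 = y.1} = (Finset.univ.filter (fun σ => f σ = y)).card := by
      rw [Nat.card_eq_fintype_card, Fintype.card_subtype]
      congr 1
      ext σ
      simp only [Finset.mem_filter, Finset.mem_univ, true_and]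
      exact ⟨fun h => Subtype.ext h, fun h => congrArg Subtype.val h⟩
    rw [e3, ← hh] at e2
    have : 0 < q ^ d - 1 := by have := H.qd2; have := H.q2; omega
    exact Nat.eq_of_mul_eq_mul_right this e2
  have := norm_deg (F := F) v hc hs x.1 x.2 (by simpa using hx0)
    (fun σ => (M.map fun t : Vt F L q d u w => max 1 (v (σ t.1))).prod) hx (h * Multiset.card M) (by
      rw [pow_mul]
      have e : ∏ σ : L ≃ₐ[F] L, (M.map fun t : Vt F L q d u w => max 1 (v (σ t.1))).prod =
        (M.map fun t : Vt F L q d u w => ∏ σ : L ≃ₐ[F] L, max 1 (v (σ t.1))).prod := by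
          exact (Multiset.prod_map_prod_map (Finset.univ : Finset (L ≃ₐ[F] L)).val M
            (f := fun σ t => max 1 (v (σ t.1))))
      have e2 : (M.map fun t : Vt F L q d u w => ∏ σ : L ≃ₐ[F] L, max 1 (v (σ t.1))).prod ≤
          (M.map fun t : Vt F L q d u w => v (algebraMap 𝕜[X] L X) ^ h).prod :=
        Multiset.prod_map_le_prod_map₀ _ _ (fun _ _ => zero_le) (fun t _ => key t)
      rw [Multiset.map_const', Multiset.prod_replicate] at e2
      refine le_trans (le_of_eq ?_) e2
      convert e)
  convert this
end Setting
end Chb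

namespace Chb
open Polynomial
set_option linter.unusedSectionVars false
set_option linter.style.haveILetI false
set_option linter.unusedVariables false

lemma lin_card {𝕜 : Type*} [Field 𝕜] [IsAlgClosed 𝕜] {p e q : ℕ} (hp : p.Prime) [CharP 𝕜 p] (he : 1 ≤ e) (hq : q = p ^ e)
    (c : ℕ → 𝕜) (d : ℕ) (h0 : c 0 ≠ 0) (hd : c d ≠ 0) :
    {y : 𝕜 | ev q c (d+1) y = 0}.ncard = q ^ d := by
  have hq2 : 2 ≤ q := by rw [hq]; exact hp.two_le.trans (Nat.le_self_pow (by omega) p)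
  let P : 𝕜[X] := ∑ j ∈ Finset.range (d+1), C (c j) * X ^ q ^ j
  have hdeg : P.natDegree = q ^ d := by
    have h1 : P = C (c d) * X ^ q ^ d + ∑ j ∈ Finset.range d, C (c j) * X ^ q ^ j := by
      simp only [P]; rw [Finset.sum_range_succ, add_comm]
    have h2 : (∑ j ∈ Finset.range d, C (c j) * X ^ q ^ j : 𝕜[X]).degree < ((q ^ d : ℕ) : WithBot ℕ) := by
      rw [← mem_degreeLT]
      apply Submodule.sum_mem
      intro j hj
      rw [mem_degreeLT]
      refine (degree_C_mul_X_pow_le _ _).trans_lt ?_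
      norm_cast
      exact Nat.pow_lt_pow_right (by omega) (Finset.mem_range.1 hj)
    apply natDegree_eq_of_degree_eq_some
    rw [h1, degree_add_eq_left_of_degree_lt, degree_C_mul_X_pow _ hd]
    rw [degree_C_mul_X_pow _ hd]; exact h2
  have hder : derivative P = C (c 0) := by
    simp only [P]
    rw [derivative_sum, Finset.sum_eq_single 0]
    · simp
    · intro j _ hj
      rw [derivative_C_mul_X_pow]
      have : ((q ^ j : ℕ) : 𝕜) = 0 := by
        rw [CharP.cast_eq_zero_iff 𝕜 p, hq]
        exact dvd_pow (dvd_pow_self _ (by omega)) hj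
      rw [this]; simp
    · intro h; simp at h
  have hsep : P.Separable := by
    rw [Separable, hder]
    exact ⟨0, C (c 0)⁻¹, by rw [zero_mul, zero_add, ← C_mul, inv_mul_cancel₀ h0, C_1]⟩
  have hP0 : P ≠ 0 := by
    rintro h; rw [h, natDegree_zero] at hdeg
    have := Nat.one_le_pow d q (by omega); omega
  have hs : {y : 𝕜 | ev q c (d+1) y = 0} = P.rootSet 𝕜 := by
    ext y
    rw [mem_rootSet]
    simp only [Set.mem_ofPred_eq, P, ev, map_sum, map_mul, aeval_C, map_pow, aeval_X, smul_eq_mul, Algebra.algebraMap_self, RingHom.id_apply]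
    exact ⟨fun h => ⟨hP0, h⟩, fun h => h.2⟩
  rw [hs, ← hdeg, ← card_rootSet_eq_natDegree (K := 𝕜) hsep (IsAlgClosed.splits _), ← Nat.card_eq_fintype_card]
  rfl

lemma gal_diff {F L E : Type*} [Field F] [Field L] [Field E] [Algebra F L] (f : F[X]) [IsSplittingField F L f]
    (i1 i2 : L →+* E) (h : ∀ c, i1 (algebraMap F L c) = i2 (algebraMap F L c)) :
    ∃ σ : L ≃ₐ[F] L, ∀ x, i2 x = i1 (σ x) := by
  letI : Algebra F E := (i1.comp (algebraMap F L)).toAlgebra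
  let j1 : L →ₐ[F] E := ⟨i1, fun c => rfl⟩
  let j2 : L →ₐ[F] E := ⟨i2, fun c => (h c).symm⟩
  haveI := IsSplittingField.finiteDimensional L f
  have hr : j1.range = j2.range := by
    rw [← IsSplittingField.adjoin_rootSet_eq_range L f j1, ← IsSplittingField.adjoin_rootSet_eq_range L f j2]
  have hex : ∀ x, ∃ y, i1 y = i2 x := by
    intro x
    have : j2 x ∈ j1.range := by rw [hr]; exact ⟨x, rfl⟩
    exact this
  choose g hg using hex
  let σ : L →ₐ[F] L := AlgHom.ofLinearMap
    { toFun := g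
      map_add' := fun x y => i1.injective (by rw [map_add, hg, hg, hg, map_add])
      map_smul' := fun c x => i1.injective (by
        rw [RingHom.id_apply, Algebra.smul_def, Algebra.smul_def, map_mul, hg, hg, map_mul, h]) }
    (i1.injective (by change i1 (g 1) = _; rw [hg, map_one, map_one]))
    (fun x y => i1.injective (by change i1 (g _) = i1 (g _ * g _); rw [map_mul, hg, hg, hg, map_mul]))
  refine ⟨AlgEquiv.ofBijective σ (Algebra.IsAlgebraic.algHom_bijective σ), fun x => (hg x).symm⟩

lemma lift_hom {F L M : Type*} [Field F] [Field L] [Algebra F L] [Field M] (f : F[X]) [hs : IsSplittingField F L f]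
    (φ : F →+* M) (h : Splits (f.map φ)) : ∃ Φ : L →+* M, ∀ c, Φ (algebraMap F L c) = φ c := by
  letI iM : Algebra F M := φ.toAlgebra
  let j : L →ₐ[F] M := IsSplittingField.lift L f h
  exact ⟨j.toRingHom, fun c => j.commutes c⟩

/-- extension of an endomorphism -/
lemma ext_endo {F L : Type*} [Field F] [Field L] [Algebra F L] (f : F[X]) [hs : IsSplittingField F L f]
    (φ : F →+* F) (hφ : f.map φ = f) : ∃ Φ : L →+* L, ∀ c, Φ (algebraMap F L c) = algebraMap F L (φ c) := by
  apply lift_hom f ((algebraMap F L).comp φ)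
  rw [← Polynomial.map_map, hφ]; exact hs.splits'

section Setting
universe uL
variable {𝕜 F : Type*} {L : Type uL} [Field 𝕜] [IsAlgClosed 𝕜] [Field F] [Field L] [Algebra 𝕜[X] F]
  [IsFractionRing 𝕜[X] F]
  [Algebra F L] [Algebra 𝕜[X] L] [IsScalarTower 𝕜[X] F L]
  [Algebra 𝕜 L] [IsScalarTower 𝕜 𝕜[X] L]
  {p e q d : ℕ} {u w : ℕ → 𝕜}

/-- specialised coefficients -/
def cs (d : ℕ) (u w : ℕ → 𝕜) (s : 𝕜) (j : ℕ) : 𝕜 := if j < d then u j - s * w j else u j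

lemma ev_cs (q d : ℕ) (u w : ℕ → 𝕜) (s y : 𝕜) : ev q (cs d u w s) (d+1) y = ev q u (d+1) y - s * ev q w d y := by
  rw [ev, ev, ev, Finset.sum_range_succ, Finset.sum_range_succ, Finset.mul_sum, add_sub_right_comm, ← Finset.sum_sub_distrib]
  congr 1
  · apply Finset.sum_congr rfl
    intro j hj
    rw [cs, if_pos (Finset.mem_range.1 hj)]
    simp only [smul_eq_mul]; ring
  · rw [cs, if_neg (lt_irrefl _)]

def Vs (q d : ℕ) (u w : ℕ → 𝕜) (s : 𝕜) : Set 𝕜 := {y | ev q u (d+1) y = s * ev q w d y}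

lemma Vs_card (H : Hyp 𝕜 p e q d u w) (s : 𝕜) (hs : u 0 - s * w 0 ≠ 0) : (Vs q d u w s).ncard = q ^ d := by
  haveI := H.ch
  rw [← lin_card H.hp H.he H.hq (cs d u w s) d (by rw [cs, if_pos (show 0 < d from H.hd)]; exact hs) (by rw [cs, if_neg (lt_irrefl _), H.hud]; exact one_ne_zero)]
  congr 1
  ext y
  simp only [Vs, Set.mem_ofPred_eq]
  rw [ev_cs, sub_eq_zero]

noncomputable def chi (s : 𝕜) : 𝕜[X] →+* PowerSeries 𝕜 :=
  (Polynomial.coeToPowerSeries.ringHom).comp (taylorAlgHom s).toRingHom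

lemma chi_apply (s : 𝕜) (g : 𝕜[X]) : chi s g = (taylor s g : PowerSeries 𝕜) := rfl

lemma chi_inj (s : 𝕜) : Function.Injective (chi s) := by
  intro a b h
  exact taylor_injective s (Polynomial.coe_injective 𝕜 h)

lemma chi_C (s c : 𝕜) : chi s (C c) = PowerSeries.C c := by
  rw [chi_apply, taylor_C, Polynomial.coe_C]

lemma chi_X (s : 𝕜) : chi s X = PowerSeries.X + PowerSeries.C s := by
  rw [chi_apply, taylor_X, Polynomial.coe_add, Polynomial.coe_X, Polynomial.coe_C]

lemma cc_chi (s : 𝕜) (g : 𝕜[X]) : PowerSeries.constantCoeff (chi s g) = g.eval s := by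
  rw [chi_apply, Polynomial.constantCoeff_coe, taylor_coeff_zero]

lemma ps_roots (H : Hyp 𝕜 p e q d u w) (s : 𝕜) (hs : u 0 - s * w 0 ≠ 0) (y0 : 𝕜) (hy : y0 ∈ Vs q d u w s) :
    ∃ y : PowerSeries 𝕜, PowerSeries.constantCoeff y = y0 ∧ ev q u (d+1) y = chi s X * ev q w d y := by
  haveI := H.ch
  haveI := Fact.mk H.hp
  let A : ℕ → PowerSeries 𝕜 := fun j => if j < d then PowerSeries.C (u j) - chi s X * PowerSeries.C (w j) else PowerSeries.C (u j)
  have hA : ∀ y : PowerSeries 𝕜, ∑ j ∈ Finset.range (d+1), A j * y ^ q ^ j = ev q u (d+1) y - chi s X * ev q w d y := by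
    intro y
    rw [ev, ev, Finset.sum_range_succ, Finset.sum_range_succ, Finset.mul_sum, add_sub_right_comm, ← Finset.sum_sub_distrib]
    congr 1
    · apply Finset.sum_congr rfl
      intro j hj
      simp only [A]
      rw [if_pos (Finset.mem_range.1 hj), PowerSeries.smul_eq_C_mul, PowerSeries.smul_eq_C_mul]; ring
    · simp only [A]; rw [if_neg (lt_irrefl _), PowerSeries.smul_eq_C_mul]
  have hcc : ∀ j, PowerSeries.constantCoeff (A j) = cs d u w s j := by
    intro j
    simp only [A, cs]
    split_ifs
    · rw [map_sub, map_mul, cc_chi, PowerSeries.constantCoeff_C, PowerSeries.constantCoeff_C, eval_X]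
    · rw [PowerSeries.constantCoeff_C]
  obtain ⟨y, h1, h2⟩ := ps_lift p q e H.hq H.he d A (by
      rw [PowerSeries.isUnit_iff_constantCoeff, hcc, cs, if_pos (show 0 < d from H.hd)]; exact isUnit_iff_ne_zero.2 hs) y0 (by
      simp only [hcc]
      have := ev_cs q d u w s y0
      rw [ev] at this
      simp only [smul_eq_mul] at this
      rw [this, sub_eq_zero]; exact hy)
  exact ⟨y, h1, by rw [← sub_eq_zero, ← hA, h2]⟩

end Setting
end Chb

namespace Chb
open Polynomial
set_option linter.unusedSectionVars false
set_option linter.style.haveILetI false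
set_option linter.unusedVariables false

lemma card_split {E : Type*} [Field E] (f : E[X]) (hf : f ≠ 0) (R : Finset E) (hR : ∀ x ∈ R, f.eval x = 0)
    (hc : f.natDegree ≤ R.card) : f.Splits := by
  rw [splits_iff_card_roots]
  apply le_antisymm (card_roots' f)
  refine hc.trans (Multiset.card_le_card ?_)
  rw [Finset.val_le_iff_val_subset]
  intro x hx
  rw [mem_roots hf]
  exact hR x hx

lemma frac_hom {R F E : Type*} [CommRing R] [IsDomain R] [Field F] [Algebra R F] [IsFractionRing R F] [Field E]
    (g : R →+* E) (hg : Function.Injective g) : ∃ φ : F →+* E, ∀ r, φ (algebraMap R F r) = g r :=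
  ⟨IsFractionRing.lift hg, fun r => IsFractionRing.lift_algebraMap hg r⟩

section Setting
universe uL
variable {𝕜 F : Type*} {L : Type uL} [Field 𝕜] [IsAlgClosed 𝕜] [Field F] [Field L] [Algebra 𝕜[X] F]
  [IsFractionRing 𝕜[X] F]
  [Algebra F L] [Algebra 𝕜[X] L] [IsScalarTower 𝕜[X] F L]
  [Algebra 𝕜 L] [IsScalarTower 𝕜 𝕜[X] L]
  {p e q d : ℕ} {u w : ℕ → 𝕜}

abbrev EE (𝕜 : Type*) [Field 𝕜] := FractionRing (PowerSeries 𝕜)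

lemma Vs_zero (H : Hyp 𝕜 p e q d u w) (s : 𝕜) : (0 : 𝕜) ∈ Vs q d u w s := by
  have := H.q2
  simp only [Vs, Set.mem_ofPred_eq]
  rw [ev_zero (by omega), ev_zero (by omega), mul_zero]

variable (F) in
lemma exists_iota [hsp : IsSplittingField F L (PF F q d u w)] (H : Hyp 𝕜 p e q d u w) (s : 𝕜) (hs : u 0 - s * w 0 ≠ 0) :
    ∃ ι : L →+* EE 𝕜, ∀ g, ι (algebraMap 𝕜[X] L g) = algebraMap (PowerSeries 𝕜) (EE 𝕜) (chi s g) := by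
  classical
  have hi : Function.Injective ((algebraMap (PowerSeries 𝕜) (EE 𝕜)).comp (chi s)) :=
    (IsFractionRing.injective (PowerSeries 𝕜) (EE 𝕜)).comp (chi_inj s)
  obtain ⟨φ, hφ0⟩ := frac_hom (F := F) _ hi
  have hφ : φ.comp (algebraMap 𝕜[X] F) = (algebraMap (PowerSeries 𝕜) (EE 𝕜)).comp (chi s) := by
    refine RingHom.ext fun g => ?_
    exact hφ0 g
  have hsplit : Splits ((PF F q d u w).map φ) := by
    have hm : ((PF F q d u w).map φ).Monic := (PF_monic H).map _
    have hfin : (Vs q d u w s \ {0}).Finite := by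
      refine (Set.finite_of_ncard_pos ?_).subset Set.sdiff_subset
      rw [Vs_card H s hs]; exact Nat.pow_pos (by have := H.q2; omega)
    choose y hy1 hy2 using fun y0 : (hfin.toFinset) => ps_roots H s hs y0.1 (by
      have := y0.2; rw [Set.Finite.mem_toFinset] at this; exact this.1)
    have hinj : Function.Injective (fun z => algebraMap (PowerSeries 𝕜) (EE 𝕜) (y z)) := by
      intro a b hab
      have := IsFractionRing.injective (PowerSeries 𝕜) (EE 𝕜) hab
      apply Subtype.ext
      rw [← hy1, ← hy1, this]
    apply card_split _ hm.ne_zero (Finset.univ.image (fun z => algebraMap (PowerSeries 𝕜) (EE 𝕜) (y z)))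
    · intro x hx
      obtain ⟨z, _, rfl⟩ := Finset.mem_image.1 hx
      have h1 := eval_BB (q := q) (d := d) (u := u) (w := w) (chi s) (fun c => chi_C s c) (by have := H.q2; omega) (y z)
      rw [hy2 z, sub_self] at h1
      have hz := z.2
      rw [Set.Finite.mem_toFinset] at hz
      have hy0 : y z ≠ 0 := by
        intro h0
        apply hz.2
        rw [Set.mem_singleton_iff, ← hy1, h0, map_zero]
      have h2 := (mul_eq_zero.1 h1).resolve_left hy0
      rw [PF, map_map, hφ, ← map_map, eval_map_apply, h2, map_zero]
    · rw [Finset.card_image_of_injective _ hinj, (PF_monic H).natDegree_map, PF_natDegree H, Finset.card_univ, Fintype.card_coe,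
        ← Set.ncard_eq_toFinset_card _ hfin, Set.ncard_sdiff_singleton_of_mem (Vs_zero H s), Vs_card H s hs]
  obtain ⟨ι, hι⟩ := lift_hom (L := L) (PF F q d u w) φ hsplit
  refine ⟨ι, fun g => ?_⟩
  rw [IsScalarTower.algebraMap_apply 𝕜[X] F L, hι]
  exact RingHom.congr_fun hφ g

lemma exists_P (s : 𝕜) (ι : L →+* EE 𝕜)
    (hι : ∀ g, ι (algebraMap 𝕜[X] L g) = algebraMap (PowerSeries 𝕜) (EE 𝕜) (chi s g)) :
    ∃ P : integralClosure 𝕜[X] L →ₐ[𝕜] PowerSeries 𝕜, ∀ x, algebraMap (PowerSeries 𝕜) (EE 𝕜) (P x) = ι x.1 := by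
  have hinj := IsFractionRing.injective (PowerSeries 𝕜) (EE 𝕜)
  have hex : ∀ x : integralClosure 𝕜[X] L, ∃ y, algebraMap (PowerSeries 𝕜) (EE 𝕜) y = ι x.1 := by
    intro x
    apply IsIntegrallyClosed.isIntegral_iff.1
    obtain ⟨f, hf, hx⟩ := x.2
    refine ⟨f.map (chi s), hf.map _, ?_⟩
    rw [eval₂_map]
    have : (algebraMap (PowerSeries 𝕜) (EE 𝕜)).comp (chi s) = ι.comp (algebraMap 𝕜[X] L) :=
      RingHom.ext (fun g => (hι g).symm)
    rw [this, ← hom_eval₂, hx, map_zero]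
  choose P hP using hex
  refine ⟨{ toFun := P, map_one' := hinj ?_, map_mul' := fun x y => hinj ?_, map_zero' := hinj ?_, map_add' := fun x y => hinj ?_, commutes' := fun c => hinj ?_}, hP⟩
  · rw [hP, map_one]; exact map_one ι
  · rw [hP, map_mul, hP, hP]; exact map_mul ι _ _
  · rw [hP, map_zero]; exact map_zero ι
  · rw [hP, map_add, hP, hP]; exact map_add ι _ _
  · rw [hP]
    have : ((algebraMap 𝕜 (integralClosure 𝕜[X] L) c) : integralClosure 𝕜[X] L).1 = algebraMap 𝕜[X] L (C c) := by
      change algebraMap 𝕜 L c = _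
      rw [IsScalarTower.algebraMap_apply 𝕜 𝕜[X] L]; rfl
    rw [this, hι, chi_C]; rfl

end Setting
end Chb

namespace Chb
open Polynomial
set_option linter.unusedSectionVars false
set_option linter.style.haveILetI false
set_option linter.unusedVariables false

section Setting
universe uL
variable {𝕜 F : Type*} {L : Type uL} [Field 𝕜] [IsAlgClosed 𝕜] [Field F] [Field L] [Algebra 𝕜[X] F]
  [IsFractionRing 𝕜[X] F]
  [Algebra F L] [Algebra 𝕜[X] L] [IsScalarTower 𝕜[X] F L]
  [Algebra 𝕜 L] [IsScalarTower 𝕜 𝕜[X] L]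
  {p e q d : ℕ} {u w : ℕ → 𝕜}

lemma algC (c : 𝕜) : algebraMap 𝕜[X] L (C c) = algebraMap 𝕜 L c := by
  rw [IsScalarTower.algebraMap_apply 𝕜 𝕜[X] L]; rfl

lemma V0_BB (H : Hyp 𝕜 p e q d u w) (x : L) (hx : x ∈ V0 L q d u w) (hx0 : x ≠ 0) :
    aeval x (BB q d u w) = 0 := by
  have h := eval_BB (q := q) (d := d) (u := u) (w := w) (algebraMap 𝕜[X] L) (fun c => algC c) (by have := H.q2; omega) x
  rw [show ev q u (d+1) x = _ from hx, sub_self] at h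
  have := (mul_eq_zero.1 h).resolve_left hx0
  rwa [eval_map, ← aeval_def] at this

lemma V0_int (H : Hyp 𝕜 p e q d u w) (x : L) (hx : x ∈ V0 L q d u w) : IsIntegral 𝕜[X] x := by
  by_cases hx0 : x = 0
  · rw [hx0]; exact isIntegral_zero
  exact ⟨BB q d u w, BB_monic H, V0_BB H x hx hx0⟩

lemma Vt_V0 (H : Hyp 𝕜 p e q d u w) (t : Vt F L q d u w) : t.1 ∈ V0 L q d u w := ((root_iff H t.1).1 t.2).2

def vO (H : Hyp 𝕜 p e q d u w) (t : Vt F L q d u w) : integralClosure 𝕜[X] L := ⟨t.1, V0_int H _ (Vt_V0 H t)⟩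

def IsIota (s : 𝕜) (ι : L →+* EE 𝕜) : Prop :=
  ∀ g, ι (algebraMap 𝕜[X] L g) = algebraMap (PowerSeries 𝕜) (EE 𝕜) (chi s g)

lemma IsIota.comp {s : 𝕜} {ι : L →+* EE 𝕜} (h : IsIota s ι) (σ : L ≃ₐ[F] L) : IsIota s (ι.comp (σ : L →+* L)) := by
  intro g
  rw [← h g, RingHom.comp_apply]
  congr 1
  rw [IsScalarTower.algebraMap_apply 𝕜[X] F L]
  exact σ.commutes _

def IsP (ι : L →+* EE 𝕜) (P : integralClosure 𝕜[X] L →ₐ[𝕜] PowerSeries 𝕜) : Prop :=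
  ∀ x, algebraMap (PowerSeries 𝕜) (EE 𝕜) (P x) = ι x.1

lemma hom_ev {A B : Type*} [CommRing A] [Algebra 𝕜 A] [CommRing B] [Algebra 𝕜 B] (f : A →+* B) (θ : 𝕜 → 𝕜)
    (hf : ∀ c, f (algebraMap 𝕜 A c) = algebraMap 𝕜 B (θ c)) (c : ℕ → 𝕜) (hc : ∀ j, θ (c j) = c j) (N : ℕ) (x : A) :
    f (ev q c N x) = ev q c N (f x) := by
  rw [ev, ev, map_sum]
  apply Finset.sum_congr rfl
  intro j _
  rw [Algebra.smul_def, Algebra.smul_def, map_mul, hf, hc, map_pow]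

section pt
variable {s : 𝕜} {ι : L →+* EE 𝕜} (hι : IsIota s ι) {P : integralClosure 𝕜[X] L →ₐ[𝕜] PowerSeries 𝕜} (hP : IsP ι P)

lemma einj : Function.Injective (algebraMap (PowerSeries 𝕜) (EE 𝕜)) := IsFractionRing.injective (PowerSeries 𝕜) (EE 𝕜)

lemma P_ev (hι : IsIota s ι) (hP : IsP ι P) (x : integralClosure 𝕜[X] L) (hx : x.1 ∈ V0 L q d u w) :
    ev q u (d+1) (P x) = chi s X * ev q w d (P x) := by
  apply einj
  have h : ∀ (c : ℕ → 𝕜) N, algebraMap (PowerSeries 𝕜) (EE 𝕜) (ev q c N (P x)) = ι (ev q c N x.1) := by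
    intro c N
    simp only [ev, map_sum]
    apply Finset.sum_congr rfl
    intro j _
    rw [Algebra.smul_def, Algebra.smul_def, map_mul, map_mul, map_pow, map_pow, hP, ← algC, hι, chi_C]; rfl
  rw [map_mul, h, h, ← hι, ← map_mul]
  congr 1

lemma P_cc (hι : IsIota s ι) (hP : IsP ι P) (x : integralClosure 𝕜[X] L) (hx : x.1 ∈ V0 L q d u w) :
    PowerSeries.constantCoeff (P x) ∈ Vs q d u w s := by
  have h := congrArg PowerSeries.constantCoeff (P_ev hι hP x hx)
  rw [map_mul, cc_chi, eval_X] at h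
  have h2 : ∀ (c : ℕ → 𝕜) N, PowerSeries.constantCoeff (ev q c N (P x)) = ev q c N (PowerSeries.constantCoeff (P x)) := by
    intro c N
    exact hom_ev _ id (fun c => PowerSeries.constantCoeff_C c) c (fun _ => rfl) N _
  rw [h2, h2] at h
  exact h

lemma P_cc_zero (H : Hyp 𝕜 p e q d u w) (hs : u 0 - s * w 0 ≠ 0) (hι : IsIota s ι) (hP : IsP ι P)
    (x : integralClosure 𝕜[X] L) (hx : x.1 ∈ V0 L q d u w) (h0 : PowerSeries.constantCoeff (P x) = 0) : x.1 = 0 := by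
  by_contra hx0
  have h1 := V0_BB H x.1 hx hx0
  have h2 : eval₂ ((PowerSeries.constantCoeff (R := 𝕜)).comp (chi s)) (PowerSeries.constantCoeff (P x)) (BB q d u w) = 0 := by
    rw [← hom_eval₂]
    have : eval₂ (chi s) (P x) (BB q d u w) = 0 := by
      apply einj
      rw [hom_eval₂, hP, map_zero]
      have : (algebraMap (PowerSeries 𝕜) (EE 𝕜)).comp (chi s) = ι.comp (algebraMap 𝕜[X] L) :=
        RingHom.ext (fun g => (hι g).symm)
      rw [this, ← hom_eval₂, ← aeval_def, h1, map_zero]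
    rw [this, map_zero]
  rw [h0, eval₂_at_zero, BB_coeff0 H.q2 H.hd, RingHom.comp_apply, cc_chi] at h2
  apply hs
  rw [eval_sub, eval_C, eval_mul, eval_X, eval_C] at h2; exact h2

lemma P_cc_inj (H : Hyp 𝕜 p e q d u w) (hs : u 0 - s * w 0 ≠ 0) (hι : IsIota s ι) (hP : IsP ι P)
    (x y : integralClosure 𝕜[X] L) (hx : x.1 ∈ V0 L q d u w) (hy : y.1 ∈ V0 L q d u w)
    (h : PowerSeries.constantCoeff (P x) = PowerSeries.constantCoeff (P y)) : x = y := by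
  haveI := H.ch
  haveI : CharP L p := (Algebra.charP_iff 𝕜 L p).1 inferInstance
  have hm : (x - y).1 ∈ V0 L q d u w := by
    have h1 := V0_closed H (-1) (by
      rw [H.hq]
      rcases H.hp.eq_two_or_odd' with h | h
      · subst h
        rw [CharTwo.neg_eq, one_pow]
      · exact (h.pow (n := e)).neg_one_pow) y.1 hy x.1 hx
    rw [neg_one_smul, neg_add_eq_sub] at h1
    exact h1
  have := P_cc_zero H hs hι hP (x - y) hm (by rw [map_sub, map_sub, h, sub_self])
  rw [← sub_eq_zero]
  exact Subtype.ext this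

/-- the derivative relation -/
lemma P_der (H : Hyp 𝕜 p e q d u w) (hι : IsIota s ι) (hP : IsP ι P) (x : integralClosure 𝕜[X] L) (hx : x.1 ∈ V0 L q d u w) :
    (PowerSeries.C (u 0) - chi s X * PowerSeries.C (w 0)) * PowerSeries.derivative 𝕜 (P x) =
      ∑ j ∈ Finset.range d, w j • (P x) ^ q ^ j := by
  haveI := H.ch
  haveI : CharP (PowerSeries 𝕜) p := (Algebra.charP_iff 𝕜 (PowerSeries 𝕜) p).1 inferInstance
  have h1 : ∀ (c : ℕ → 𝕜) N, 1 ≤ N → PowerSeries.derivative 𝕜 (ev q c N (P x)) = PowerSeries.C (c 0) * PowerSeries.derivative 𝕜 (P x) := by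
    intro c N hN
    rw [ev, map_sum, Finset.sum_eq_single 0]
    · rw [pow_zero, pow_one, Derivation.map_smul, PowerSeries.smul_eq_C_mul]
    · intro j _ hj
      rw [Derivation.map_smul, Derivation.leibniz_pow]
      have : ((q ^ j : ℕ) : PowerSeries 𝕜) = 0 := by
        rw [CharP.cast_eq_zero_iff _ p, H.hq]
        exact dvd_pow (dvd_pow_self _ (by have := H.he; omega)) hj
      rw [← Nat.cast_smul_eq_nsmul (PowerSeries 𝕜), this, zero_smul, smul_zero]
    · intro h; exact absurd (Finset.mem_range.2 (by omega)) h
  have h2 := congrArg (PowerSeries.derivative 𝕜) (P_ev hι hP x hx)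
  rw [Derivation.leibniz, h1 u _ (by omega), h1 w _ H.hd, chi_X, map_add, PowerSeries.derivative_X, PowerSeries.derivative_C] at h2
  change _ = ev q w d (P x)
  rw [chi_X]
  simp only [smul_eq_mul, add_zero, mul_one] at h2
  linear_combination h2
end pt
end Setting
end Chb

namespace Chb
open Polynomial
set_option linter.unusedSectionVars false
set_option linter.style.haveILetI false
set_option linter.unusedVariables false

section Setting
universe uL
variable {𝕜 F : Type*} {L : Type uL} [Field 𝕜] [IsAlgClosed 𝕜] [Field F] [Field L] [Algebra 𝕜[X] F]
  [IsFractionRing 𝕜[X] F]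
  [Algebra F L] [Algebra 𝕜[X] L] [IsScalarTower 𝕜[X] F L]
  [Algebra 𝕜 L] [IsScalarTower 𝕜 𝕜[X] L]
  {p e q d : ℕ} {u w : ℕ → 𝕜}

structure Semi (Q : ℕ) (ψ : L →+* L) : Prop where
  hc : ∀ c : 𝕜, ψ (algebraMap 𝕜 L c) = algebraMap 𝕜 L (c ^ Q)
  hX : ψ (algebraMap 𝕜[X] L X) = algebraMap 𝕜[X] L X

lemma Semi.V0 {Q : ℕ} {ψ : L →+* L} (h : Semi (𝕜 := 𝕜) Q ψ) (hu : ∀ j, u j ^ Q = u j) (hw : ∀ j, w j ^ Q = w j)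
    {x : L} (hx : x ∈ V0 L q d u w) : ψ x ∈ V0 L q d u w := by
  have h1 := hom_ev (q := q) ψ (fun c => c ^ Q) h.hc u hu (d+1) x
  have h2 := hom_ev (q := q) ψ (fun c => c ^ Q) h.hc w hw d x
  change ev q u (d+1) (ψ x) = algebraMap 𝕜[X] L X * ev q w d (ψ x)
  rw [← h1, ← h2, show ev q u (d+1) x = _ from hx, map_mul, h.hX]

/-- Frobenius on coefficients -/
noncomputable def fr (p a : ℕ) [ExpChar 𝕜 p] : 𝕜[X] →+* 𝕜[X] := mapRingHom (iterateFrobenius 𝕜 p a)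

lemma Semi.apply {Q a : ℕ} [ExpChar 𝕜 p] (hQ : Q = p ^ a) {ψ : L →+* L} (h : Semi (𝕜 := 𝕜) Q ψ) (g : 𝕜[X]) :
    ψ (algebraMap 𝕜[X] L g) = algebraMap 𝕜[X] L (fr p a g) := by
  have : ψ.comp (algebraMap 𝕜[X] L) = (algebraMap 𝕜[X] L).comp (fr p a) := by
    apply Polynomial.ringHom_ext
    · intro c
      rw [RingHom.comp_apply, RingHom.comp_apply, algC, h.hc, fr, coe_mapRingHom, map_C, algC, iterateFrobenius_def, hQ]
    · rw [RingHom.comp_apply, RingHom.comp_apply, h.hX, fr, coe_mapRingHom, map_X]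
  exact RingHom.congr_fun this g

lemma Semi.integral {Q a : ℕ} [ExpChar 𝕜 p] (hQ : Q = p ^ a) {ψ : L →+* L} (h : Semi (𝕜 := 𝕜) Q ψ) {x : L}
    (hx : IsIntegral 𝕜[X] x) : IsIntegral 𝕜[X] (ψ x) := by
  obtain ⟨f, hf, hx⟩ := hx
  refine ⟨f.map (fr p a), hf.map _, ?_⟩
  rw [eval₂_map]
  have : (algebraMap 𝕜[X] L).comp (fr p a) = ψ.comp (algebraMap 𝕜[X] L) := RingHom.ext fun g => (h.apply hQ g).symm
  rw [this, ← hom_eval₂, hx, map_zero]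

lemma Semi.exO {Q a : ℕ} [ExpChar 𝕜 p] (hQ : Q = p ^ a) {ψ : L →+* L} (h : Semi (𝕜 := 𝕜) Q ψ) :
    ∃ ψO : integralClosure 𝕜[X] L →+* integralClosure 𝕜[X] L, ∀ x, (ψO x).1 = ψ x.1 :=
  ⟨{ toFun := fun x => ⟨ψ x.1, h.integral hQ x.2⟩
     map_one' := Subtype.ext (map_one ψ)
     map_mul' := fun x y => Subtype.ext (map_mul ψ _ _)
     map_zero' := Subtype.ext (map_zero ψ)
     map_add' := fun x y => Subtype.ext (map_add ψ _ _) }, fun x => rfl⟩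

/-- good parameters -/
def Good (u w : ℕ → 𝕜) : Type _ := {s : 𝕜 // u 0 - s * w 0 ≠ 0}

variable (F L u w) in
/-- a system of points -/
structure Sys where
  ι : Good u w → L →+* EE 𝕜
  hι : ∀ s, IsIota s.1 (ι s)
  P : Good u w × (L ≃ₐ[F] L) → integralClosure 𝕜[X] L →ₐ[𝕜] PowerSeries 𝕜
  hP : ∀ i x, algebraMap (PowerSeries 𝕜) (EE 𝕜) (P i x) = ι i.1 (i.2 x.1)

lemma exists_Sys [hsp : IsSplittingField F L (PF F q d u w)] (H : Hyp 𝕜 p e q d u w) : Nonempty (Sys F L u w) := by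
  choose ι hι using fun s : Good u w => exists_iota F (L := L) H s.1 s.2
  choose P hP using fun i : Good u w × (L ≃ₐ[F] L) => exists_P i.1.1 _ (IsIota.comp (hι i.1) i.2)
  exact ⟨⟨ι, hι, P, hP⟩⟩

lemma Sys.isI (Y : Sys F L u w) (i : Good u w × (L ≃ₐ[F] L)) :
    IsIota i.1.1 ((Y.ι i.1).comp (i.2 : L →+* L)) := (Y.hι i.1).comp i.2

lemma Sys.isP (Y : Sys F L u w) (i : Good u w × (L ≃ₐ[F] L)) :
    IsP ((Y.ι i.1).comp (i.2 : L →+* L)) (Y.P i) := Y.hP i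

def Sys.Fix (Y : Sys F L u w) (Q : ℕ) (ψ : L →+* L) (i : Good u w × (L ≃ₐ[F] L)) : Prop :=
  ∀ x y : integralClosure 𝕜[X] L, y.1 = ψ x.1 → PowerSeries.constantCoeff (Y.P i x) ^ Q = PowerSeries.constantCoeff (Y.P i y)

variable [hsp : IsSplittingField F L (PF F q d u w)]

lemma Good_inf (H : Hyp 𝕜 p e q d u w) : Infinite (Good u w) := by
  haveI : Infinite 𝕜 := inferInstance
  have hfin : {s : 𝕜 | u 0 - s * w 0 = 0}.Finite := by
    by_cases h : w 0 = 0
    · have h0 := H.h0.resolve_right (by simpa using h)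
      have : {s : 𝕜 | u 0 - s * w 0 = 0} = ∅ := by
        ext s; simp [h, h0]
      rw [this]; exact Set.finite_empty
    · refine (Set.finite_singleton (u 0 / w 0)).subset ?_
      intro s hs
      rw [Set.mem_singleton_iff, eq_div_iff h]
      exact (sub_eq_zero.1 hs).symm
  exact (hfin.infinite_compl).to_subtype

lemma steps (H : Hyp 𝕜 p e q d u w) (Y : Sys F L u w) (t1 : Vt F L q d u w) :
    ∃ h z : ℕ, z ≤ d - 1 ∧ h ≤ (q ^ d - 1) ^ z ∧ h * (q ^ d - 1) = Nat.card (L ≃ₐ[F] L) ∧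
    ∀ (l ra sb A B : ℕ) (ψ : L →+* L), (l = 1 ∨ (l ≤ p ∧ 1 ≤ sb)) → Semi (𝕜 := 𝕜) (p ^ ra * p ^ sb) ψ →
      (∀ j, u j ^ (p ^ ra * p ^ sb) = u j) → (∀ j, w j ^ (p ^ ra * p ^ sb) = w j) →
      h * (A + (q ^ d - 2) * z) < p ^ sb →
      ∑ i ∈ Finset.range l, (h * (p ^ ra * (A + (q ^ d - 2) * z + i * (q ^ (d - 1) * (z + 1))) + (B + (q ^ d - 2) * z)) + 1) <
        ((A + 1) * h) * ((B + 1) * h) →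
      ∀ T : Finset (Good u w × (L ≃ₐ[F] L)), (∀ i ∈ T, Y.Fix (p ^ ra * p ^ sb) ψ i) →
      l * T.card ≤ h * (A + (q ^ d - 2) * z) + p ^ sb * (h * (B + (q ^ d - 2) * z)) := by
  classical
  haveI := H.ch
  haveI := Fact.mk H.hp
  haveI := findim (F := F) (L := L) H
  haveI : Fintype (L ≃ₐ[F] L) := Fintype.ofFinite _
  haveI : ExpChar 𝕜 p := ExpChar.prime H.hp
  obtain ⟨Z, J, iJ, ex, hZ, hex, hJ, hG, hli⟩ := hbox H t1
  obtain ⟨V, hVc, hVs⟩ := exists_V F (L := L) H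
  refine ⟨Fintype.card J, Multiset.card Z, hZ, hJ, hG, ?_⟩
  intro l ra sb A B ψ hl hψ hu hw hyp1 hyp2 T hT
  obtain ⟨ψO, hψO⟩ := hψ.exO (p := p) (a := ra + sb) (by rw [pow_add])
  let v := V.valuation
  haveI : Infinite (Good u w) := Good_inf H
  haveI : Infinite (Good u w × (L ≃ₐ[F] L)) := inferInstance
  refine stepanov p (fun i => Y.P i) (vO (F := F) H) (LLs H v hVc) ?_ ?_ ?_ ?_ (Fintype.card J) ?_ q d
    (by have := H.q2; omega) w (fun i => PowerSeries.C (u 0) - chi i.1.1 X * PowerSeries.C (w 0)) ?_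
    ?_ l (p ^ ra) (p ^ sb) ra sb rfl rfl hl ψO ?_
    (fun t => ⟨ψ t.1, ?_⟩) ?_ t1 Z ex (q ^ d - 2) (Multiset.card Z) rfl hex ?_ A B hyp1 hyp2 T ?_
  · -- one
    intro σ
    change v (σ 1) ≤ _
    simp
  · -- mul
    intro M M' x y hx hy σ
    change v (σ (x.1 * y.1)) ≤ _
    rw [map_mul, map_mul, Multiset.map_add, Multiset.prod_add]
    exact mul_le_mul' (hx σ) (hy σ)
  · -- mono
    intro M M' hM x hx σ
    refine (hx σ).trans ?_
    obtain ⟨M2, rfl⟩ := Multiset.le_iff_exists_add.1 hM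
    rw [Multiset.map_add, Multiset.prod_add]
    apply le_mul_of_one_le_right'
    apply Multiset.one_le_prod_of_one_le
    intro y hy
    obtain ⟨t, _, rfl⟩ := Multiset.mem_map.1 hy
    exact le_max_left _ _
  · -- gen
    intro t σ
    rw [Multiset.map_singleton, Multiset.prod_singleton]
    exact le_max_right _ _
  · -- C1
    intro M x hx hx0 T l hT
    obtain ⟨n, hn0, hnk, hn⟩ := LLs_norm H v hVc hVs (Fintype.card J) hG M x hx hx0
    refine C1_pts (fun s : Good u w => s.1) Subtype.val_injective (fun i => Y.P i x) _ n hn0 hnk ?_ T l hT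
    intro s
    apply einj
    rw [map_prod, ← chi_apply, ← Y.hι s, hn, map_prod]
    apply Finset.prod_congr rfl
    intro σ _
    rw [Y.hP]
  · intro i
    rw [PowerSeries.isUnit_iff_constantCoeff, map_sub, map_mul, cc_chi, eval_X, PowerSeries.constantCoeff_C,
      PowerSeries.constantCoeff_C]
    exact isUnit_iff_ne_zero.2 i.1.2
  · intro i t
    exact P_der H (Y.isI i) (Y.isP i) _ (Vt_V0 H t)
  · intro c
    apply Subtype.ext
    rw [hψO]
    exact hψ.hc c
  · rw [root_iff H]
    refine ⟨?_, hψ.V0 hu hw (Vt_V0 H t)⟩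
    rw [Ne, map_eq_zero]
    exact root_ne_zero H t.1 t.2
  · intro t
    apply Subtype.ext
    rw [hψO]
    rfl
  · intro A
    apply LinearIndependent.of_comp (IsScalarTower.toAlgHom 𝕜 (integralClosure 𝕜[X] L) L).toLinearMap
    have h1 := hli.comp (fun a : Fin A × J => ((a.1 : ℕ), a.2)) (by
      rintro ⟨a, b⟩ ⟨a', b'⟩ h
      simp only [Prod.mk.injEq] at h
      exact Prod.ext (Fin.ext h.1) h.2)
    have e : ((IsScalarTower.toAlgHom 𝕜 (integralClosure 𝕜[X] L) L).toLinearMap ∘ fun a : Fin A × J =>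
        vO (F := F) H t1 ^ (a.1 : ℕ) * ((ex a.2).map (vO (F := F) H)).prod) =
        ((fun a : ℕ × J => t1.1 ^ a.1 * ((ex a.2).map (fun t => t.1)).prod) ∘ (fun a : Fin A × J => ((a.1 : ℕ), a.2))) := by
      funext a
      simp only [Function.comp_apply, AlgHom.toLinearMap_apply, map_mul, map_pow, map_multiset_prod, Multiset.map_map]
      rfl
    rw [e]; exact h1
  · intro i hi x
    exact hT i hi x _ (hψO x)

end Setting
end Chb

namespace Chb
open Polynomial
set_option linter.unusedSectionVars false
set_option linter.style.haveILetI false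
set_option linter.unusedVariables false

section Setting
universe uL
variable {𝕜 F : Type*} {L : Type uL} [Field 𝕜] [IsAlgClosed 𝕜] [Field F] [Field L] [Algebra 𝕜[X] F]
  [IsFractionRing 𝕜[X] F]
  [Algebra F L] [Algebra 𝕜[X] L] [IsScalarTower 𝕜[X] F L]
  [Algebra 𝕜 L] [IsScalarTower 𝕜 𝕜[X] L]
  {p e q d : ℕ} {u w : ℕ → 𝕜}

lemma lp1_map {Q a : ℕ} [ExpChar 𝕜 p] (hQ : Q = p ^ a) (c : ℕ → 𝕜) (hc : ∀ j, c j ^ Q = c j) (N : ℕ) :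
    (lp1 q c N).map (iterateFrobenius 𝕜 p a) = lp1 q c N := by
  rw [lp1, Polynomial.map_sum]
  apply Finset.sum_congr rfl
  intro j _
  rw [Polynomial.map_mul, Polynomial.map_pow, map_X, map_C, iterateFrobenius_def, ← hQ, hc]

lemma fr_C {a : ℕ} [ExpChar 𝕜 p] (c : 𝕜) : fr p a (C c) = C (c ^ p ^ a) := by
  rw [fr, coe_mapRingHom, map_C, iterateFrobenius_def]

lemma fr_X {a : ℕ} [ExpChar 𝕜 p] : fr p a (X : 𝕜[X]) = X := by
  rw [fr, coe_mapRingHom, map_X]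

lemma fr_inj {a : ℕ} [ExpChar 𝕜 p] : Function.Injective (fr p a : 𝕜[X] →+* 𝕜[X]) :=
  Polynomial.map_injective _ (iterateFrobenius 𝕜 p a).injective

lemma BB_map {Q a : ℕ} [ExpChar 𝕜 p] (hQ : Q = p ^ a) (hu : ∀ j, u j ^ Q = u j) (hw : ∀ j, w j ^ Q = w j) :
    (BB q d u w).map (fr p a) = BB q d u w := by
  have : (fr p a : 𝕜[X] →+* 𝕜[X]).comp C = C.comp (iterateFrobenius 𝕜 p a) := by
    ext1 c
    rw [RingHom.comp_apply, RingHom.comp_apply, fr_C, iterateFrobenius_def]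
  rw [BB, Polynomial.map_sub, Polynomial.map_mul, map_C, fr_X, map_map, map_map, this, ← map_map, ← map_map,
    lp1_map hQ u hu, lp1_map hQ w hw]

lemma frac_ext {E : Type*} [Field E] (f g : F →+* E) (h : ∀ r : 𝕜[X], f (algebraMap 𝕜[X] F r) = g (algebraMap 𝕜[X] F r)) :
    f = g := by
  apply IsLocalization.ringHom_ext (nonZeroDivisors 𝕜[X])
  exact RingHom.ext h

variable (F) in
lemma exists_semi [hsp : IsSplittingField F L (PF F q d u w)] {Q a : ℕ} [ExpChar 𝕜 p] (hQ : Q = p ^ a)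
    (hu : ∀ j, u j ^ Q = u j) (hw : ∀ j, w j ^ Q = w j) :
    ∃ ψ : L →+* L, Semi (𝕜 := 𝕜) Q ψ := by
  obtain ⟨φ, hφ⟩ := frac_hom (F := F) ((algebraMap 𝕜[X] F).comp (fr p a))
    ((IsFractionRing.injective 𝕜[X] F).comp fr_inj)
  obtain ⟨Φ, hΦ⟩ := ext_endo (L := L) (PF F q d u w) φ (by
    have : φ.comp (algebraMap 𝕜[X] F) = (algebraMap 𝕜[X] F).comp (fr p a) := RingHom.ext hφ
    rw [PF, map_map, this, ← map_map, BB_map hQ hu hw])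
  have h1 : ∀ g, Φ (algebraMap 𝕜[X] L g) = algebraMap 𝕜[X] L (fr p a g) := by
    intro g
    rw [IsScalarTower.algebraMap_apply 𝕜[X] F L, hΦ, hφ, RingHom.comp_apply, ← IsScalarTower.algebraMap_apply]
  refine ⟨Φ, ⟨fun c => ?_, ?_⟩⟩
  · rw [← algC, h1, fr_C, algC, hQ]
  · rw [h1, fr_X]

lemma Semi.comp {Q : ℕ} {ψ : L →+* L} (h : Semi (𝕜 := 𝕜) Q ψ) (σ : L ≃ₐ[F] L) : Semi (𝕜 := 𝕜) Q (ψ.comp (σ : L →+* L)) := by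
  have hσ : ∀ g : 𝕜[X], σ (algebraMap 𝕜[X] L g) = algebraMap 𝕜[X] L g := by
    intro g
    rw [IsScalarTower.algebraMap_apply 𝕜[X] F L, σ.commutes]
  refine ⟨fun c => ?_, ?_⟩
  · rw [RingHom.comp_apply, ← h.hc, ← algC]
    exact congrArg ψ (hσ _)
  · rw [RingHom.comp_apply]
    exact (congrArg ψ (hσ _)).trans h.hX

lemma chi_fr {Q a : ℕ} [ExpChar 𝕜 p] (hQ : Q = p ^ a) (s : 𝕜) (hs : s ^ Q = s) (g : 𝕜[X]) :
    chi s (fr p a g) = PowerSeries.map (iterateFrobenius 𝕜 p a) (chi s g) := by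
  have : (chi s).comp (fr p a) = (PowerSeries.map (iterateFrobenius 𝕜 p a)).comp (chi s) := by
    apply Polynomial.ringHom_ext
    · intro c
      rw [RingHom.comp_apply, RingHom.comp_apply, fr_C, chi_C, chi_C, PowerSeries.map_C, iterateFrobenius_def]
    · rw [RingHom.comp_apply, RingHom.comp_apply, fr_X, chi_X, map_add, PowerSeries.map_X, PowerSeries.map_C,
        iterateFrobenius_def, ← hQ, hs]
  exact RingHom.congr_fun this g

lemma exists_frob [hsp : IsSplittingField F L (PF F q d u w)] {Q a : ℕ} [ExpChar 𝕜 p] (hQ : Q = p ^ a)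
    (Y : Sys F L u w) {ψ : L →+* L} (hψ : Semi (𝕜 := 𝕜) Q ψ)
    (i : Good u w × (L ≃ₐ[F] L)) (hi : i.1.1 ^ Q = i.1.1) :
    ∃ σ : L ≃ₐ[F] L, Y.Fix Q (ψ.comp (σ : L →+* L)) i := by
  have hinj : Function.Injective ((algebraMap (PowerSeries 𝕜) (EE 𝕜)).comp (PowerSeries.map (iterateFrobenius 𝕜 p a))) :=
    einj.comp (PowerSeries.map_injective _ (iterateFrobenius 𝕜 p a).injective)
  obtain ⟨φ, hφ⟩ := frac_hom (F := EE 𝕜) _ hinj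
  have hI := Y.isI i
  have hP := Y.isP i
  set ι := (Y.ι i.1).comp (i.2 : L →+* L) with hι
  obtain ⟨σ, hσ⟩ := gal_diff (PF F q d u w) (ι.comp ψ) (φ.comp ι) (by
    apply RingHom.congr_fun (f := ((ι.comp ψ).comp (algebraMap F L))) (g := (φ.comp ι).comp (algebraMap F L))
    apply frac_ext (𝕜 := 𝕜)
    intro g
    simp only [RingHom.comp_apply]
    rw [← IsScalarTower.algebraMap_apply 𝕜[X] F L, hψ.apply hQ, hI, hI, hφ, RingHom.comp_apply, chi_fr hQ _ hi])
  refine ⟨σ, ?_⟩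
  intro x y hxy
  have h1 : Y.P i y = PowerSeries.map (iterateFrobenius 𝕜 p a) (Y.P i x) := by
    apply einj
    rw [hP y, hxy]
    have := hσ x.1
    simp only [RingHom.comp_apply] at this
    rw [RingHom.comp_apply]
    refine Eq.trans this.symm ?_
    rw [← hP x, hφ]; rfl
  rw [h1, ← PowerSeries.coeff_zero_eq_constantCoeff_apply (PowerSeries.map _ _), PowerSeries.coeff_map,
    PowerSeries.coeff_zero_eq_constantCoeff_apply, iterateFrobenius_def, hQ]

end Setting
end Chb

namespace Chb
open Polynomial
set_option linter.unusedSectionVars false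
set_option linter.style.haveILetI false
set_option linter.unusedVariables false

section Setting
universe uL
variable {𝕜 F : Type*} {L : Type uL} [Field 𝕜] [IsAlgClosed 𝕜] [Field F] [Field L] [Algebra 𝕜[X] F]
  [IsFractionRing 𝕜[X] F]
  [Algebra F L] [Algebra 𝕜[X] L] [IsScalarTower 𝕜[X] F L]
  [Algebra 𝕜 L] [IsScalarTower 𝕜 𝕜[X] L]
  {p e q d : ℕ} {u w : ℕ → 𝕜}

variable [hsp : IsSplittingField F L (PF F q d u w)]

lemma P_surj (H : Hyp 𝕜 p e q d u w) (Y : Sys F L u w) (i : Good u w × (L ≃ₐ[F] L)) (y : 𝕜) (hy : y ∈ Vs q d u w i.1.1) :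
    ∃ x : integralClosure 𝕜[X] L, x.1 ∈ V0 L q d u w ∧ PowerSeries.constantCoeff (Y.P i x) = y := by
  have hVf : (Vs q d u w i.1.1).Finite := by
    apply Set.finite_of_ncard_pos
    rw [Vs_card H _ i.1.2]; exact Nat.pow_pos (by have := H.q2; omega)
  have hV0f := V0_fin F (L := L) H
  obtain ⟨a, ha, hb⟩ := Set.surj_on_of_inj_on_of_ncard_le (s := V0 L q d u w) (t := Vs q d u w i.1.1)
    (fun x hx => PowerSeries.constantCoeff (Y.P i ⟨x, V0_int H x hx⟩))
    (fun x hx => P_cc (Y.isI i) (Y.isP i) _ hx)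
    (fun x y hx hy h => congrArg Subtype.val (P_cc_inj H i.1.2 (Y.isI i) (Y.isP i) _ _ hx hy h))
    (by rw [Vs_card H _ i.1.2, V0_card F H]) hVf y hy
  exact ⟨⟨a, V0_int H a ha⟩, ha, hb.symm⟩

lemma fix_count (H : Hyp 𝕜 p e q d u w) (Y : Sys F L u w) {Q : ℕ} (hu : ∀ j, u j ^ Q = u j) (hw : ∀ j, w j ^ Q = w j)
    {ψ : L →+* L} (hψ : Semi (𝕜 := 𝕜) Q ψ) (i : Good u w × (L ≃ₐ[F] L)) (hi : Y.Fix Q ψ i) :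
    {x | x ∈ V0 L q d u w ∧ ψ x = x}.ncard = {y | y ∈ Vs q d u w i.1.1 ∧ y ^ Q = y}.ncard := by
  refine Set.ncard_congr (fun x hx => PowerSeries.constantCoeff (Y.P i ⟨x, V0_int H x hx.1⟩)) ?_ ?_ ?_
  · intro x hx
    refine ⟨P_cc (Y.isI i) (Y.isP i) _ hx.1, ?_⟩
    exact hi _ _ hx.2.symm
  · intro x y hx hy h
    exact congrArg Subtype.val (P_cc_inj H i.1.2 (Y.isI i) (Y.isP i) _ _ hx.1 hy.1 h)
  · rintro y ⟨hy, hyQ⟩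
    obtain ⟨x, hx, rfl⟩ := P_surj H Y i y hy
    have hx' := hψ.V0 hu hw hx
    refine ⟨x.1, ⟨hx, ?_⟩, rfl⟩
    have h1 := hi x ⟨ψ x.1, V0_int H _ hx'⟩ rfl
    rw [hyQ] at h1
    exact (congrArg Subtype.val (P_cc_inj H i.1.2 (Y.isI i) (Y.isP i) _ _ hx hx' h1)).symm

lemma V0_Vt (H : Hyp 𝕜 p e q d u w) (x : L) (hx : x ∈ V0 L q d u w) (hx0 : x ≠ 0) : aeval x (PF F q d u w) = 0 :=
  (root_iff H x).2 ⟨hx0, hx⟩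

lemma semi_fiber (H : Hyp 𝕜 p e q d u w) {Q : ℕ} (hu : ∀ j, u j ^ Q = u j) (hw : ∀ j, w j ^ Q = w j)
    {ψ : L →+* L} (hψ : Semi (𝕜 := 𝕜) Q ψ) (v : Vt F L q d u w) :
    Nat.card {σ : L ≃ₐ[F] L // ψ (σ v.1) = v.1} * (q ^ d - 1) = Nat.card (L ≃ₐ[F] L) := by
  haveI := Vt_finite (F := F) (L := L) H
  let g : Vt F L q d u w → Vt F L q d u w := fun t => ⟨ψ t.1, V0_Vt H _ (hψ.V0 hu hw (Vt_V0 H t)) (by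
    rw [Ne, map_eq_zero]; exact root_ne_zero H t.1 t.2)⟩
  have hg : Function.Injective g := by
    intro a b hab
    exact Subtype.ext (ψ.injective (congrArg Subtype.val hab))
  obtain ⟨v', hv'⟩ := Finite.surjective_of_injective hg v
  have hv2 : ψ v'.1 = v.1 := congrArg Subtype.val hv'
  rw [← fiber H v v']
  congr 1
  apply Nat.card_congr
  refine Equiv.subtypeEquivRight fun σ => ?_
  rw [← hv2]
  exact ψ.injective.eq_iff

/-- abstract geometric counting -/
lemma geo (H : Hyp 𝕜 p e q d u w) (Y : Sys F L u w) {Q a : ℕ} (hQ : Q = p ^ a) (hu : ∀ j, u j ^ Q = u j) (hw : ∀ j, w j ^ Q = w j)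
    (hgood : ∀ x : 𝕜, ev q w d x ≠ 0 → u 0 * ev q w d x - ev q u (d+1) x * w 0 ≠ 0)
    (KK : Finset 𝕜) (hKK : ∀ x, x ∈ KK ↔ x ^ Q = x)
    (h : ℕ) (hh : h * (q ^ d - 1) = Nat.card (L ≃ₐ[F] L)) (b : ℕ)
    (hb : ∀ ψ : L →+* L, Semi (𝕜 := 𝕜) Q ψ → ∀ T : Finset (Good u w × (L ≃ₐ[F] L)), (∀ i ∈ T, Y.Fix Q ψ i) → T.card ≤ b)
    (ψ : L →+* L) (hψ : Semi (𝕜 := 𝕜) Q ψ) (v : Vt F L q d u w) (hv : ψ v.1 = v.1) :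
    h * {x | x ∈ KK ∧ ev q w d x ≠ 0}.ncard ≤
      {s | s ∈ KK ∧ u 0 - s * w 0 ≠ 0 ∧ {y | y ∈ Vs q d u w s ∧ y ^ Q = y}.ncard =
        {x | x ∈ V0 L q d u w ∧ ψ x = x}.ncard}.ncard * (h * (q ^ d - 1)) + (h - 1) * b := by
  classical
  haveI := H.ch
  haveI : ExpChar 𝕜 p := ExpChar.prime H.hp
  haveI := findim (F := F) (L := L) H
  haveI : Fintype (L ≃ₐ[F] L) := Fintype.ofFinite _
  have hqd : 0 < q ^ d - 1 := by have := H.qd2; have := H.q2; omega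
  -- good K-points
  have hGf : Finite {s : Good u w // s.1 ^ Q = s.1} := by
    apply Finite.of_injective (fun s => (⟨s.1.1, (hKK _).2 s.2⟩ : KK))
    intro a b hab
    have h2 : a.1.1 = b.1.1 := by simpa using congrArg (fun z : KK => (z : 𝕜)) hab
    exact Subtype.ext (Subtype.ext h2)
  haveI : Fintype {s : Good u w // s.1 ^ Q = s.1} := Fintype.ofFinite _
  let I0 : Finset (Good u w × (L ≃ₐ[F] L)) :=
    (Finset.univ : Finset ({s : Good u w // s.1 ^ Q = s.1} × (L ≃ₐ[F] L))).image (fun i => (i.1.1, i.2))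
  have hI0 : ∀ i, i ∈ I0 ↔ i.1.1 ^ Q = i.1.1 := by
    rintro ⟨s, τ⟩
    simp only [I0, Finset.mem_image, Finset.mem_univ, true_and, Prod.exists]
    constructor
    · rintro ⟨a, b, hab⟩
      rw [← (Prod.mk.inj hab).1]; exact a.2
    · intro hs
      exact ⟨⟨s, hs⟩, τ, rfl⟩
  let T : (L ≃ₐ[F] L) → Finset (Good u w × (L ≃ₐ[F] L)) := fun σ => I0.filter (fun i => Y.Fix Q (ψ.comp (σ : L →+* L)) i)
  let G1 : Finset (L ≃ₐ[F] L) := Finset.univ.filter (fun σ => ψ (σ v.1) = v.1)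
  have hG1 : G1.card = h := by
    have h1 := semi_fiber H hu hw hψ v
    rw [Nat.card_eq_fintype_card, Fintype.card_subtype, ← hh] at h1
    exact Nat.eq_of_mul_eq_mul_right hqd h1
  have h1G : (1 : L ≃ₐ[F] L) ∈ G1 := by
    simp only [G1, Finset.mem_filter, Finset.mem_univ, true_and]; exact hv
  -- the big set
  let D : Finset (Good u w × (L ≃ₐ[F] L)) := I0.filter (fun i => PowerSeries.constantCoeff (Y.P i (vO H v)) ∈ KK)
  have hDsub : D ⊆ G1.biUnion T := by
    intro i hi
    obtain ⟨hi1, hi2⟩ := Finset.mem_filter.1 hi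
    obtain ⟨σ, hσ⟩ := exists_frob (q := q) (d := d) hQ Y hψ i ((hI0 i).1 hi1)
    refine Finset.mem_biUnion.2 ⟨σ, ?_, Finset.mem_filter.2 ⟨hi1, hσ⟩⟩
    simp only [G1, Finset.mem_filter, Finset.mem_univ, true_and]
    have hs := hψ.comp σ
    have hm := hs.V0 hu hw (Vt_V0 H v)
    have h1 := hσ (vO H v) ⟨_, V0_int H _ hm⟩ rfl
    rw [(hKK _).1 hi2] at h1
    have h2 := P_cc_inj H i.1.2 (Y.isI i) (Y.isP i) (vO H v) _ (Vt_V0 H v) hm h1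
    exact (congrArg Subtype.val h2).symm
  have hD : h * {x | x ∈ KK ∧ ev q w d x ≠ 0}.ncard ≤ D.card := by
    let X0 := KK.filter (fun x => ev q w d x ≠ 0)
    have hX0 : {x | x ∈ KK ∧ ev q w d x ≠ 0}.ncard = X0.card := by
      rw [← Set.ncard_coe_finset]; congr 1; ext x; simp [X0]
    rw [hX0, mul_comm]
    let m : (Good u w × (L ≃ₐ[F] L)) → 𝕜 := fun i => PowerSeries.constantCoeff (Y.P i (vO H v))
    have : X0.card * h ≤ ∑ x ∈ X0, (D.filter (fun i => m i = x)).card := by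
      rw [← smul_eq_mul]
      apply Finset.card_nsmul_le_sum
      intro x hx
      obtain ⟨hx1, hx2⟩ := Finset.mem_filter.1 hx
      have hxQ := (hKK x).1 hx1
      have hs : u 0 - (ev q u (d+1) x / ev q w d x) * w 0 ≠ 0 := by
        intro h0
        apply hgood x hx2
        field_simp at h0
        linear_combination h0
      let s : Good u w := ⟨ev q u (d+1) x / ev q w d x, hs⟩
      have hsQ : s.1 ^ Q = s.1 := by
        have e1 : ∀ (c : ℕ → 𝕜) (hc : ∀ j, c j ^ Q = c j) N, (ev q c N x) ^ Q = ev q c N x := by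
          intro c hc N
          have := hom_ev (q := q) (iterateFrobenius 𝕜 p a) (fun c => c ^ Q) (fun c => by
            rw [iterateFrobenius_def, ← hQ]; rfl) c hc N x
          rw [iterateFrobenius_def, iterateFrobenius_def, ← hQ, hxQ] at this
          exact this
        change (_ / _) ^ Q = _
        rw [div_pow, e1 u hu, e1 w hw]
      have hxs : x ∈ Vs q d u w s.1 := by
        change _ = _ / _ * _
        rw [div_mul_cancel₀ _ hx2]
      obtain ⟨y, hy, hyx⟩ := P_surj H Y (s, 1) x hxs
      have hy0 : y.1 ≠ 0 := by
        intro h0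
        have : y = 0 := Subtype.ext h0
        rw [this, map_zero, map_zero] at hyx
        apply hx2
        rw [← hyx, ev_zero (by have := H.q2; omega)]
      have hf := fiber H v ⟨y.1, V0_Vt H _ hy hy0⟩
      rw [Nat.card_eq_fintype_card, Fintype.card_subtype, ← hh] at hf
      rw [← Nat.eq_of_mul_eq_mul_right hqd hf]
      refine Finset.card_le_card_of_injOn (fun τ => (s, τ)) ?_ ?_
      · intro τ hτ
        have hτ' : τ v.1 = y.1 := by simpa using hτ
        have hm : m (s, τ) = x := by
          have : Y.P (s, τ) (vO H v) = Y.P (s, 1) y := by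
            apply einj
            rw [Y.hP, Y.hP]
            change Y.ι s (τ v.1) = Y.ι s y.1
            rw [hτ']
          simp only [m]
          rw [this, hyx]
        refine Finset.mem_coe.2 (Finset.mem_filter.2 ⟨Finset.mem_filter.2 ⟨(hI0 _).2 hsQ, ?_⟩, hm⟩)
        change m (s, τ) ∈ KK
        rw [hm]; exact hx1
      · intro τ _ τ' _ hh
        exact (Prod.mk.inj hh).2
    refine this.trans ?_
    rw [← Finset.card_biUnion]
    · apply Finset.card_le_card
      intro i hi
      obtain ⟨x, _, hx⟩ := Finset.mem_biUnion.1 hi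
      exact (Finset.mem_filter.1 hx).1
    · intro x _ y _ hxy
      rw [Function.onFun, Finset.disjoint_left]
      intro i hi hi'
      exact hxy ((Finset.mem_filter.1 hi).2.symm.trans (Finset.mem_filter.1 hi').2)
  have hT1 : (T 1).card ≤ {s | s ∈ KK ∧ u 0 - s * w 0 ≠ 0 ∧ {y | y ∈ Vs q d u w s ∧ y ^ Q = y}.ncard =
        {x | x ∈ V0 L q d u w ∧ ψ x = x}.ncard}.ncard * (h * (q ^ d - 1)) := by
    rw [hh, Nat.card_eq_fintype_card]
    let N0 := KK.filter (fun s => u 0 - s * w 0 ≠ 0 ∧ {y | y ∈ Vs q d u w s ∧ y ^ Q = y}.ncard =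
        {x | x ∈ V0 L q d u w ∧ ψ x = x}.ncard)
    have hN0 : {s | s ∈ KK ∧ u 0 - s * w 0 ≠ 0 ∧ {y | y ∈ Vs q d u w s ∧ y ^ Q = y}.ncard =
        {x | x ∈ V0 L q d u w ∧ ψ x = x}.ncard}.ncard = N0.card := by
      rw [← Set.ncard_coe_finset]; congr 1; ext x; simp [N0]
    rw [hN0, ← Finset.card_univ, ← Finset.card_product]
    refine Finset.card_le_card_of_injOn (fun i => (i.1.1, i.2)) ?_ ?_
    · intro i hi
      obtain ⟨hi1, hi2⟩ := Finset.mem_filter.1 (Finset.mem_coe.1 hi)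
      refine Finset.mem_coe.2 (Finset.mem_product.2 ⟨Finset.mem_filter.2 ⟨(hKK _).2 ((hI0 i).1 hi1), i.1.2, ?_⟩, Finset.mem_univ _⟩)
      have hi3 : Y.Fix Q ψ i := hi2
      exact (fix_count H Y hu hw hψ i hi3).symm
    · intro i _ j _ hij
      have := Prod.mk.inj hij
      exact Prod.ext (Subtype.ext this.1) this.2
  calc _ ≤ D.card := hD
    _ ≤ (G1.biUnion T).card := Finset.card_le_card hDsub
    _ ≤ ∑ σ ∈ G1, (T σ).card := Finset.card_biUnion_le
    _ = (T 1).card + ∑ σ ∈ G1.erase 1, (T σ).card := (Finset.add_sum_erase _ _ h1G).symm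
    _ ≤ _ := by
      refine Nat.add_le_add hT1 ?_
      refine (Finset.sum_le_card_nsmul _ _ b ?_).trans ?_
      · intro σ _
        exact hb _ (hψ.comp σ) _ (fun i hi => (Finset.mem_filter.1 hi).2)
      · rw [Finset.card_erase_of_mem h1G, hG1, smul_eq_mul]

end Setting
end Chb

namespace Chb
open Polynomial
set_option linter.unusedSectionVars false
set_option linter.style.haveILetI false
set_option linter.unusedVariables false

section Infty
variable {𝕜 : Type*} [Field 𝕜] [IsAlgClosed 𝕜] {p e q t k : ℕ} {w : ℕ → 𝕜}

/-- the equation at infinity -/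
def SM {M : Type*} [CommRing M] (θ : PowerSeries 𝕜 →+* M) (q t : ℕ) (w : ℕ → 𝕜) : Set M :=
  {x | ∑ j ∈ Finset.range t, θ (PowerSeries.C (w j)) * x ^ q ^ j = θ PowerSeries.X * x ^ q ^ t}

lemma SM_hom {M M' : Type*} [CommRing M] [CommRing M'] (θ : PowerSeries 𝕜 →+* M) (g : M →+* M') (x : M) (hx : x ∈ SM θ q t w) :
    g x ∈ SM (g.comp θ) q t w := by
  have := congrArg g (show _ = _ from hx)
  rw [map_sum, map_mul, map_pow] at this
  simpa [SM] using this

lemma SM_sub (hp : p.Prime) (hq : q = p ^ e) {M : Type*} [CommRing M] [CharP M p] (θ : PowerSeries 𝕜 →+* M) (x y : M)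
    (hx : x ∈ SM θ q t w) (hy : y ∈ SM θ q t w) : x - y ∈ SM θ q t w := by
  haveI := Fact.mk hp
  have hs : ∀ j, (x - y) ^ q ^ j = x ^ q ^ j - y ^ q ^ j := by
    intro j
    rw [hq, ← pow_mul, sub_pow_char_pow]
  simp only [SM, Set.mem_ofPred_eq, hs, mul_sub, Finset.sum_sub_distrib] at *
  rw [hx, hy]

lemma SM_zero (hq : 1 ≤ q) {M : Type*} [CommRing M] (θ : PowerSeries 𝕜 →+* M) : (0 : M) ∈ SM θ q t w := by
  have : ∀ j, (0 : M) ^ q ^ j = 0 := fun j => zero_pow (Nat.pow_pos hq).ne'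
  simp [SM, this]

lemma SS_cc (ht : 1 ≤ t) (hq : 1 ≤ q) (y : PowerSeries 𝕜) (hy : y ∈ SM (RingHom.id _) q t w) :
    ev q w t (PowerSeries.constantCoeff y) = 0 := by
  have := congrArg PowerSeries.constantCoeff (show _ = _ from hy)
  simpa [ev] using this

lemma SS_cc_zero (ht : 1 ≤ t) (hq : 2 ≤ q) (hw : w 0 ≠ 0) (y : PowerSeries 𝕜) (hy : y ∈ SM (RingHom.id _) q t w)
    (h0 : PowerSeries.constantCoeff y = 0) : y = 0 := by
  have h1 : y * (∑ j ∈ Finset.range t, PowerSeries.C (w j) * y ^ (q ^ j - 1) - PowerSeries.X * y ^ (q ^ t - 1)) = 0 := by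
    have e1 : ∀ j, y * y ^ (q ^ j - 1) = y ^ q ^ j := fun j => by
      rw [← pow_succ', Nat.sub_add_cancel (Nat.pow_pos (by omega))]
    have h2 : ∑ j ∈ Finset.range t, PowerSeries.C (w j) * y ^ q ^ j = PowerSeries.X * y ^ q ^ t := by simpa [SM] using hy
    rw [mul_sub, mul_left_comm, e1, Finset.mul_sum, ← h2, sub_eq_zero]
    apply Finset.sum_congr rfl
    intro j _
    rw [mul_left_comm, e1]
  refine (mul_eq_zero.1 h1).resolve_right ?_
  intro h2
  apply hw
  have h3 := congrArg PowerSeries.constantCoeff h2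
  rw [map_sub, map_sum, map_mul, PowerSeries.constantCoeff_X, zero_mul, sub_zero, map_zero,
    Finset.sum_eq_single_of_mem 0 (Finset.mem_range.2 (by omega))] at h3
  · simpa using h3
  · intro j _ hj
    have : q ^ j - 1 ≠ 0 := by
      have := Nat.one_lt_pow hj (show 1 < q by omega); omega
    rw [map_mul, map_pow, h0, zero_pow this, mul_zero]

lemma ccharP (hp : CharP 𝕜 p) : CharP (PowerSeries 𝕜) p :=
  charP_of_injective_algebraMap (algebraMap 𝕜 (PowerSeries 𝕜)).injective p

lemma SS_inj (hp : p.Prime) [CharP 𝕜 p] (hqe : q = p ^ e) (ht : 1 ≤ t) (hq : 2 ≤ q) (hw : w 0 ≠ 0) (x y : PowerSeries 𝕜) (hx : x ∈ SM (RingHom.id _) q t w)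
    (hy : y ∈ SM (RingHom.id _) q t w)
    (h0 : PowerSeries.constantCoeff x = PowerSeries.constantCoeff y) : x = y := by
  haveI := ccharP (𝕜 := 𝕜) (p := p) inferInstance
  rw [← sub_eq_zero]
  exact SS_cc_zero ht hq hw _ (SM_sub hp hqe _ _ _ hx hy) (by rw [map_sub, h0, sub_self])

lemma SS_surj (hp : p.Prime) [CharP 𝕜 p] (he : 1 ≤ e) (hqe : q = p ^ e) (ht : 1 ≤ t) (hw : w 0 ≠ 0) (y0 : 𝕜) (hy : ev q w t y0 = 0) :
    ∃ y : PowerSeries 𝕜, y ∈ SM (RingHom.id _) q t w ∧ PowerSeries.constantCoeff y = y0 := by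
  haveI := Fact.mk hp
  let A : ℕ → PowerSeries 𝕜 := fun j => if j < t then PowerSeries.C (w j) else - PowerSeries.X
  have hA : ∀ j < t, A j = PowerSeries.C (w j) := fun j hj => if_pos hj
  have hAt : A t = - PowerSeries.X := if_neg (lt_irrefl _)
  obtain ⟨y, h1, h2⟩ := ps_lift p q e hqe he t A (by
    rw [hA 0 (by omega), PowerSeries.isUnit_iff_constantCoeff, PowerSeries.constantCoeff_C]; exact isUnit_iff_ne_zero.2 hw) y0 (by
    rw [Finset.sum_range_succ, hAt, map_neg, PowerSeries.constantCoeff_X, neg_zero, zero_mul, add_zero, ← hy, ev]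
    apply Finset.sum_congr rfl
    intro j hj
    rw [hA j (Finset.mem_range.1 hj), PowerSeries.constantCoeff_C, smul_eq_mul])
  refine ⟨y, ?_, h1⟩
  rw [Finset.sum_range_succ, hAt, neg_mul, ← sub_eq_add_neg, sub_eq_zero] at h2
  simp only [SM, Set.mem_ofPred_eq, RingHom.id_apply]
  rw [← h2]
  apply Finset.sum_congr rfl
  intro j hj
  rw [hA j (Finset.mem_range.1 hj)]

lemma ker_card (hp : p.Prime) [CharP 𝕜 p] (he : 1 ≤ e) (hqe : q = p ^ e) (hkt : k < t) (hw : w 0 ≠ 0) (hwk : w k ≠ 0)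
    (hwj : ∀ j, k < j → w j = 0) : {y : 𝕜 | ev q w t y = 0}.ncard = q ^ k := by
  rw [← lin_card hp he hqe w k hw hwk]
  congr 1
  ext y
  simp only [Set.mem_ofPred_eq]
  have : ev q w t y = ev q w (k+1) y := by
    rw [ev, ev]
    symm
    apply Finset.sum_subset
    · intro j hj; rw [Finset.mem_range] at *; omega
    · intro j _ hj
      rw [hwj j (by rw [Finset.mem_range] at hj; omega), zero_smul]
  rw [this]

lemma SS_card (hp : p.Prime) [CharP 𝕜 p] (he : 1 ≤ e) (hqe : q = p ^ e) (hkt : k < t) (hq : 2 ≤ q) (hw : w 0 ≠ 0) (hwk : w k ≠ 0)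
    (hwj : ∀ j, k < j → w j = 0) : (SM (RingHom.id (PowerSeries 𝕜)) q t w).ncard = q ^ k := by
  rw [← ker_card hp he hqe hkt hw hwk hwj]
  apply Set.ncard_congr (fun y _ => PowerSeries.constantCoeff y)
  · intro y hy; exact SS_cc (by omega) (by omega) y hy
  · intro x y hx hy h; exact SS_inj hp hqe (by omega) hq hw x y hx hy h
  · intro y0 hy
    obtain ⟨y, h1, h2⟩ := SS_surj hp he hqe (show 1 ≤ t by omega) hw y0 hy
    exact ⟨y, h1, h2⟩

/-- the reversed polynomial -/
noncomputable def CC (q t : ℕ) (w : ℕ → 𝕜) : (PowerSeries 𝕜)[X] :=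
  ∑ j ∈ Finset.range t, C (PowerSeries.C (w j / w 0)) * X ^ (q ^ t - q ^ j) - C (PowerSeries.C (w 0)⁻¹ * PowerSeries.X)

lemma CC_monic (ht : 1 ≤ t) (hq : 2 ≤ q) (hw : w 0 ≠ 0) : (CC q t w).Monic ∧ (CC q t w).natDegree = q ^ t - 1 := by
  have hpt : ∀ j, 1 ≤ j → q ≤ q ^ j := fun j hj => Nat.le_self_pow (by omega) q
  have e1 : CC q t w = X ^ (q ^ t - 1) + (∑ j ∈ Finset.range (t-1), C (PowerSeries.C (w (j+1) / w 0)) * X ^ (q ^ t - q ^ (j+1)) - C (PowerSeries.C (w 0)⁻¹ * PowerSeries.X)) := by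
    rw [CC]
    obtain ⟨s, rfl⟩ : ∃ s, t = s + 1 := ⟨t-1, by omega⟩
    rw [Finset.sum_range_succ', div_self hw]
    simp
    ring
  have hd : (∑ j ∈ Finset.range (t-1), C (PowerSeries.C (w (j+1) / w 0)) * X ^ (q ^ t - q ^ (j+1)) - C (PowerSeries.C (w 0)⁻¹ * PowerSeries.X)).degree < ((q ^ t - 1 : ℕ) : WithBot ℕ) := by
    have hh := hpt t ht
    refine (degree_sub_le _ _).trans_lt (max_lt ?_ ?_)
    · refine (degree_sum_le _ _).trans_lt ?_
      rw [Finset.sup_lt_iff (WithBot.bot_lt_coe _)]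
      intro j _
      refine (degree_C_mul_X_pow_le _ _).trans_lt ?_
      have := hpt (j+1) (by omega)
      exact_mod_cast (show q ^ t - q ^ (j+1) < q ^ t - 1 by omega)
    · refine degree_C_le.trans_lt ?_
      exact_mod_cast (show 0 < q ^ t - 1 by omega)
  rw [e1]
  refine ⟨monic_X_pow_add hd, ?_⟩
  rw [natDegree_eq_of_degree_eq_some]
  rw [degree_add_eq_left_of_degree_lt (by rwa [degree_X_pow]), degree_X_pow]

lemma CC_eval {M : Type*} [Field M] (θ : PowerSeries 𝕜 →+* M) (hq : 2 ≤ q) (hw : w 0 ≠ 0) (x : M) (hx0 : x ≠ 0) (hx : x ∈ SM θ q t w) :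
    ((CC q t w).map θ).eval x⁻¹ = 0 := by
  have hdiv : ∀ c, θ (PowerSeries.C (c / w 0)) = θ (PowerSeries.C c) * (θ (PowerSeries.C (w 0)))⁻¹ := by
    intro c
    exact (map_div₀ (θ.comp PowerSeries.C) c (w 0)).trans (div_eq_mul_inv _ _)
  have hinv : θ (PowerSeries.C (w 0)⁻¹) = (θ (PowerSeries.C (w 0)))⁻¹ := map_inv₀ (θ.comp PowerSeries.C) (w 0)
  rw [CC, Polynomial.map_sub, Polynomial.map_sum, eval_sub, eval_finsetSum, map_C, eval_C, map_mul, hinv, sub_eq_zero]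
  have e1 : ∀ j ∈ Finset.range t, ((C (PowerSeries.C (w j / w 0)) * X ^ (q ^ t - q ^ j)).map θ).eval x⁻¹ =
      (θ (PowerSeries.C (w 0)))⁻¹ * (x⁻¹ ^ q ^ t) * (θ (PowerSeries.C (w j)) * x ^ q ^ j) := by
    intro j hj
    rw [Polynomial.map_mul, Polynomial.map_pow, map_X, map_C, eval_mul, eval_pow, eval_X, eval_C, hdiv]
    have h1 : x⁻¹ ^ q ^ t = x⁻¹ ^ (q ^ t - q ^ j) * x⁻¹ ^ q ^ j := by
      rw [← pow_add, Nat.sub_add_cancel (Nat.pow_le_pow_right (by omega) (Finset.mem_range.1 hj).le)]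
    have h2 : x⁻¹ ^ q ^ j * x ^ q ^ j = 1 := by rw [← mul_pow, inv_mul_cancel₀ hx0, one_pow]
    rw [h1]
    linear_combination -(θ (PowerSeries.C (w j)) * (θ (PowerSeries.C (w 0)))⁻¹ * x⁻¹ ^ (q ^ t - q ^ j)) * h2
  rw [Finset.sum_congr rfl e1, ← Finset.mul_sum, show _ = _ from hx]
  have h2 : x⁻¹ ^ q ^ t * x ^ q ^ t = 1 := by rw [← mul_pow, inv_mul_cancel₀ hx0, one_pow]
  linear_combination ((θ (PowerSeries.C (w 0)))⁻¹ * θ PowerSeries.X) * h2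

end Infty
end Chb

namespace Chb
open Polynomial
set_option linter.unusedSectionVars false
set_option linter.style.haveILetI false
set_option linter.unusedVariables false

section Infty
variable {𝕜 : Type*} [Field 𝕜] [IsAlgClosed 𝕜] {p e q t k : ℕ} {w : ℕ → 𝕜}

lemma CC_bar (hq : 2 ≤ q) (hkt : k < t) (hwj : ∀ j, k < j → w j = 0) :
    X ^ (q ^ t - q ^ k) ∣ (CC q t w).map (PowerSeries.constantCoeff (R := 𝕜)) := by
  rw [CC, Polynomial.map_sub, Polynomial.map_sum, map_C, map_mul, PowerSeries.constantCoeff_X, mul_zero, C_0, sub_zero]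
  apply Finset.dvd_sum
  intro j hj
  rw [Polynomial.map_mul, Polynomial.map_pow, map_X]
  by_cases h : k < j
  · rw [hwj j h, zero_div, map_zero, map_zero, Polynomial.map_zero, zero_mul]; exact dvd_zero _
  · apply Dvd.dvd.mul_left
    apply pow_dvd_pow
    have := Nat.pow_le_pow_right (show 0 < q by omega) (show j ≤ k by omega)
    omega

lemma SS_hom {E : Type*} [CommRing E] (θ : PowerSeries 𝕜 →+* E) (y : PowerSeries 𝕜)
    (hy : y ∈ SM (RingHom.id (PowerSeries 𝕜)) q t w) : θ y ∈ SM θ q t w := by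
  simp only [SM, Set.mem_ofPred_eq, RingHom.id_apply] at hy ⊢
  have := congrArg θ hy
  rw [map_sum, map_mul, map_pow] at this
  simpa using this

lemma CC_root {E : Type*} [Field E] (θ : PowerSeries 𝕜 →+* E) (hθ : Function.Injective θ) (hq : 2 ≤ q) (hw : w 0 ≠ 0) (y : PowerSeries 𝕜)
    (hy : y ∈ SM (RingHom.id _) q t w) (hinv : y * y⁻¹ = 1) :
    (CC q t w).eval y⁻¹ = 0 := by
  apply hθ
  have h4 := congrArg θ hinv
  replace h4 : θ y * θ y⁻¹ = 1 := by
    rw [← θ.map_mul, h4, θ.map_one]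
  have hsm : θ y ∈ SM θ q t w := by
    exact SS_hom θ y hy
  have hy0 : θ y ≠ 0 := by
    intro h0
    rw [h0, zero_mul] at h4
    exact zero_ne_one h4
  have h5 : θ y⁻¹ = (θ y)⁻¹ := by
    exact eq_inv_of_mul_eq_one_right h4
  have h1 := CC_eval (t := t) (w := w) θ hq hw (θ y) hy0 hsm
  rw [← h5, eval_map_apply] at h1
  rw [h1, map_zero]

set_option maxHeartbeats 1000000 in
lemma inf_irr (hp : p.Prime) [CharP 𝕜 p] (he : 1 ≤ e) (hqe : q = p ^ e) (hkt : k < t) (hq : 2 ≤ q) (hw : w 0 ≠ 0) (hwk : w k ≠ 0)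
    (hwj : ∀ j, k < j → w j = 0) :
    ∃ g : (PowerSeries 𝕜)[X], g.Monic ∧ Irreducible g ∧ ∀ {M : Type*} [Field M] (θ : PowerSeries 𝕜 →+* M) (hθ : Function.Injective θ) (x : M),
      x ∈ SM θ q t w → (∀ y ∈ SM (RingHom.id (PowerSeries 𝕜)) q t w, x ≠ θ y) → (g.map θ).eval x⁻¹ = 0 := by
  classical
  have hqk : 0 < q ^ k := Nat.pow_pos (by omega)
  have hcard := SS_card hp he hqe hkt hq hw hwk hwj
  have hfin : (SM (RingHom.id (PowerSeries 𝕜)) q t w).Finite := Set.finite_of_ncard_pos (by omega)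
  let S := hfin.toFinset.erase 0
  have hScard : S.card = q ^ k - 1 := by
    rw [Finset.card_erase_of_mem (hfin.mem_toFinset.2 (SM_zero (by omega) _)), ← Set.ncard_eq_toFinset_card _ hfin, hcard]
  have hS : ∀ y ∈ S, y ∈ SM (RingHom.id (PowerSeries 𝕜)) q t w ∧ PowerSeries.constantCoeff y ≠ 0 := by
    intro y hy
    obtain ⟨h1, h2⟩ := Finset.mem_erase.1 hy
    have h3 := hfin.mem_toFinset.1 h2
    exact ⟨h3, fun h => h1 (SS_cc_zero (by omega) hq hw y h3 h)⟩
  have hinv : ∀ y ∈ S, y * y⁻¹ = 1 := fun y hy => PowerSeries.mul_inv_cancel y (hS y hy).2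
  let A : (PowerSeries 𝕜)[X] := ∏ y ∈ S, (X - C y⁻¹)
  have hAm : A.Monic := monic_prod_of_monic _ _ fun y _ => monic_X_sub_C _
  have hAd : A.natDegree = q ^ k - 1 := by
    rw [natDegree_prod_of_monic _ _ fun y _ => monic_X_sub_C _]
    simp [hScard]
  obtain ⟨hCm, hCd⟩ := CC_monic (w := w) (show 1 ≤ t by omega) hq hw
  have hinj : Set.InjOn (fun y : PowerSeries 𝕜 => y⁻¹) S := by
    intro x hx y hy hxy
    have hxy' : x⁻¹ = y⁻¹ := hxy
    have h1 := hinv x hx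
    have h2 := hinv y hy
    rw [hxy'] at h1
    calc x = x * (y * y⁻¹) := by rw [h2, mul_one]
      _ = y * (x * y⁻¹) := by ring
      _ = y := by rw [h1, mul_one]
  have hdvd : A ∣ CC q t w := by
    have : A = ((S.image (fun y : PowerSeries 𝕜 => y⁻¹)).val.map fun a => X - C a).prod := by
      change _ = ∏ a ∈ S.image (fun y : PowerSeries 𝕜 => y⁻¹), (X - C a)
      rw [Finset.prod_image hinj]
    rw [this, Multiset.prod_X_sub_C_dvd_iff_le_roots hCm.ne_zero, Finset.val_le_iff_val_subset]
    intro z hz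
    obtain ⟨y, hy, rfl⟩ := Finset.mem_image.1 hz
    rw [mem_roots hCm.ne_zero, IsRoot.def]
    exact CC_root (algebraMap (PowerSeries 𝕜) (EE 𝕜)) einj hq hw y (hS y hy).1 (hinv y hy)
  obtain ⟨B, hB⟩ := hdvd
  have hBm : B.Monic := hAm.of_mul_monic_left (hB ▸ hCm)
  have hkt' : q ^ k < q ^ t := Nat.pow_lt_pow_right (by omega) hkt
  have hBd : B.natDegree = q ^ t - q ^ k := by
    have := hAm.natDegree_mul hBm
    rw [← hB, hCd, hAd] at this
    omega
  have hA0 : PowerSeries.constantCoeff (A.coeff 0) ≠ 0 := by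
    rw [coeff_zero_eq_eval_zero, eval_prod, map_prod, Finset.prod_ne_zero_iff]
    intro y hy
    rw [eval_sub, eval_X, eval_C, zero_sub, map_neg, neg_ne_zero]
    intro h0
    have := congrArg PowerSeries.constantCoeff (hinv y hy)
    rw [map_mul, h0, mul_zero, map_one] at this
    exact zero_ne_one this
  have hBbar : B.map PowerSeries.constantCoeff = X ^ (q ^ t - q ^ k) := by
    apply eq_of_monic_of_dvd_of_natDegree_le (monic_X_pow _) (hBm.map _)
    · have h1 := CC_bar hq hkt hwj
      rw [hB, Polynomial.map_mul] at h1
      refine IsCoprime.dvd_of_dvd_mul_left ?_ h1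
      apply IsCoprime.pow_left
      rw [(irreducible_X (R := 𝕜)).coprime_iff_not_dvd, X_dvd_iff, coeff_map]
      exact hA0
    · rw [natDegree_X_pow, hBm.natDegree_map, hBd]
  have hB0 : A.coeff 0 * B.coeff 0 = - (PowerSeries.C (w 0)⁻¹ * PowerSeries.X) := by
    rw [← mul_coeff_zero, ← hB, CC, coeff_sub, finsetSum_coeff, coeff_C_zero, Finset.sum_eq_zero, zero_sub]
    intro j hj
    rw [coeff_C_mul, coeff_X_pow, if_neg, mul_zero]
    have := Nat.pow_lt_pow_right (show 1 < q by omega) (Finset.mem_range.1 hj)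
    omega
  refine ⟨B, hBm, ?_, ?_⟩
  · have hE : B.IsEisensteinAt (Ideal.span {PowerSeries.X}) := by
      refine ⟨?_, ?_, ?_⟩
      · rw [hBm.leadingCoeff, Ideal.mem_span_singleton, PowerSeries.X_dvd_iff, map_one]; exact one_ne_zero
      · intro n hn
        rw [Ideal.mem_span_singleton, PowerSeries.X_dvd_iff, ← coeff_map, hBbar, coeff_X_pow, if_neg (by omega)]
      · rw [Ideal.span_singleton_pow, Ideal.mem_span_singleton]
        intro h
        have h2 := Dvd.dvd.mul_left h (A.coeff 0)
        rw [hB0, PowerSeries.X_pow_dvd_iff] at h2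
        have := h2 1 (by norm_num)
        rw [map_neg, PowerSeries.coeff_C_mul, PowerSeries.coeff_one_X, mul_one, neg_eq_zero, inv_eq_zero] at this
        exact hw this
    exact hE.irreducible PowerSeries.span_X_isPrime hBm.isPrimitive (by omega)
  · intro M _ θ hθ x hx hne
    have hx0 : x ≠ 0 := by
      have := hne 0 (SM_zero (by omega) _)
      rwa [map_zero] at this
    have h1 := CC_eval θ hq hw x hx0 hx
    rw [hB, Polynomial.map_mul, eval_mul] at h1
    refine (mul_eq_zero.1 h1).resolve_left ?_
    intro h2
    rw [Polynomial.map_prod, eval_prod, Finset.prod_eq_zero_iff] at h2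
    obtain ⟨y, hy, h3⟩ := h2
    rw [Polynomial.map_sub, map_X, map_C, eval_sub, eval_X, eval_C, sub_eq_zero] at h3
    apply hne y (hS y hy).1
    have h4 := congrArg θ (hinv y hy)
    rw [map_mul, map_one, ← h3] at h4
    field_simp at h4
    exact h4.symm

/-- counting fixed points over a transitive coset -/
lemma coset_avg {G X : Type*} [Group G] [Finite G] [MulAction G X] (S : Set X) (hS : S.Finite)
    (htr : ∀ x ∈ S, ∀ y ∈ S, ∃ g : G, g • x = y) (hst : ∀ x ∈ S, ∀ g : G, g • x ∈ S) (φ : X → X) (hφ : ∀ x ∈ S, φ x ∈ S) :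
    ∃ g : G, {x | x ∈ S ∧ g • φ x = x}.ncard ≤ 1 := by
  classical
  haveI := Fintype.ofFinite G
  by_contra hcon
  push Not at hcon
  let T := hS.toFinset
  have hT : ∀ x, x ∈ T ↔ x ∈ S := fun x => hS.mem_toFinset
  have h1 : ∀ g : G, 2 ≤ (T.filter (fun x => g • φ x = x)).card := by
    intro g
    refine (Nat.succ_le_of_lt (hcon g)).trans_eq ?_
    rw [← Set.ncard_coe_finset]; congr 1; ext x; simp [hT]
  have h2 : ∑ g : G, (T.filter (fun x => g • φ x = x)).card = ∑ x ∈ T, (Finset.univ.filter (fun g : G => g • φ x = x)).card := by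
    simp only [Finset.card_filter]
    exact Finset.sum_comm
  have h3 : ∀ x ∈ T, (Finset.univ.filter (fun g : G => g • φ x = x)).card * T.card = Fintype.card G := by
    intro x hx
    have hx' := (hT x).1 hx
    have e1 : ∀ z ∈ T, (Finset.univ.filter (fun g : G => g • φ x = z)).card = (Finset.univ.filter (fun g : G => g • φ x = x)).card := by
      intro z hz
      obtain ⟨a, ha⟩ := htr z ((hT z).1 hz) x hx'
      refine Finset.card_equiv (Equiv.mulLeft a) ?_
      intro g
      simp only [Finset.mem_filter, Finset.mem_univ, true_and, Equiv.coe_mulLeft, mul_smul]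
      rw [← ha]
      exact (smul_left_cancel_iff a).symm
    have e2 := Finset.card_eq_sum_card_fiberwise (s := (Finset.univ : Finset G)) (t := T) (f := fun g => g • φ x)
      (fun g _ => (hT _).2 (hst _ (hφ x hx') g))
    rw [Finset.sum_congr rfl e1, Finset.sum_const, smul_eq_mul, Finset.card_univ] at e2
    rw [e2, mul_comm]
  have h4 : Fintype.card G * 2 ≤ ∑ g : G, (T.filter (fun x => g • φ x = x)).card := by
    have := Finset.card_nsmul_le_sum (Finset.univ : Finset G) (fun g => (T.filter (fun x => g • φ x = x)).card) 2 (fun g _ => h1 g)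
    simpa using this
  have hG : 0 < Fintype.card G := Fintype.card_pos
  have hTne : T.Nonempty := by
    rw [Finset.nonempty_iff_ne_empty]
    intro h0
    have := h1 1
    rw [h0] at this
    simp at this
  have h5 : (∑ x ∈ T, (Finset.univ.filter (fun g : G => g • φ x = x)).card) * T.card = T.card * Fintype.card G := by
    rw [Finset.sum_mul, Finset.sum_congr rfl h3, Finset.sum_const, smul_eq_mul]
  have h6 : (∑ x ∈ T, (Finset.univ.filter (fun g : G => g • φ x = x)).card) = Fintype.card G := by
    rw [mul_comm] at h5
    exact Nat.eq_of_mul_eq_mul_left hTne.card_pos h5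
  omega

end Infty
end Chb

namespace Chb
open Polynomial
set_option linter.unusedSectionVars false
set_option linter.style.haveILetI false
set_option linter.unusedVariables false

section Infty
variable {𝕜 : Type*} [Field 𝕜] [IsAlgClosed 𝕜] {p e q t k : ℕ} {w : ℕ → 𝕜}

lemma SM_frob {M : Type*} [CommRing M] {Q a : ℕ} [ExpChar 𝕜 p] (hQ : Q = p ^ a) (hwQ : ∀ j, w j ^ Q = w j)
    (θ : PowerSeries 𝕜 →+* M) (φ : M →+* M) (hφ : ∀ y, φ (θ y) = θ (PowerSeries.map (iterateFrobenius 𝕜 p a) y))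
    (x : M) (hx : x ∈ SM θ q t w) : φ x ∈ SM θ q t w := by
  simp only [SM, Set.mem_ofPred_eq] at hx ⊢
  have := congrArg φ hx
  rw [map_sum, map_mul, map_pow, hφ, PowerSeries.map_X] at this
  rw [← this]
  apply Finset.sum_congr rfl
  intro j _
  rw [map_mul, map_pow, hφ, PowerSeries.map_C, iterateFrobenius_def, ← hQ, hwQ]

lemma inf_local {E M : Type*} [Field E] [Field M] [Algebra (PowerSeries 𝕜) E] [IsFractionRing (PowerSeries 𝕜) E] [Algebra E M]
    [FiniteDimensional E M] [Normal E M]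
    (hp : p.Prime) [CharP 𝕜 p] (he : 1 ≤ e) (hqe : q = p ^ e) (hkt : k < t) (hq : 2 ≤ q) (hw : w 0 ≠ 0) (hwk : w k ≠ 0)
    (hwj : ∀ j, k < j → w j = 0) {Q a : ℕ} [ExpChar 𝕜 p] (hQ : Q = p ^ a) (hwQ : ∀ j, w j ^ Q = w j)
    (θ : PowerSeries 𝕜 →+* M) (hθ : θ = (algebraMap E M).comp (algebraMap (PowerSeries 𝕜) E))
    (φ : M →+* M) (hφ : ∀ y, φ (θ y) = θ (PowerSeries.map (iterateFrobenius 𝕜 p a) y)) (hfin : (SM θ q t w).Finite)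
    (h2 : 2 ≤ {y : 𝕜 | ev q w t y = 0 ∧ y ^ Q = y}.ncard) :
    ∃ η : M ≃ₐ[E] M, {x | x ∈ SM θ q t w ∧ η (φ x) = x}.ncard = {y : 𝕜 | ev q w t y = 0 ∧ y ^ Q = y}.ncard := by
  have hinj : Function.Injective θ := by
    rw [hθ]; exact (algebraMap E M).injective.comp (IsFractionRing.injective (PowerSeries 𝕜) E)
  haveI : CharP M p := charP_of_injective_ringHom (θ.comp PowerSeries.C).injective p
  haveI : CharP (PowerSeries 𝕜) p := ccharP inferInstance
  have hηθ : ∀ (η : M ≃ₐ[E] M) y, η (θ y) = θ y := by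
    intro η y
    rw [hθ]; exact η.commutes _
  obtain ⟨g, hgm, hgi, hg⟩ := inf_irr hp he hqe hkt hq hw hwk hwj
  have hgi' : Irreducible (g.map (algebraMap (PowerSeries 𝕜) E)) :=
    (Polynomial.Monic.irreducible_iff_irreducible_map_fraction_map hgm).1 hgi
  set SS := SM (RingHom.id (PowerSeries 𝕜)) q t w with hSS
  have hSSfr : ∀ y ∈ SS, PowerSeries.map (iterateFrobenius 𝕜 p a) y ∈ SS := by
    intro y hy
    exact SM_frob hQ hwQ (RingHom.id _) _ (fun y => rfl) y hy
  have hSSfin : SS.Finite := by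
    apply Set.finite_of_ncard_pos
    rw [hSS, SS_card hp he hqe hkt hq hw hwk hwj]; exact Nat.pow_pos (by omega)
  have hcc : ∀ y : PowerSeries 𝕜, PowerSeries.constantCoeff (PowerSeries.map (iterateFrobenius 𝕜 p a) y) = (PowerSeries.constantCoeff y) ^ Q := by
    intro y
    rw [← PowerSeries.coeff_zero_eq_constantCoeff_apply (PowerSeries.map _ _), PowerSeries.coeff_map,
      PowerSeries.coeff_zero_eq_constantCoeff_apply, iterateFrobenius_def, hQ]
  have hSSinj := fun x y hx hy h => SS_inj (w := w) (t := t) hp hqe (by omega) hq hw x y hx hy h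
  let S1 : Set M := θ '' SS
  have hS1 : S1 ⊆ SM θ q t w := by
    rintro _ ⟨y, hy, rfl⟩
    exact SS_hom θ y hy
  let X0 : Set M := SM θ q t w \ S1
  have hηSM : ∀ (η : M ≃ₐ[E] M) x, x ∈ SM θ q t w → η x ∈ SM θ q t w := by
    intro η x hx
    have := SM_hom θ (η : M →+* M) x hx
    have e1 : (η : M →+* M).comp θ = θ := RingHom.ext (hηθ η)
    rw [e1] at this
    exact this
  have hφSM := SM_frob (q := q) (t := t) hQ hwQ θ φ hφ
  obtain ⟨η, hη⟩ := coset_avg (G := M ≃ₐ[E] M) X0 (hfin.subset Set.sdiff_subset) (by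
    intro x hx y hy
    have hne : ∀ z ∈ X0, ∀ y ∈ SS, z ≠ θ y := fun z hz y hy h => hz.2 ⟨y, hy, h.symm⟩
    have hr : ∀ z ∈ X0, aeval z⁻¹ (g.map (algebraMap (PowerSeries 𝕜) E)) = 0 := by
      intro z hz
      have := hg θ hinj z hz.1 (hne z hz)
      rw [hθ, ← map_map] at this
      rw [aeval_def, ← eval_map]; exact this
    have hm : minpoly E y⁻¹ = g.map (algebraMap (PowerSeries 𝕜) E) :=
      (minpoly.eq_of_irreducible_of_monic hgi' (hr y hy) (hgm.map _)).symm
    obtain ⟨σ, hσ⟩ := minpoly.exists_algEquiv_of_root (K := E) (x := x⁻¹) (y := y⁻¹) (IsAlgebraic.of_finite E _) (by rw [hm]; exact hr x hx)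
    refine ⟨σ, ?_⟩
    change σ x = y
    rw [map_inv₀] at hσ
    exact inv_injective hσ) (by
    intro x hx η
    refine ⟨hηSM η x hx.1, ?_⟩
    rintro ⟨y, hy, hyx⟩
    apply hx.2
    refine ⟨y, hy, ?_⟩
    apply η.injective
    rw [hηθ]; exact hyx) φ (by
    intro x hx
    refine ⟨hφSM x hx.1, ?_⟩
    rintro ⟨y, hy, hyx⟩
    apply hx.2
    obtain ⟨y', hy', h⟩ := Set.surj_on_of_inj_on_of_ncard_le (s := SS) (t := SS) (fun y _ => PowerSeries.map (iterateFrobenius 𝕜 p a) y)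
      (fun y hy => hSSfr y hy) (fun x y _ _ h => PowerSeries.map_injective _ (iterateFrobenius 𝕜 p a).injective h) le_rfl hSSfin y hy
    refine ⟨y', hy', ?_⟩
    apply φ.injective
    rw [hφ, ← hyx, h])
  refine ⟨η, ?_⟩
  -- fixed points on the lifted part
  have hfixS : ∀ y ∈ SS, (η (φ (θ y)) = θ y ↔ PowerSeries.constantCoeff y ^ Q = PowerSeries.constantCoeff y) := by
    intro y hy
    rw [hφ, hηθ, hinj.eq_iff, ← hcc]
    constructor
    · intro h; rw [h]
    · intro h; exact hSSinj _ _ (hSSfr y hy) hy h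
  obtain ⟨b, hb, hb0⟩ := Set.exists_ne_of_one_lt_ncard h2 0
  obtain ⟨v, hv, hvb⟩ := SS_surj hp he hqe (show 1 ≤ t by omega) hw b hb.1
  have hvfix : η (φ (θ v)) = θ v := by
    rw [hfixS v hv, hvb]; exact hb.2
  have hv0 : θ v ≠ 0 := by
    intro h0
    apply hb0
    have : v = 0 := hinj (h0.trans (map_zero θ).symm)
    rw [← hvb, this, map_zero]
  have hnone : ∀ x ∈ SM θ q t w, η (φ x) = x → x ∈ S1 := by
    intro x hx hfx
    by_contra hxS
    have hx1 : x - θ v ∈ SM θ q t w := SM_sub hp hqe θ _ _ hx (SS_hom θ v hv)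
    have hx2 : x - θ v ∉ S1 := by
      rintro ⟨y, hy, hyx⟩
      apply hxS
      refine ⟨y - (0 - v), SM_sub hp hqe _ _ _ hy (SM_sub hp hqe _ _ _ (SM_zero (by omega) _) hv), ?_⟩
      rw [map_sub, map_sub, map_zero, hyx]; ring
    have : 1 < {x | x ∈ X0 ∧ η • φ x = x}.ncard := by
      rw [Set.one_lt_ncard_iff ((hfin.subset Set.sdiff_subset).subset (fun x hx => hx.1))]
      refine ⟨x, x - θ v, ⟨⟨hx, hxS⟩, hfx⟩, ⟨⟨hx1, hx2⟩, ?_⟩, ?_⟩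
      · change η (φ (x - θ v)) = _
        rw [map_sub, map_sub, hfx, hvfix]
      · intro h
        apply hv0
        linear_combination h
    omega
  symm
  choose! lf hlf1 hlf2 using fun y0 (hy0 : ev q w t y0 = 0) => SS_surj hp he hqe (show 1 ≤ t by omega) hw y0 hy0
  refine Set.ncard_congr (fun y hy => θ (lf y)) ?_ ?_ ?_
  · intro y hy
    refine ⟨SS_hom θ _ (hlf1 y hy.1), ?_⟩
    rw [hfixS _ (hlf1 y hy.1), hlf2 y hy.1]; exact hy.2
  · intro x y hx hy h
    rw [← hlf2 x hx.1, ← hlf2 y hy.1, hinj h]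
  · rintro x ⟨hx, hfx⟩
    obtain ⟨y, hy, rfl⟩ := hnone x hx hfx
    have hk := SS_cc (show 1 ≤ t by omega) (show 1 ≤ q by omega) y hy
    refine ⟨PowerSeries.constantCoeff y, ⟨hk, (hfixS y hy).1 hfx⟩, ?_⟩
    change θ (lf _) = _
    rw [hSSinj _ _ (hlf1 _ hk) hy (hlf2 _ hk)]

end Infty
end Chb

namespace Chb
open Polynomial
set_option linter.unusedSectionVars false
set_option linter.style.haveILetI false
set_option linter.unusedVariables false

section Setting
universe uL
variable {𝕜 F : Type*} {L : Type uL} [Field 𝕜] [IsAlgClosed 𝕜] [Field F] [Field L] [Algebra 𝕜[X] F]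
  [IsFractionRing 𝕜[X] F]
  [Algebra F L] [Algebra 𝕜[X] L] [IsScalarTower 𝕜[X] F L]
  [Algebra 𝕜 L] [IsScalarTower 𝕜 𝕜[X] L]
  {p e q d k : ℕ} {u w : ℕ → 𝕜}

lemma inv_inj {E : Type*} [Field E] (ρ : PowerSeries 𝕜 →+* E) (hρ : Function.Injective ρ) :
    Function.Injective (eval₂RingHom (ρ.comp PowerSeries.C) (ρ PowerSeries.X)⁻¹ : 𝕜[X] →+* E) := by
  have hX : ρ PowerSeries.X ≠ 0 := by
    intro h0
    exact PowerSeries.X_ne_zero (hρ (h0.trans (map_zero ρ).symm))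
  rw [injective_iff_map_eq_zero]
  intro f hf
  letI : Invertible ((ρ PowerSeries.X)⁻¹) := invertibleOfNonzero (inv_ne_zero hX)
  have h1 := (eval₂_reverse_eq_zero_iff (ρ.comp PowerSeries.C) (ρ PowerSeries.X)⁻¹ f).2 hf
  rw [invOf_eq_inv, inv_inv, ← hom_eval₂] at h1
  have h2 : f.reverse.eval₂ PowerSeries.C PowerSeries.X = 0 := hρ (h1.trans (map_zero ρ).symm)
  have hco : (eval₂RingHom PowerSeries.C PowerSeries.X : 𝕜[X] →+* PowerSeries 𝕜) = Polynomial.coeToPowerSeries.ringHom := by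
    apply Polynomial.ringHom_ext
    · intro c; simp
    · simp
  replace h2 : (f.reverse : PowerSeries 𝕜) = 0 := (RingHom.congr_fun hco f.reverse).symm.trans h2
  have h3 : f.reverse = 0 := Polynomial.coe_injective 𝕜 (by rw [h2, Polynomial.coe_zero])
  exact reverse_eq_zero.1 h3

lemma exists_inf_aux {E : Type*} [Field E] [Algebra (PowerSeries 𝕜) E] [IsFractionRing (PowerSeries 𝕜) E]
    [hsp : IsSplittingField F L (PF F q d u w)]
    (H : Hyp 𝕜 p e q d u w) (hu1 : ∀ j, j < d → u j = 0) (hkd : k < d) (hw : w 0 ≠ 0) (hwk : w k ≠ 0)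
    (hwj : ∀ j, k < j → w j = 0) {Q a : ℕ} (hQ : Q = p ^ a) (hu : ∀ j, u j ^ Q = u j) (hwQ : ∀ j, w j ^ Q = w j)
    (h2 : 2 ≤ {y : 𝕜 | ev q w d y = 0 ∧ y ^ Q = y}.ncard) :
    ∃ ψ : L →+* L, Semi (𝕜 := 𝕜) Q ψ ∧
      {x | x ∈ V0 L q d u w ∧ ψ x = x}.ncard = {y : 𝕜 | ev q w d y = 0 ∧ y ^ Q = y}.ncard := by
  haveI := H.ch
  haveI : ExpChar 𝕜 p := ExpChar.prime H.hp
  have hq2 := H.q2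
  set ρ := algebraMap (PowerSeries 𝕜) E with hρ
  have hρi : Function.Injective ρ := IsFractionRing.injective (PowerSeries 𝕜) E
  have hX : ρ PowerSeries.X ≠ 0 := by
    intro h0
    exact PowerSeries.X_ne_zero (hρi (h0.trans (map_zero ρ).symm))
  set G : 𝕜[X] →+* E := eval₂RingHom (ρ.comp PowerSeries.C) (ρ PowerSeries.X)⁻¹ with hG
  have hGC : ∀ c, G (C c) = ρ (PowerSeries.C c) := by intro c; simp [hG]
  have hGX : G X = (ρ PowerSeries.X)⁻¹ := by simp [hG]
  obtain ⟨φF, hφF⟩ := frac_hom (F := F) G (inv_inj ρ hρi)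
  let M := SplittingField ((PF F q d u w).map φF)
  haveI : FiniteDimensional E M := IsSplittingField.finiteDimensional M ((PF F q d u w).map φF)
  haveI : Normal E M := Normal.of_isSplittingField ((PF F q d u w).map φF)
  set κ := algebraMap E M with hκ
  obtain ⟨ι, hι⟩ := lift_hom (L := L) (PF F q d u w) (κ.comp φF) (by
    rw [← Polynomial.map_map]; exact SplittingField.splits _)
  have hιG : ∀ g : 𝕜[X], ι (algebraMap 𝕜[X] L g) = κ (G g) := by
    intro g
    rw [IsScalarTower.algebraMap_apply 𝕜[X] F L, hι, RingHom.comp_apply, hφF]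
  have hfrinj : Function.Injective (ρ.comp (PowerSeries.map (iterateFrobenius 𝕜 p a))) :=
    hρi.comp (PowerSeries.map_injective _ (iterateFrobenius 𝕜 p a).injective)
  obtain ⟨φE, hφE⟩ := frac_hom (F := E) _ hfrinj
  have hGfr : φE.comp G = G.comp (fr p a) := by
    apply Polynomial.ringHom_ext
    · intro c
      rw [RingHom.comp_apply, RingHom.comp_apply, fr_C, hGC, hGC, hφE, RingHom.comp_apply, PowerSeries.map_C, iterateFrobenius_def]
    · rw [RingHom.comp_apply, RingHom.comp_apply, fr_X, hGX, map_inv₀, hφE, RingHom.comp_apply, PowerSeries.map_X]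
  have hφFG : φF.comp (algebraMap 𝕜[X] F) = G := RingHom.ext hφF
  obtain ⟨φ, hφ⟩ := ext_endo (L := M) ((PF F q d u w).map φF) φE (by
    have hPG : (PF F q d u w).map φF = (BB q d u w).map G := by rw [PF, map_map, hφFG]
    rw [hPG, map_map, hGfr, ← map_map, BB_map hQ hu hwQ])
  set θ : PowerSeries 𝕜 →+* M := κ.comp ρ with hθ
  have hφθ : ∀ y, φ (θ y) = θ (PowerSeries.map (iterateFrobenius 𝕜 p a) y) := by
    intro y
    rw [hθ, RingHom.comp_apply, hφ, hφE]; rfl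
  have hθX : θ PowerSeries.X ≠ 0 := by
    rw [hθ, RingHom.comp_apply, Ne, map_eq_zero]; exact hX
  have hev : ∀ v : L, ι (ev q w d v) = ∑ j ∈ Finset.range d, θ (PowerSeries.C (w j)) * (ι v) ^ q ^ j := by
    intro v
    rw [ev, map_sum]
    apply Finset.sum_congr rfl
    intro j _
    rw [Algebra.smul_def, map_mul, map_pow, ← algC, hιG, hGC]; rfl
  have hevu : ∀ v : L, ev q u (d+1) v = v ^ q ^ d := by
    intro v
    rw [ev, Finset.sum_range_succ, H.hud, one_smul, Finset.sum_eq_zero, zero_add]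
    intro j hj
    rw [hu1 j (Finset.mem_range.1 hj), zero_smul]
  have hV : ∀ v : L, v ∈ V0 L q d u w ↔ ι v ∈ SM θ q d w := by
    intro v
    simp only [V0, SM, Set.mem_ofPred_eq]
    rw [← hev, hevu, ← ι.injective.eq_iff, map_mul, hιG, hGX, map_inv₀, map_pow]
    change _ = (θ PowerSeries.X)⁻¹ * _ ↔ _
    rw [eq_inv_mul_iff_mul_eq₀ hθX, eq_comm]
  have hVs : ∀ x ∈ SM θ q d w, ∃ v ∈ V0 L q d u w, ι v = x := by
    intro x hx
    have : ∃ v, ι v = x := by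
      by_cases hx0 : x = 0
      · exact ⟨0, by rw [map_zero, hx0]⟩
      letI : Algebra 𝕜 M := (θ.comp PowerSeries.C).toAlgebra
      have h1 := eval_BB (q := q) (d := d) (u := u) (w := w) (κ.comp G) (fun c => by
        rw [RingHom.comp_apply, hGC]; rfl) (by omega) x
      have h3 : ev q u (d+1) x = x ^ q ^ d := by
        rw [ev, Finset.sum_range_succ, H.hud, one_smul, Finset.sum_eq_zero, zero_add]
        intro j hj
        rw [hu1 j (Finset.mem_range.1 hj), zero_smul]
      have h4 : ev q w d x = θ PowerSeries.X * x ^ q ^ d := by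
        rw [← show _ = _ from hx, ev]
        apply Finset.sum_congr rfl
        intro j _
        rw [Algebra.smul_def]; rfl
      have h5 : (κ.comp G) X = (θ PowerSeries.X)⁻¹ := by
        rw [RingHom.comp_apply, hGX, map_inv₀]; rfl
      rw [h3, h4, h5, inv_mul_cancel_left₀ hθX, sub_self] at h1
      have h6 := (mul_eq_zero.1 h1).resolve_left hx0
      have h7 : (BB q d u w).map (κ.comp G) = ((PF F q d u w).map (algebraMap F L)).map ι := by
        change _ = (((BB q d u w).map (algebraMap 𝕜[X] F)).map (algebraMap F L)).map ι
        rw [map_map, map_map]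
        congr 1
        refine RingHom.ext fun g => ?_
        rw [RingHom.comp_apply, RingHom.comp_apply, RingHom.comp_apply, hι, RingHom.comp_apply, hφF]
      rw [h7] at h6
      obtain ⟨v, hv⟩ := hsp.splits'.mem_range_of_isRoot (i := ι) (((PF_monic H).map _).ne_zero) h6
      exact ⟨v, hv⟩
    obtain ⟨v, rfl⟩ := this
    exact ⟨v, (hV v).2 hx, rfl⟩
  have hfin : (SM θ q d w).Finite := by
    refine ((V0_fin F (L := L) H).image ι).subset ?_
    intro x hx
    obtain ⟨v, h1, h2⟩ := hVs x hx
    exact ⟨v, h1, h2⟩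
  obtain ⟨η, hη⟩ := inf_local (E := E) (M := M) H.hp H.he H.hq hkd hq2 hw hwk hwj hQ hwQ θ rfl φ hφθ hfin h2
  obtain ⟨ψ0, hψ0⟩ := exists_semi F (L := L) (q := q) (d := d) hQ hu hwQ
  obtain ⟨σ, hσ⟩ := gal_diff (PF F q d u w) (ι.comp ψ0) (((η : M →+* M).comp φ).comp ι) (by
    apply RingHom.congr_fun (f := ((ι.comp ψ0).comp (algebraMap F L))) (g := (((η : M →+* M).comp φ).comp ι).comp (algebraMap F L))
    apply frac_ext (𝕜 := 𝕜)
    intro g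
    simp only [RingHom.comp_apply]
    rw [← IsScalarTower.algebraMap_apply 𝕜[X] F L, hψ0.apply hQ, hιG, hιG, hφ, ← RingHom.comp_apply φE G, hGfr, RingHom.comp_apply]
    exact (η.commutes _).symm)
  refine ⟨ψ0.comp (σ : L →+* L), hψ0.comp σ, ?_⟩
  rw [← hη]
  have hσ' : ∀ x, ι (ψ0 (σ x)) = η (φ (ι x)) := fun x => (hσ x).symm
  refine Set.ncard_congr (fun x _ => ι x) ?_ ?_ ?_
  · rintro x ⟨h1, h3⟩
    refine ⟨(hV x).1 h1, ?_⟩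
    rw [← hσ']; exact congrArg ι h3
  · intro x y _ _ h; exact ι.injective h
  · rintro x ⟨h1, h3⟩
    obtain ⟨v, hv, rfl⟩ := hVs x h1
    refine ⟨v, ⟨hv, ?_⟩, rfl⟩
    apply ι.injective
    rw [← hσ'] at h3
    exact h3

lemma exists_inf [hsp : IsSplittingField F L (PF F q d u w)]
    (H : Hyp 𝕜 p e q d u w) (hu1 : ∀ j, j < d → u j = 0) (hkd : k < d) (hw : w 0 ≠ 0) (hwk : w k ≠ 0)
    (hwj : ∀ j, k < j → w j = 0) {Q a : ℕ} (hQ : Q = p ^ a) (hu : ∀ j, u j ^ Q = u j) (hwQ : ∀ j, w j ^ Q = w j)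
    (h2 : 2 ≤ {y : 𝕜 | ev q w d y = 0 ∧ y ^ Q = y}.ncard) :
    ∃ ψ : L →+* L, Semi (𝕜 := 𝕜) Q ψ ∧
      {x | x ∈ V0 L q d u w ∧ ψ x = x}.ncard = {y : 𝕜 | ev q w d y = 0 ∧ y ^ Q = y}.ncard :=
  exists_inf_aux (F := F) (E := EE 𝕜) H hu1 hkd hw hwk hwj hQ hu hwQ h2

end Setting
end Chb

namespace Chb
set_option linter.unusedSectionVars false
set_option linter.style.haveILetI false
set_option linter.unusedVariables false

lemma num1 (l R S h T c' cc g : ℕ) (hl : 1 ≤ l) (hS : S = l * R) (hh : 1 ≤ h) (hc : 2 * c' = cc * (l - 1))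
    (hST : h * T + l ≤ S)
    (hbig : (h * T + l) * (h * T + l + h * c' + g) + l * (h * T + 1) < S * (1 + g)) :
    ∃ A B : ℕ, h * (A + T) < S ∧
      ∑ i ∈ Finset.range l, (h * (R * (A + T + i * cc) + (B + T)) + 1) < ((A + 1) * h) * ((B + 1) * h) ∧
      h * (B + T) + 1 ≤ S + 2 * h * T + l + h * c' + g := by
  have hTq : T ≤ (S - 1) / h := by
    rw [Nat.le_div_iff_mul_le (by omega), mul_comm]; omega
  obtain ⟨A, hA⟩ : ∃ A, (S - 1) / h = A + T := ⟨(S-1)/h - T, by omega⟩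
  have hA1 : h * (A + T) ≤ S - 1 := by rw [← hA]; exact Nat.mul_div_le _ _
  have hA2 : S - 1 < h * (A + T) + h := by
    rw [← hA]; have := Nat.lt_mul_div_succ (S-1) (show 0 < h by omega); rw [mul_add] at this; omega
  set U := S + (h * T + l + h * c') + g with hU
  have hB1 : h * ((U - 1) / h) ≤ U - 1 := Nat.mul_div_le _ _
  have hB2 : U - 1 < h * ((U - 1) / h) + h := by
    have := Nat.lt_mul_div_succ (U-1) (show 0 < h by omega); rw [mul_add] at this; omega
  set B := (U - 1) / h with hB
  have hU1 : 1 ≤ U := by omega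
  refine ⟨A, B, by omega, ?_, ?_⟩
  · have hsum : ∑ i ∈ Finset.range l, (h * (R * (A + T + i * cc) + (B + T)) + 1) = S * (h * (A + T)) + l * (h * B + h * T + 1) + S * (h * c') := by
      have h1 : ∀ i ∈ Finset.range l, (h * (R * (A + T + i * cc) + (B + T)) + 1) = (R * (h * (A + T)) + (h * B + h * T + 1)) + i * (h * R * cc) := by
        intro i _; ring
      rw [Finset.sum_congr rfl h1, Finset.sum_add_distrib, Finset.sum_const, Finset.card_range, ← Finset.sum_mul, smul_eq_mul]
      have h2 := Finset.sum_range_id_mul_two l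
      have h3 : 2 * ((∑ i ∈ Finset.range l, i) * (h * R * cc)) = 2 * (S * (h * c')) := by
        calc _ = ((∑ i ∈ Finset.range l, i) * 2) * (h * R * cc) := by ring
          _ = (l * R) * h * (cc * (l - 1)) := by rw [h2]; ring
          _ = _ := by rw [← hc, hS]; ring
      have h4 : (∑ i ∈ Finset.range l, i) * (h * R * cc) = S * (h * c') := by omega
      rw [h4, hS]; ring
    rw [hsum]
    have hA3 : S ≤ (A + 1) * h + h * T := by
      have : (A + 1) * h + h * T = h * (A + T) + h := by ring
      omega
    have hB3 : U ≤ (B + 1) * h := by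
      have : (B + 1) * h = h * B + h := by ring
      omega
    have hA4 : h * (A + T) + 1 ≤ S := by omega
    have hB4 : h * B ≤ (B + 1) * h := by nlinarith
    generalize (A + 1) * h = a at *
    generalize (B + 1) * h = b at *
    generalize h * (A + T) = a' at *
    generalize h * B = b' at *
    zify at *
    generalize (h : ℤ) * T = t at *
    generalize (h : ℤ) * c' = c at *
    have e1 : (S : ℤ) * a' ≤ S * (S - 1) := by
      apply mul_le_mul_of_nonneg_left <;> linarith
    have e2 : (l : ℤ) * b' ≤ l * b := mul_le_mul_of_nonneg_left hB4 (by linarith)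
    have e3 : ((S : ℤ) - t) * b ≤ a * b := by
      apply mul_le_mul_of_nonneg_right <;> linarith
    have e4 : ((S : ℤ) - t - l) * U ≤ (S - t - l) * b := by
      apply mul_le_mul_of_nonneg_left <;> linarith
    have e5 : ((S : ℤ) - t - l) * U = (S - t - l) * (S + (t + l + c) + g) := by rw [hU]
    nlinarith
  · have : h * (B + T) = h * B + h * T := by ring
    have h2 : 2 * h * T = h * T + h * T := by ring
    omega

lemma num2a (y P D h l E : ℝ) (hy : 4 ≤ y) (hl1 : 1 ≤ l) (hlP : 8 * l ≤ P) (hyP : y * y ≤ P) (hly : l * l ≤ y)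
    (hhP : h * y ≤ P) (hh : 1 ≤ h) (hD : 1 ≤ D) (hE : E = D * h) (hP0 : 16 ≤ P) (hE1 : 1 ≤ E) :
    y * ((E * (y - 2) + l) * (2 * (E * y) + l) + l * (E * y)) < 2 * D * (P * P) * (1 + 2 * E) := by
  have hE0 : 0 ≤ E := by linarith
  have b1 : y * (E * (y - 2) * (2 * (E * y))) ≤ 2 * (D * E) * (P * P) := by
    have e1 : y * (y - 2) ≤ P := by linarith [mul_sub y y 2]
    have e2 : (h * y) * (y * (y - 2)) ≤ P * P :=
      mul_le_mul hhP e1 (mul_nonneg (by linarith) (by linarith)) (by linarith)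
    have e3 : 0 ≤ 2 * (D * E) := by positivity
    have e4 := mul_le_mul_of_nonneg_left e2 e3
    have e5 : y * (E * (y - 2) * (2 * (E * y))) = 2 * (D * E) * ((h * y) * (y * (y - 2))) := by
      nth_rewrite 2 [hE]; ring
    linarith
  have b2 : y * (l * (2 * (E * y)) + E * (y - 2) * l + l * (E * y)) ≤ E * (P * P) / 2 := by
    have e1 : l * (y * y) ≤ (P / 8) * P :=
      mul_le_mul (by linarith) hyP (by positivity) (by linarith)
    have e2 := mul_le_mul_of_nonneg_left e1 hE0
    have e3 : 0 ≤ y * (E * l) := by positivity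
    have e4 : y * (l * (2 * (E * y)) + E * (y - 2) * l + l * (E * y)) = 4 * (E * (l * (y * y))) - 2 * (y * (E * l)) := by ring
    linarith
  have b3 : y * (l * l) ≤ P := le_trans (mul_le_mul_of_nonneg_left hly (by linarith)) hyP
  have hPP : 0 < P * P := by positivity
  have b4 : E * (P * P) ≤ D * E * (P * P) := by
    have := mul_le_mul_of_nonneg_right hD (mul_nonneg hE0 hPP.le)
    linarith
  have b5 : P ≤ D * (P * P) := by
    have e1 : P * 1 ≤ P * P := mul_le_mul_of_nonneg_left (by linarith) (by linarith)
    have e2 := mul_le_mul_of_nonneg_right hD hPP.le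
    linarith
  have b6 : 0 < D * E * (P * P) := by positivity
  have c1 : y * ((E * (y - 2) + l) * (2 * (E * y) + l) + l * (E * y)) =
     y * (E * (y - 2) * (2 * (E * y))) + y * (l * (2 * (E * y)) + E * (y - 2) * l + l * (E * y)) + y * (l * l) := by ring
  have c2 : 2 * D * (P * P) * (1 + 2 * E) = 2 * (D * (P * P)) + 4 * (D * E * (P * P)) := by ring
  linarith

lemma num2 (q y P D h l T c' S : ℝ) (hy : 4 ≤ y) (hl1 : 1 ≤ l) (hl : l ≤ q) (hP : 8 * q ≤ P) (hyP : y * y ≤ P) (hqy : q * q ≤ y)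
    (hhP : h * y ≤ P) (hh : 1 ≤ h) (hD : 1 ≤ D) (hT0 : 0 ≤ T) (hT : T ≤ D * (y - 2)) (hc0 : 0 ≤ c') (hc : c' ≤ D * y) (hS : 2 * D * (P * P) ≤ S * y) :
    (h * T + l) * (h * T + l + h * c' + 2 * D * h) + l * (h * T + 1) < S * (1 + 2 * D * h) := by
  have hh0 : 0 ≤ h := by linarith
  have hE1 : 1 ≤ D * h := one_le_mul_of_one_le_of_one_le hD hh
  have h1 : h * T ≤ D * h * (y - 2) := by
    have := mul_le_mul_of_nonneg_left hT hh0
    linarith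
  have h2 : h * c' ≤ D * h * y := by
    have := mul_le_mul_of_nonneg_left hc hh0
    linarith
  have hP0 : 16 ≤ P := by
    have := mul_le_mul hy hy (by norm_num) (by linarith)
    linarith
  have hT1 : 0 ≤ h * T := by positivity
  have hc1 : 0 ≤ h * c' := by positivity
  have hly : l * l ≤ y := le_trans (mul_le_mul hl hl (by linarith) (by linarith)) hqy
  have key := num2a y P D h l (D * h) hy hl1 (by linarith) hyP hly hhP hh hD rfl hP0 hE1
  have h3 : 2 * D * h = 2 * (D * h) := by ring
  rw [h3]
  generalize D * h = E at *
  have a1 : (h * T + l) * (h * T + l + h * c' + 2 * E) ≤ (E * (y - 2) + l) * (2 * (E * y) + l) := by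
    apply mul_le_mul
    · linarith
    · linarith
    · linarith
    · have : 0 ≤ E * (y - 2) := mul_nonneg (by linarith) (by linarith)
      linarith
  have a2 : l * (h * T + 1) ≤ l * (E * y) := by
    apply mul_le_mul_of_nonneg_left _ (by linarith); linarith
  have hy0 : 0 < y := by linarith
  have b0 : 2 * D * (P * P) * (1 + 2 * E) ≤ y * (S * (1 + 2 * E)) := by
    have e : 0 ≤ 1 + 2 * E := by linarith
    have := mul_le_mul_of_nonneg_right hS e
    linarith
  have := lt_of_mul_lt_mul_left (key.trans_le b0) hy0.le
  linarith

lemma num3 (p : ℕ) (hp : 2 ≤ p) : (3 : ℝ) - 1 / p + 3 / 10 ≤ 2 * Real.sqrt p := by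
  have hpp : (0 : ℝ) < p := by positivity
  rcases Nat.lt_or_ge p 3 with h | h
  · have : p = 2 := by omega
    subst this
    have : (1.4 : ℝ) ≤ Real.sqrt (2 : ℕ) := Real.le_sqrt_of_sq_le (by norm_num)
    norm_num at this ⊢
    linarith
  · have h1 : (3 : ℝ) ≤ p := by exact_mod_cast h
    have : (1.7 : ℝ) ≤ Real.sqrt p := Real.le_sqrt_of_sq_le (by norm_num; linarith)
    have h2 : (0 : ℝ) ≤ 1 / p := by positivity
    have h3 : (2 : ℝ) * 1.7 = 3.4 := by norm_num
    have h4 : (3 : ℝ) + 3 / 10 ≤ 3.4 := by norm_num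
    linarith

end Chb

namespace Chb
set_option linter.unusedSectionVars false
set_option linter.style.haveILetI false
set_option linter.unusedVariables false

lemma stepan_core (p q y P D h z l R S cc c' : ℕ) (hp : 2 ≤ p) (hpq : p ≤ q) (hl : l = 1 ∨ l = p) (hS : S = l * R)
    (hP : 8 * q ≤ P) (hyP : y * y ≤ P) (hqy : q * q ≤ y) (hhP : h * y ≤ P) (hh : 1 ≤ h) (hD : 1 ≤ D) (hz : z ≤ D)
    (hc : 2 * c' = cc * (l - 1)) (hc2 : c' * l ≤ D * y * (l - 1)) (hSb : 2 * D * (P * P) ≤ S * y) :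
    ∃ A B : ℕ, h * (A + (y - 2) * z) < S ∧
      ∑ i ∈ Finset.range l, (h * (R * (A + (y - 2) * z + i * cc) + (B + (y - 2) * z)) + 1) < ((A + 1) * h) * ((B + 1) * h) ∧
      ∀ c : ℕ, l * c ≤ h * (A + (y - 2) * z) + S * (h * (B + (y - 2) * z)) →
        (c : ℝ) ≤ l * R ^ 2 + 2 * D * P * (R * Real.sqrt l) := by
  have hl1 : 1 ≤ l := by omega
  have hlq : l ≤ q := by omega
  have hy : 4 ≤ y := le_trans (by nlinarith) hqy
  have hT : (y - 2) * z ≤ D * (y - 2) := by rw [mul_comm]; exact Nat.mul_le_mul_right _ hz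
  have hcD : c' ≤ D * y := by
    have : c' * l ≤ D * y * l := hc2.trans (Nat.mul_le_mul_left _ (by omega))
    exact Nat.le_of_mul_le_mul_right this (by omega)
  set T := (y - 2) * z with hTd
  have hTr : (T : ℝ) ≤ D * (y - 2) := by
    have : ((y - 2 : ℕ) : ℝ) = y - 2 := by push_cast [show 2 ≤ y by omega]; ring
    rw [← this]; exact_mod_cast hT
  have hbig := num2 q y P D h l T c' S (by exact_mod_cast hy) (by exact_mod_cast hl1) (by exact_mod_cast hlq)
    (by exact_mod_cast hP) (by exact_mod_cast hyP) (by exact_mod_cast hqy) (by exact_mod_cast hhP)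
    (by exact_mod_cast hh) (by exact_mod_cast hD) (by positivity) hTr (by positivity) (by exact_mod_cast hcD)
    (by exact_mod_cast hSb)
  have hbig' : (h * T + l) * (h * T + l + h * c' + 2 * D * h) + l * (h * T + 1) < S * (1 + 2 * D * h) := by exact_mod_cast hbig
  have hST : h * T + l ≤ S := by
    by_contra hcon
    push Not at hcon
    have h1 : S * (1 + 2 * D * h) ≤ (h * T + l) * (1 + 2 * D * h) := Nat.mul_le_mul_right _ hcon.le
    have h2 : (h * T + l) * (1 + 2 * D * h) ≤ (h * T + l) * (h * T + l + h * c' + 2 * D * h) := Nat.mul_le_mul_left _ (by nlinarith [Nat.zero_le (h*T), Nat.zero_le (h*c')])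
    have := Nat.zero_le (l * (h * T + 1))
    omega
  obtain ⟨A, B, h1, h2, h3⟩ := num1 l R S h T c' cc (2 * D * h) hl1 hS hh hc hST hbig'
  refine ⟨A, B, h1, h2, fun c hcc => ?_⟩
  have h4 : l * c ≤ l * (R * (S + 2 * h * T + l + h * c' + 2 * D * h)) := by
    calc l * c ≤ S + S * (h * (B + T)) := by omega
      _ = l * (R * (h * (B + T) + 1)) := by rw [hS]; ring
      _ ≤ _ := by gcongr
  have h5 : c ≤ R * (S + 2 * h * T + l + h * c' + 2 * D * h) := Nat.le_of_mul_le_mul_left h4 (by omega)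
  have h6 : (c : ℝ) ≤ R * (S + 2 * h * T + l + h * c' + 2 * D * h) := by exact_mod_cast h5
  have hsq : (2 * (h * T) + l + h * c' + 2 * D * h : ℝ) ≤ 2 * D * P * Real.sqrt l := by
    have hh' : (1 : ℝ) ≤ h := by exact_mod_cast hh
    have hD' : (1 : ℝ) ≤ D := by exact_mod_cast hD
    have hP' : (8 * q : ℝ) ≤ P := by exact_mod_cast hP
    have hlq' : (l : ℝ) ≤ q := by exact_mod_cast hlq
    have hl' : (1 : ℝ) ≤ l := by exact_mod_cast hl1
    have hhP' : (h * y : ℝ) ≤ P := by exact_mod_cast hhP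
    have e1 : (h * T : ℝ) ≤ h * (D * (y - 2)) := mul_le_mul_of_nonneg_left hTr (by linarith)
    have e2 : (h * y * D : ℝ) ≤ P * D := mul_le_mul_of_nonneg_right hhP' (by linarith)
    have e3 : (1 : ℝ) ≤ D * h := one_le_mul_of_one_le_of_one_le hD' hh'
    have e4 : (P : ℝ) ≤ D * P := le_mul_of_one_le_left (by positivity) hD'
    have hc2' : (c' * l : ℝ) ≤ D * y * (l - 1) := by
      have : ((l - 1 : ℕ) : ℝ) = l - 1 := by push_cast [hl1]; ring
      rw [← this]; exact_mod_cast hc2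
    rcases hl with hl | hl
    · rw [hl] at hc2' ⊢
      have : (c' : ℝ) ≤ 0 := by simpa using hc2'
      have hc0 : (c' : ℝ) = 0 := le_antisymm this (by positivity)
      rw [hc0]; simp only [Nat.cast_one, Real.sqrt_one, mul_one, mul_zero, add_zero]
      linarith
    · have h7 := num3 l (by omega)
      have e5 : (h * c' * l : ℝ) ≤ D * P * (l - 1) := by
        calc (h * c' * l : ℝ) = h * (c' * l) := by ring
          _ ≤ h * (D * y * (l - 1)) := mul_le_mul_of_nonneg_left hc2' (by linarith)
          _ = (h * y * D) * (l - 1) := by ring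
          _ ≤ (P * D) * (l - 1) := mul_le_mul_of_nonneg_right e2 (by linarith)
          _ = _ := by ring
      have e6 : (h * c' : ℝ) ≤ D * P * (1 - 1 / l) := by
        have : (D * P * (1 - 1 / l) : ℝ) = D * P * (l - 1) / l := by field_simp
        rw [this, le_div_iff₀ (by linarith)]; exact e5
      have e7 : (0 : ℝ) ≤ D * P := by positivity
      have e8 := mul_le_mul_of_nonneg_left h7 e7
      linarith
  have h7 : (c : ℝ) ≤ R * (S + 2 * D * P * Real.sqrt l) := by
    refine h6.trans (mul_le_mul_of_nonneg_left ?_ (by positivity))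
    linarith
  have h8 : (S : ℝ) = l * R := by exact_mod_cast hS
  rw [h8] at h7
  linarith [h7, show (R * (l * R + 2 * D * P * Real.sqrt l) : ℝ) = l * R ^ 2 + 2 * D * P * (R * Real.sqrt l) by ring]

lemma stepan_num (p e q d h z N : ℕ) (hp : p.Prime) (he : 1 ≤ e) (hq : q = p ^ e) (hd : 2 ≤ d) (hh : 1 ≤ h) (hz : z ≤ d - 1)
    (hhz : h ≤ (q ^ d - 1) ^ z)
    (hbig : 2 * ((d : ℝ) - 1) * ((q : ℝ) ^ d ^ 2) ^ 2 ≤ Real.sqrt ((p : ℝ) ^ N) * (q : ℝ) ^ d) :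
    ∃ l ra sb A B : ℕ, ra + sb = N ∧ (l = 1 ∨ (l ≤ p ∧ 1 ≤ sb)) ∧ 1 ≤ l ∧
      h * (A + (q ^ d - 2) * z) < p ^ sb ∧
      ∑ i ∈ Finset.range l, (h * (p ^ ra * (A + (q ^ d - 2) * z + i * (q ^ (d - 1) * (z + 1))) + (B + (q ^ d - 2) * z)) + 1) <
        ((A + 1) * h) * ((B + 1) * h) ∧
      ∀ c : ℕ, l * c ≤ h * (A + (q ^ d - 2) * z) + p ^ sb * (h * (B + (q ^ d - 2) * z)) →
        (c : ℝ) ≤ (p : ℝ) ^ N + 2 * ((d : ℝ) - 1) * (q : ℝ) ^ d ^ 2 * Real.sqrt ((p : ℝ) ^ N) := by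
  have hp2 := hp.two_le
  have hpq : p ≤ q := by rw [hq]; exact Nat.le_self_pow (by omega) p
  have hq2 : 2 ≤ q := by omega
  have hP : 8 * q ≤ q ^ d ^ 2 := by
    calc 8 * q ≤ q ^ 3 * q := Nat.mul_le_mul_right _ (by calc 8 = 2 ^ 3 := by norm_num
                                                         _ ≤ q ^ 3 := Nat.pow_le_pow_left hq2 3)
      _ = q ^ 4 := by ring
      _ ≤ _ := Nat.pow_le_pow_right (by omega) (by nlinarith)
  have hyP : q ^ d * q ^ d ≤ q ^ d ^ 2 := by
    rw [← pow_add]; exact Nat.pow_le_pow_right (by omega) (by nlinarith)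
  have hqy : q * q ≤ q ^ d := by rw [← sq]; exact Nat.pow_le_pow_right (by omega) hd
  have hhP : h * q ^ d ≤ q ^ d ^ 2 := by
    have h1 : h ≤ (q ^ d) ^ (d - 1) := hhz.trans ((Nat.pow_le_pow_left (Nat.sub_le _ _) z).trans
      (Nat.pow_le_pow_right (by positivity) hz))
    calc h * q ^ d ≤ (q ^ d) ^ (d - 1) * q ^ d := Nat.mul_le_mul_right _ h1
      _ = (q ^ d) ^ (d - 1 + 1) := (pow_succ _ _).symm
      _ = q ^ d ^ 2 := by rw [Nat.sub_add_cancel (by omega), ← pow_mul, sq]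
  have hdr : ((d - 1 : ℕ) : ℝ) = d - 1 := by push_cast [show 1 ≤ d by omega]; ring
  have hp0 : (0 : ℝ) ≤ p := by positivity
  rcases Nat.even_or_odd' N with ⟨r, rfl | rfl⟩
  · have hs : Real.sqrt ((p : ℝ) ^ (2 * r)) = p ^ r := by
      rw [mul_comm, pow_mul]; exact Real.sqrt_sq (by positivity)
    rw [hs] at hbig ⊢
    obtain ⟨A, B, h1, h2, h3⟩ := stepan_core p q (q ^ d) (q ^ d ^ 2) (d - 1) h z 1 (p ^ r) (p ^ r) (q ^ (d - 1) * (z + 1)) 0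
      hp2 hpq (Or.inl rfl) (one_mul _).symm hP hyP hqy hhP hh (by omega) hz (by simp) (by simp) (by
        have : (2 * ((d - 1 : ℕ) : ℝ) * ((q : ℝ) ^ d ^ 2 * q ^ d ^ 2)) ≤ p ^ r * q ^ d := by rw [hdr, ← sq]; exact hbig
        exact_mod_cast this)
    refine ⟨1, r, r, A, B, by ring, Or.inl rfl, le_rfl, h1, h2, fun c hc => ?_⟩
    have := h3 c hc
    rw [hdr] at this
    push_cast at this
    simp only [one_mul, Real.sqrt_one, mul_one, ← pow_mul] at this
    rw [mul_comm 2 r]; exact this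
  · have hs : Real.sqrt ((p : ℝ) ^ (2 * r + 1)) = p ^ r * Real.sqrt p := by
      rw [pow_succ, mul_comm 2 r, pow_mul, Real.sqrt_mul (by positivity), Real.sqrt_sq (by positivity)]
    rw [hs] at hbig ⊢
    have hcc : ∃ c', 2 * c' = q ^ (d - 1) * (z + 1) * (p - 1) := by
      rcases hp.eq_two_or_odd' with h2 | h2
      · obtain ⟨m, hm⟩ : 2 ∣ q ^ (d - 1) := by
          rw [hq, h2]; exact dvd_pow (dvd_pow_self 2 (by omega)) (by omega)
        exact ⟨m * (z + 1) * (p - 1), by rw [hm]; ring⟩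
      · obtain ⟨m, hm⟩ := h2
        exact ⟨q ^ (d - 1) * (z + 1) * m, by rw [hm, Nat.add_sub_cancel]; ring⟩
    obtain ⟨c', hc'⟩ := hcc
    have hc2 : c' * p ≤ (d - 1) * q ^ d * (p - 1) := by
      have e1 : q ^ d = q ^ (d - 1) * q := by rw [← pow_succ, Nat.sub_add_cancel (by omega)]
      have e2 : 2 * (c' * p) ≤ 2 * ((d - 1) * q ^ d * (p - 1)) := by
        calc 2 * (c' * p) = (2 * c') * p := by ring
          _ = (q ^ (d - 1) * p) * (z + 1) * (p - 1) := by rw [hc']; ring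
          _ ≤ (q ^ (d - 1) * q) * (2 * (d - 1)) * (p - 1) := by
            gcongr; omega
          _ = _ := by rw [e1]; ring
      omega
    obtain ⟨A, B, h1, h2, h3⟩ := stepan_core p q (q ^ d) (q ^ d ^ 2) (d - 1) h z p (p ^ r) (p ^ (r + 1)) (q ^ (d - 1) * (z + 1)) c'
      hp2 hpq (Or.inr rfl) (by ring) hP hyP hqy hhP hh (by omega) hz hc' hc2 (by
        have h0 : (2 * ((d - 1 : ℕ) : ℝ) * ((q : ℝ) ^ d ^ 2 * q ^ d ^ 2)) ≤ p ^ (r + 1) * q ^ d := by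
          rw [hdr, ← sq]; refine hbig.trans ?_
          have : Real.sqrt p ≤ p := by
            rw [Real.sqrt_le_left hp0]
            have : (1 : ℝ) ≤ p := by exact_mod_cast hp.one_le
            nlinarith
          rw [pow_succ]; gcongr
        exact_mod_cast h0)
    refine ⟨p, r, r + 1, A, B, by ring, Or.inr ⟨le_rfl, by omega⟩, hp.one_le, h1, h2, fun c hc => ?_⟩
    have := h3 c hc
    rw [hdr] at this
    push_cast at this
    rw [← pow_mul, ← pow_succ', mul_comm r 2] at this
    exact this

end Chb

namespace Chb
open Polynomial
set_option linter.unusedSectionVars false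
set_option linter.style.haveILetI false
set_option linter.unusedVariables false

lemma fin_num (q n d h N' : ℕ) (hq : 2 ≤ q) (hd : 1 ≤ d) (hn : 2 ≤ n) (hh : 1 ≤ h) (hG : h * (q ^ d - 1) ≤ q ^ d ^ 2) (h1 : d = 1 → h = 1)
    (W : ℕ) (hW : q ^ n ≤ W + q ^ (d - 1))
    (hm : (h * W : ℝ) ≤ N' * (h * (q ^ d - 1)) + (h - 1) * ((q : ℝ) ^ n + 2 * ((d : ℝ) - 1) * (q : ℝ) ^ d ^ 2 * Real.sqrt ((q : ℝ) ^ n))) :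
    (N' : ℝ) > ((q : ℝ) ^ n + 1) / (q : ℝ) ^ (d ^ 2)
        - (2 * ((d : ℝ) - 1) * (q : ℝ) ^ (d ^ 2) / ((q : ℝ) ^ d - 1)) *
            Real.sqrt ((q : ℝ) ^ n)
        - 1 := by
  have hq' : (2 : ℝ) ≤ q := by exact_mod_cast hq
  have hW' : (q : ℝ) ^ n ≤ W + q ^ (d - 1) := by exact_mod_cast hW
  have hh' : (1 : ℝ) ≤ h := by exact_mod_cast hh
  rcases Nat.lt_or_ge d 2 with hd2 | hd2
  · obtain rfl : d = 1 := by omega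
    have := h1 rfl
    subst this
    simp at hm hW' ⊢
    have hQ : (q : ℝ) ^ 2 ≤ q ^ n := pow_le_pow_right₀ (by linarith) hn
    generalize (q : ℝ) ^ n = Q at *
    rw [sub_lt_iff_lt_add, div_lt_iff₀ (by linarith)]
    have e1 : Q ≤ 1 + N' * (q - 1) := by linarith
    have e2 : Q * q ≤ (1 + N' * (q - 1)) * q := mul_le_mul_of_nonneg_right e1 (by linarith)
    have e3 : Q + 1 < (N' + 1) * q ↔ (Q + 1) * (q - 1) < (N' + 1) * q * (q - 1) := by
      rw [mul_lt_mul_iff_of_pos_right (by linarith)]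
    have e4 : (N' + 1 : ℝ) * q > Q + 1 := by
      rw [gt_iff_lt, e3]
      nlinarith
    linarith
  · have hG' : (h * ((q : ℝ) ^ d - 1)) ≤ q ^ d ^ 2 := by
      have : ((q ^ d - 1 : ℕ) : ℝ) = q ^ d - 1 := by push_cast [show 1 ≤ q ^ d from Nat.one_le_pow _ _ (by omega)]; ring
      rw [← this]; exact_mod_cast hG
    have hy1 : (q : ℝ) ^ 2 ≤ q ^ d := pow_le_pow_right₀ (by linarith) hd2
    have hy : (4 : ℝ) ≤ q ^ d := by nlinarith
    have hP1 : (q : ℝ) ^ 4 ≤ q ^ d ^ 2 := pow_le_pow_right₀ (by linarith) (by nlinarith)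
    have hP : (16 : ℝ) ≤ q ^ d ^ 2 := by
      have : (2 : ℝ) ^ 4 ≤ q ^ 4 := by gcongr
      linarith
    have hx : (q : ℝ) ^ (d - 1) * 2 ≤ q ^ d := by
      have : (q : ℝ) ^ d = q ^ (d - 1) * q := by rw [← pow_succ, Nat.sub_add_cancel hd]
      rw [this]; gcongr
    set E := 2 * ((d : ℝ) - 1) * (q : ℝ) ^ d ^ 2 * Real.sqrt ((q : ℝ) ^ n) with hE
    have hE0 : 0 ≤ E := by
      have : (1 : ℝ) ≤ d := by exact_mod_cast hd
      have : 0 ≤ (d : ℝ) - 1 := by linarith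
      positivity
    have hQ0 : (0 : ℝ) < q ^ n := by positivity
    have hEE : (2 * ((d : ℝ) - 1) * (q : ℝ) ^ (d ^ 2) / ((q : ℝ) ^ d - 1)) * Real.sqrt ((q : ℝ) ^ n) = E / ((q : ℝ) ^ d - 1) := by
      rw [hE]; ring
    rw [hEE]
    generalize (q : ℝ) ^ n = Q at *
    generalize (q : ℝ) ^ d ^ 2 = P at *
    generalize (q : ℝ) ^ d = y at *
    generalize (q : ℝ) ^ (d - 1) = x at *
    have hy0 : 0 < y - 1 := by linarith
    have hhy : 0 < h * (y - 1) := by positivity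
    have a1 : (Q - h * x - h * E) ≤ N' * (h * (y - 1)) := by
      have : (h : ℝ) * Q ≤ h * (W + x) := mul_le_mul_of_nonneg_left hW' (by linarith)
      linarith
    have a2 : Q / (h * (y - 1)) - x / (y - 1) - E / (y - 1) ≤ N' := by
      have : Q / (h * (y - 1)) - x / (y - 1) - E / (y - 1) = (Q - h * x - h * E) / (h * (y - 1)) := by
        field_simp
      rw [this, div_le_iff₀ hhy]; exact a1
    have a3 : Q / P ≤ Q / (h * (y - 1)) := by gcongr
    have a4 : x / (y - 1) ≤ 2 / 3 := by rw [div_le_iff₀ hy0]; linarith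
    have a5 : 1 / P ≤ 1 / 16 := by gcongr
    rw [add_div]
    linarith

lemma big_num (q n d : ℕ) (hq : 2 ≤ q) (hd : 2 ≤ d) (hbig : ¬ ((1 : ℝ) > ((q : ℝ) ^ n + 1) / (q : ℝ) ^ (d ^ 2)
        - (2 * ((d : ℝ) - 1) * (q : ℝ) ^ (d ^ 2) / ((q : ℝ) ^ d - 1)) *
            Real.sqrt ((q : ℝ) ^ n)
        - 1)) : 2 * ((d : ℝ) - 1) * ((q : ℝ) ^ d ^ 2) ^ 2 ≤ Real.sqrt ((q : ℝ) ^ n) * (q : ℝ) ^ d := by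
  have hq' : (2 : ℝ) ≤ q := by exact_mod_cast hq
  have hP : (1 : ℝ) ≤ q ^ d ^ 2 := one_le_pow₀ (by linarith)
  have hy1 : (q : ℝ) ^ 2 ≤ q ^ d := pow_le_pow_right₀ (by linarith) hd
  have hy : (4 : ℝ) ≤ q ^ d := by nlinarith
  have hs : 0 < Real.sqrt ((q : ℝ) ^ n) := Real.sqrt_pos.2 (by positivity)
  have hs2 : (q : ℝ) ^ n = Real.sqrt ((q : ℝ) ^ n) * Real.sqrt ((q : ℝ) ^ n) := (Real.mul_self_sqrt (by positivity)).symm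
  rw [not_lt] at hbig
  nth_rewrite 1 [hs2] at hbig
  generalize Real.sqrt ((q : ℝ) ^ n) = s at *
  have hd1 : (0 : ℝ) ≤ d - 1 := by
    have : (2 : ℝ) ≤ d := by exact_mod_cast hd
    linarith
  generalize (d : ℝ) - 1 = D at *
  generalize (q : ℝ) ^ d ^ 2 = P at *
  generalize (q : ℝ) ^ d = y at *
  have hy0 : 0 < y - 1 := by linarith
  have hP0 : 0 < P := by linarith
  have h1 : 1 / P ≤ 1 := by rw [div_le_iff₀ hP0]; linarith
  have h2 : 2 * D * P / (y - 1) * s ≤ s * s / P := by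
    rw [add_div] at hbig; linarith
  have h3 : 2 * D * P / (y - 1) ≤ s / P := by
    have : s * s / P = s / P * s := by ring
    rw [this] at h2
    exact le_of_mul_le_mul_right h2 hs
  rw [div_le_div_iff₀ hy0 hP0] at h3
  nlinarith

section Setting
universe uL
variable {𝕜 F : Type*} {L : Type uL} [Field 𝕜] [IsAlgClosed 𝕜] [Field F] [Field L] [Algebra 𝕜[X] F]
  [IsFractionRing 𝕜[X] F]
  [Algebra F L] [Algebra 𝕜[X] L] [IsScalarTower 𝕜[X] F L]
  [Algebra 𝕜 L] [IsScalarTower 𝕜 𝕜[X] L]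
  {p e q d : ℕ} {u w : ℕ → 𝕜}

variable (F) in
lemma main_count [hsp : IsSplittingField F L (PF F q d u w)] (H : Hyp 𝕜 p e q d u w) {Q a : ℕ} (hQ : Q = p ^ a) (ha : 1 ≤ a) (hu : ∀ j, u j ^ Q = u j) (hw : ∀ j, w j ^ Q = w j)
    (hgood : ∀ x : 𝕜, ev q w d x ≠ 0 → u 0 * ev q w d x - ev q u (d+1) x * w 0 ≠ 0)
    (KK : Finset 𝕜) (hKK : ∀ x, x ∈ KK ↔ x ^ Q = x)
    (c : ℕ) (hc : 2 ≤ c)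
    (hψ : (∃ s ∈ KK, u 0 - s * w 0 ≠ 0 ∧ {y | y ∈ Vs q d u w s ∧ y ^ Q = y}.ncard = c) ∨
      ∃ ψ : L →+* L, Semi (𝕜 := 𝕜) Q ψ ∧ {x | x ∈ V0 L q d u w ∧ ψ x = x}.ncard = c)
    (hbig : 2 ≤ d → 2 * ((d : ℝ) - 1) * ((q : ℝ) ^ d ^ 2) ^ 2 ≤ Real.sqrt ((p : ℝ) ^ a) * (q : ℝ) ^ d) :
    ∃ h : ℕ, 1 ≤ h ∧ h * (q ^ d - 1) ≤ q ^ d ^ 2 ∧ (d = 1 → h = 1) ∧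
      (h * ({x | x ∈ KK ∧ ev q w d x ≠ 0}.ncard : ℝ) : ℝ) ≤
        ({s | s ∈ KK ∧ u 0 - s * w 0 ≠ 0 ∧ {y | y ∈ Vs q d u w s ∧ y ^ Q = y}.ncard = c}.ncard : ℝ) *
          (h * ((q : ℝ) ^ d - 1)) + (h - 1) * ((p : ℝ) ^ a + 2 * ((d : ℝ) - 1) * (q : ℝ) ^ d ^ 2 * Real.sqrt ((p : ℝ) ^ a)) := by
  haveI := H.ch
  haveI : ExpChar 𝕜 p := ExpChar.prime H.hp
  haveI := findim (F := F) (L := L) H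
  have hq2 := H.q2
  have hd := H.hd
  obtain ⟨Y⟩ := exists_Sys (F := F) (L := L) H
  obtain ⟨ψ, hψs, hψc⟩ : ∃ ψ : L →+* L, Semi (𝕜 := 𝕜) Q ψ ∧ {x | x ∈ V0 L q d u w ∧ ψ x = x}.ncard = c := by
    rcases hψ with ⟨s, hs, hsg, hsc⟩ | h
    · obtain ⟨ψ, hψ⟩ := exists_semi F (L := L) (p := p) (q := q) (d := d) hQ hu hw
      obtain ⟨σ, hσ⟩ := exists_frob (q := q) (d := d) hQ Y hψ (⟨s, hsg⟩, 1) ((hKK s).1 hs)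
      exact ⟨_, hψ.comp σ, (fix_count H Y hu hw (hψ.comp σ) _ hσ).trans hsc⟩
    · exact h
  obtain ⟨v, hv, hv0⟩ : ∃ v ∈ {x | x ∈ V0 L q d u w ∧ ψ x = x}, v ≠ 0 :=
    Set.exists_ne_of_one_lt_ncard (by omega) 0
  let t1 : Vt F L q d u w := ⟨v, V0_Vt H v hv.1 hv0⟩
  obtain ⟨h, z, hz, hhz, hG, hst⟩ := steps H Y t1
  have hh : 1 ≤ h := by
    rcases Nat.eq_zero_or_pos h with h0 | h0
    · exfalso
      rw [h0, zero_mul] at hG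
      exact (Nat.card_pos (α := L ≃ₐ[F] L)).ne hG
    · exact h0
  have hqd : 1 ≤ q ^ d := Nat.one_le_pow _ _ (by omega)
  have hqd2 : 2 ≤ q ^ d := hq2.trans (Nat.le_self_pow (by omega) q)
  have hle : h * (q ^ d - 1) ≤ q ^ d ^ 2 := by
    calc h * (q ^ d - 1) ≤ (q ^ d - 1) ^ (d - 1) * (q ^ d - 1) := Nat.mul_le_mul_right _ (hhz.trans (Nat.pow_le_pow_right (by omega) hz))
      _ = (q ^ d - 1) ^ d := by rw [← pow_succ, Nat.sub_add_cancel hd]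
      _ ≤ (q ^ d) ^ d := Nat.pow_le_pow_left (Nat.sub_le _ _) _
      _ = _ := by rw [← pow_mul, sq]
  have hone : d = 1 → h = 1 := by
    intro h1
    have : z = 0 := by omega
    rw [this, pow_zero] at hhz
    omega
  refine ⟨h, hh, hle, hone, ?_⟩
  have hcast : ((q ^ d - 1 : ℕ) : ℝ) = q ^ d - 1 := by push_cast [hqd]; ring
  have fin : ∀ b : ℕ, (∀ ψ : L →+* L, Semi (𝕜 := 𝕜) Q ψ → ∀ T : Finset (Good u w × (L ≃ₐ[F] L)), (∀ i ∈ T, Y.Fix Q ψ i) → T.card ≤ b) →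
      (h * ({x | x ∈ KK ∧ ev q w d x ≠ 0}.ncard : ℝ) : ℝ) ≤
        ({s | s ∈ KK ∧ u 0 - s * w 0 ≠ 0 ∧ {y | y ∈ Vs q d u w s ∧ y ^ Q = y}.ncard = c}.ncard : ℝ) *
          (h * ((q : ℝ) ^ d - 1)) + (h - 1) * b := by
    intro b hb
    have := geo H Y hQ hu hw hgood KK hKK h hG b hb ψ hψs t1 hv.2
    rw [hψc] at this
    have h2 : ((h - 1 : ℕ) : ℝ) = h - 1 := by push_cast [hh]; ring
    rw [← hcast, ← h2]
    exact_mod_cast this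
  rcases Nat.lt_or_ge d 2 with hd2 | hd2
  · have hd1 : d = 1 := by omega
    have h1 := hone hd1
    have hz0 : z = 0 := by omega
    have := fin (1 + p ^ a) (by
      intro ψ' hψ' T hT
      have hQ' : p ^ 0 * p ^ a = Q := by rw [hQ, pow_zero, one_mul]
      have hpa : 1 < p ^ a := Nat.one_lt_pow (by omega) H.hp.one_lt
      have := hst 1 0 a 1 1 ψ' (Or.inl rfl) (by rw [hQ']; exact hψ') (by rw [hQ']; exact hu) (by rw [hQ']; exact hw)
        (by rw [h1, hz0]; simpa using hpa) (by rw [h1, hz0]; simp) T (by rw [hQ']; exact hT)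
      rw [h1, hz0] at this
      simpa using this)
    rw [h1] at this ⊢
    simpa using this
  · obtain ⟨l, ra, sb, A, B, hrs, hl, hl1, c1, c2, c3⟩ := stepan_num p e q d h z a H.hp H.he H.hq hd2 hh hz hhz (hbig hd2)
    have hQ' : p ^ ra * p ^ sb = Q := by rw [hQ, ← hrs, pow_add]
    set M := (p : ℝ) ^ a + 2 * ((d : ℝ) - 1) * (q : ℝ) ^ d ^ 2 * Real.sqrt ((p : ℝ) ^ a) with hM
    have hM0 : 0 ≤ M := by simpa using c3 0 (by simp)
    have := fin ⌊M⌋₊ (by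
      intro ψ' hψ' T hT
      apply Nat.le_floor
      apply c3
      exact hst l ra sb A B ψ' hl (by rw [hQ']; exact hψ') (by rw [hQ']; exact hu) (by rw [hQ']; exact hw) c1 c2 T (by rw [hQ']; exact hT))
    refine this.trans ?_
    have h3 : (⌊M⌋₊ : ℝ) ≤ M := Nat.floor_le hM0
    have h4 : (0 : ℝ) ≤ h - 1 := by
      have : (1 : ℝ) ≤ h := by exact_mod_cast hh
      linarith
    have := mul_le_mul_of_nonneg_left h3 h4
    linarith

end Setting
end Chb

namespace Chb
open Polynomial
set_option linter.unusedSectionVars false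
set_option linter.style.haveILetI false
set_option linter.unusedVariables false

section
variable {𝕜 : Type*} [Field 𝕜] {p e q d : ℕ} {u w : ℕ → 𝕜}

lemma lp1_coeff0 (hq : 2 ≤ q) (c : ℕ → 𝕜) {N : ℕ} (hN : 1 ≤ N) : (lp1 q c N).coeff 0 = c 0 := by
  rw [lp1, finsetSum_coeff, Finset.sum_eq_single 0]
  · simp
  · intro j _ hj
    have : 1 < q ^ j := Nat.one_lt_pow hj (by omega)
    rw [coeff_C_mul, coeff_X_pow, if_neg (by omega), mul_zero]
  · intro h; exact absurd (Finset.mem_range.2 (by omega)) h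

lemma lp1_single (c : ℕ → 𝕜) {N t : ℕ} (ht : t < N) (h1 : c t = 1) (hc : ∀ j, j < N → j ≠ t → c j = 0) : lp1 q c N = X ^ (q ^ t - 1) := by
  rw [lp1, Finset.sum_eq_single t]
  · rw [h1, C_1, one_mul]
  · intro j hj hjt
    rw [hc j (Finset.mem_range.1 hj) hjt, C_0, zero_mul]
  · intro h; exact absurd (Finset.mem_range.2 ht) h

lemma ev_single {A : Type*} [CommRing A] [Algebra 𝕜 A] (c : ℕ → 𝕜) {N t : ℕ} (ht : t < N) (h1 : c t = 1) (hc : ∀ j, j < N → j ≠ t → c j = 0) (x : A) :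
    ev q c N x = x ^ q ^ t := by
  rw [ev, Finset.sum_eq_single t]
  · rw [h1, one_smul]
  · intro j hj hjt
    rw [hc j (Finset.mem_range.1 hj) hjt, zero_smul]
  · intro h; exact absurd (Finset.mem_range.2 ht) h

lemma cop_X (P : 𝕜[X]) (h : P.coeff 0 ≠ 0) (m : ℕ) : IsCoprime P (X ^ m) := by
  apply IsCoprime.pow_right
  apply IsCoprime.symm
  rw [irreducible_X.coprime_iff_not_dvd, X_dvd_iff]
  exact h

/-- the two cases -/
def Cas (d : ℕ) (u w : ℕ → 𝕜) : Prop :=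
  (∃ t, t < d ∧ w t = 1 ∧ (∀ j, j ≠ t → w j = 0) ∧ 1 ≤ t ∧ u 0 ≠ 0) ∨
    ((∀ j, j < d → u j = 0) ∧ ∃ k, k < d ∧ w 0 ≠ 0 ∧ w k ≠ 0 ∧ ∀ j, k < j → w j = 0)

lemma mkHyp (hp : p.Prime) (he : 1 ≤ e) (hq : q = p ^ e) (hd : 1 ≤ d) [ch : CharP 𝕜 p] (hud : u d = 1) (hc : Cas d u w) :
    Hyp 𝕜 p e q d u w := by
  have hq2 : 2 ≤ q := by rw [hq]; exact hp.two_le.trans (Nat.le_self_pow (by omega) p)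
  rcases hc with ⟨t, htd, hwt, hw0, ht, hu⟩ | ⟨hu, k, hkd, hw0, hwk, hwj⟩
  · have h1 : lp1 q w d = X ^ (q ^ t - 1) := lp1_single w htd hwt (fun j _ hj => hw0 j hj)
    refine ⟨hp, he, hq, hd, ch, hud, ?_, ?_, Or.inl hu⟩
    · rw [h1]
      exact cop_X _ (by rw [lp1_coeff0 hq2 _ (by omega)]; exact hu) _
    · rw [h1]; exact pow_ne_zero _ X_ne_zero
  · have h1 : lp1 q u (d+1) = X ^ (q ^ d - 1) := lp1_single u (by omega) hud (fun j hj hj' => hu j (by omega))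
    refine ⟨hp, he, hq, hd, ch, hud, ?_, ?_, Or.inr hw0⟩
    · rw [h1]
      exact (cop_X _ (by rw [lp1_coeff0 hq2 _ (by omega)]; exact hw0) _).symm
    · intro h
      have := lp1_coeff0 hq2 w hd
      rw [h] at this
      exact hw0 (by simpa using this.symm)

lemma hgood_of (hq : 2 ≤ q) (hd : 1 ≤ d) (hud : u d = 1) (hc : Cas d u w) (x : 𝕜) (hx : ev q w d x ≠ 0) :
    u 0 * ev q w d x - ev q u (d+1) x * w 0 ≠ 0 := by
  rcases hc with ⟨t, htd, hwt, hw0, ht, hu⟩ | ⟨hu, k, hkd, hw0, hwk, hwj⟩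
  · rw [hw0 0 (by omega), mul_zero, sub_zero]
    exact mul_ne_zero hu hx
  · rw [hu 0 (by omega), zero_mul, zero_sub, neg_ne_zero, ev_single u (show d < d + 1 by omega) hud (fun j hj hj' => hu j (by omega))]
    refine mul_ne_zero (pow_ne_zero _ ?_) hw0
    rintro rfl
    exact hx (by rw [← mul_lp1 (by omega), zero_mul])

end

lemma main2_aux {𝕜 : Type*} (F L : Type*) [Field 𝕜] [IsAlgClosed 𝕜] [Field F] [Field L] [Algebra 𝕜[X] F]
    [IsFractionRing 𝕜[X] F] [Algebra F L] {p e q d : ℕ} {u w : ℕ → 𝕜} (hp : p.Prime) (he : 1 ≤ e) (hq : q = p ^ e) (hd : 1 ≤ d)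
    [ch : CharP 𝕜 p] (hud : u d = 1) (hcas : Cas d u w)
    [hsp : IsSplittingField F L (PF F q d u w)]
    {Q a : ℕ} (hQ : Q = p ^ a) (ha : 1 ≤ a) (hu : ∀ j, u j ^ Q = u j) (hw : ∀ j, w j ^ Q = w j)
    (KK : Finset 𝕜) (hKK : ∀ x, x ∈ KK ↔ x ^ Q = x)
    (c : ℕ) (hc : 2 ≤ c)
    (hψ : (∃ s ∈ KK, u 0 - s * w 0 ≠ 0 ∧ {y | y ∈ Vs q d u w s ∧ y ^ Q = y}.ncard = c) ∨
      (u 0 = 0 ∧ {y : 𝕜 | ev q w d y = 0 ∧ y ^ Q = y}.ncard = c))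
    (hbig : 2 ≤ d → 2 * ((d : ℝ) - 1) * ((q : ℝ) ^ d ^ 2) ^ 2 ≤ Real.sqrt ((p : ℝ) ^ a) * (q : ℝ) ^ d) :
    ∃ h : ℕ, 1 ≤ h ∧ h * (q ^ d - 1) ≤ q ^ d ^ 2 ∧ (d = 1 → h = 1) ∧
      (h * ({x | x ∈ KK ∧ ev q w d x ≠ 0}.ncard : ℝ) : ℝ) ≤
        ({s | s ∈ KK ∧ u 0 - s * w 0 ≠ 0 ∧ {y | y ∈ Vs q d u w s ∧ y ^ Q = y}.ncard = c}.ncard : ℝ) *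
          (h * ((q : ℝ) ^ d - 1)) + (h - 1) * ((p : ℝ) ^ a + 2 * ((d : ℝ) - 1) * (q : ℝ) ^ d ^ 2 * Real.sqrt ((p : ℝ) ^ a)) := by
  have H := mkHyp hp he hq hd hud hcas
  letI iA : Algebra 𝕜[X] L := ((algebraMap F L).comp (algebraMap 𝕜[X] F)).toAlgebra
  haveI : IsScalarTower 𝕜[X] F L := IsScalarTower.of_algebraMap_eq' rfl
  letI iL : Algebra 𝕜 L := ((algebraMap 𝕜[X] L).comp C).toAlgebra
  haveI : IsScalarTower 𝕜 𝕜[X] L := IsScalarTower.of_algebraMap_eq' rfl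
  refine main_count F (L := L) H hQ ha hu hw (hgood_of H.q2 hd hud hcas) KK hKK c hc ?_ hbig
  rcases hψ with h | ⟨hu0, h⟩
  · exact Or.inl h
  · right
    rcases hcas with ⟨t, htd, hwt, hw0, ht, hu'⟩ | ⟨hu1, k, hkd, hw0, hwk, hwj⟩
    · exact absurd hu0 hu'
    · obtain ⟨ψ, h1, h2⟩ := exists_inf (F := F) (L := L) H hu1 hkd hw0 hwk hwj hQ hu hw (by omega)
      exact ⟨ψ, h1, h2.trans h⟩

lemma main2 {𝕜 : Type*} [Field 𝕜] [IsAlgClosed 𝕜] {p e q d : ℕ} {u w : ℕ → 𝕜} (hp : p.Prime) (he : 1 ≤ e) (hq : q = p ^ e) (hd : 1 ≤ d)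
    [ch : CharP 𝕜 p] (hud : u d = 1) (hcas : Cas d u w)
    {Q a : ℕ} (hQ : Q = p ^ a) (ha : 1 ≤ a) (hu : ∀ j, u j ^ Q = u j) (hw : ∀ j, w j ^ Q = w j)
    (KK : Finset 𝕜) (hKK : ∀ x, x ∈ KK ↔ x ^ Q = x)
    (c : ℕ) (hc : 2 ≤ c)
    (hψ : (∃ s ∈ KK, u 0 - s * w 0 ≠ 0 ∧ {y | y ∈ Vs q d u w s ∧ y ^ Q = y}.ncard = c) ∨
      (u 0 = 0 ∧ {y : 𝕜 | ev q w d y = 0 ∧ y ^ Q = y}.ncard = c))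
    (hbig : 2 ≤ d → 2 * ((d : ℝ) - 1) * ((q : ℝ) ^ d ^ 2) ^ 2 ≤ Real.sqrt ((p : ℝ) ^ a) * (q : ℝ) ^ d) :
    ∃ h : ℕ, 1 ≤ h ∧ h * (q ^ d - 1) ≤ q ^ d ^ 2 ∧ (d = 1 → h = 1) ∧
      (h * ({x | x ∈ KK ∧ ev q w d x ≠ 0}.ncard : ℝ) : ℝ) ≤
        ({s | s ∈ KK ∧ u 0 - s * w 0 ≠ 0 ∧ {y | y ∈ Vs q d u w s ∧ y ^ Q = y}.ncard = c}.ncard : ℝ) *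
          (h * ((q : ℝ) ^ d - 1)) + (h - 1) * ((p : ℝ) ^ a + 2 * ((d : ℝ) - 1) * (q : ℝ) ^ d ^ 2 * Real.sqrt ((p : ℝ) ^ a)) :=
  main2_aux (FractionRing 𝕜[X]) (PF (FractionRing 𝕜[X]) q d u w).SplittingField hp he hq hd hud hcas hQ ha hu hw KK hKK c hc hψ hbig

end Chb

namespace Chb
open Polynomial
set_option linter.unusedSectionVars false
set_option linter.style.haveILetI false
set_option linter.unusedVariables false

lemma ev_roots {𝕜 : Type*} [Field 𝕜] [IsAlgClosed 𝕜] {p e q d : ℕ} {u w : ℕ → 𝕜} (hp : p.Prime) (he : 1 ≤ e) (hq : q = p ^ e)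
    [ch : CharP 𝕜 p] (hcas : Cas d u w) : {y : 𝕜 | ev q w d y = 0}.Finite ∧ {y : 𝕜 | ev q w d y = 0}.ncard ≤ q ^ (d - 1) := by
  have hq2 : 2 ≤ q := by rw [hq]; exact hp.two_le.trans (Nat.le_self_pow (by omega) p)
  rcases hcas with ⟨t, htd, hwt, hw0, ht, hu⟩ | ⟨hu, k, hkd, hw0, hwk, hwj⟩
  · have : {y : 𝕜 | ev q w d y = 0} = {0} := by
      ext y
      rw [Set.mem_ofPred_eq, ev_single w htd hwt (fun j _ hj => hw0 j hj), Set.mem_singleton_iff, pow_eq_zero_iff (by positivity)]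
    rw [this, Set.ncard_singleton]
    exact ⟨Set.finite_singleton _, Nat.one_le_pow _ _ (by omega)⟩
  · have := ker_card hp he hq hkd hw0 hwk hwj
    refine ⟨Set.finite_of_ncard_pos (by rw [this]; positivity), ?_⟩
    rw [this]
    exact Nat.pow_le_pow_right (by omega) (by omega)

lemma transfer {K 𝕜 : Type*} [Field K] [Field 𝕜] (φ : K →+* 𝕜) (R : 𝕜 → Prop) (S : K → Prop) (h1 : ∀ x, R (φ x) ↔ S x)
    (h2 : ∀ y, R y → ∃ x, φ x = y) : {y | R y}.ncard = Nat.card {x // S x} := by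
  have : {y | R y} = φ '' {x | S x} := by
    ext y
    constructor
    · intro hy
      obtain ⟨x, rfl⟩ := h2 y hy
      exact ⟨x, (h1 x).1 hy, rfl⟩
    · rintro ⟨x, hx, rfl⟩
      exact (h1 x).2 hx
  rw [this, Set.ncard_image_of_injective _ φ.injective]
  rfl

lemma ev_map {K 𝕜 : Type*} [Field K] [Field 𝕜] (φ : K →+* 𝕜) (q : ℕ) (c : ℕ → K) (N : ℕ) (x : K) :
    ev q (fun j => φ (c j)) N (φ x) = φ (ev q c N x) := by
  simp [ev, map_sum]

lemma main3 {K : Type*} [Field K] [Fintype K] {p e q d n : ℕ} {u w : ℕ → K} (hp : p.Prime) (he : 1 ≤ e) (hq : q = p ^ e) (hd : 1 ≤ d)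
    (hn : 2 ≤ n) (hcard : Fintype.card K = q ^ n) (hud : u d = 1) (hcas : Cas d u w) (c : ℕ) (hc : 2 ≤ c)
    (hψ : (∃ s : K, u 0 - s * w 0 ≠ 0 ∧ Nat.card {x : K // ev q u (d+1) x = s * ev q w d x} = c) ∨
      (u 0 = 0 ∧ Nat.card {x : K // ev q w d x = 0} = c))
    (hR : ¬ ((1 : ℝ) > ((q : ℝ) ^ n + 1) / (q : ℝ) ^ (d ^ 2)
        - (2 * ((d : ℝ) - 1) * (q : ℝ) ^ (d ^ 2) / ((q : ℝ) ^ d - 1)) * Real.sqrt ((q : ℝ) ^ n) - 1)) :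
    (Nat.card {s : K // u 0 - s * w 0 ≠ 0 ∧ Nat.card {x : K // ev q u (d+1) x = s * ev q w d x} = c} : ℝ) >
      ((q : ℝ) ^ n + 1) / (q : ℝ) ^ (d ^ 2)
        - (2 * ((d : ℝ) - 1) * (q : ℝ) ^ (d ^ 2) / ((q : ℝ) ^ d - 1)) * Real.sqrt ((q : ℝ) ^ n) - 1 := by
  classical
  haveI := Fact.mk hp
  have hcard' : Fintype.card K = p ^ (e * n) := by rw [hcard, hq, pow_mul]
  haveI : CharP K p := charP_of_card_eq_prime_pow hcard'
  let 𝕜 := AlgebraicClosure K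
  haveI : CharP 𝕜 p := charP_of_injective_algebraMap (algebraMap K 𝕜).injective p
  let φ : K →+* 𝕜 := algebraMap K 𝕜
  have hφ : Function.Injective φ := φ.injective
  have hq2 : 2 ≤ q := by rw [hq]; exact hp.two_le.trans (Nat.le_self_pow (by omega) p)
  have hQ1 : 1 < q ^ n := Nat.one_lt_pow (by omega) (by omega)
  have hpow : ∀ x : K, φ x ^ (q ^ n) = φ x := by
    intro x; rw [← map_pow, ← hcard, FiniteField.pow_card]
  let KK : Finset 𝕜 := Finset.univ.image φ
  have hKKc : KK.card = q ^ n := by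
    rw [Finset.card_image_of_injective _ hφ, Finset.card_univ, hcard]
  have hKK' : KK = (X ^ (q ^ n) - X : 𝕜[X]).roots.toFinset := by
    have hne : (X ^ (q ^ n) - X : 𝕜[X]) ≠ 0 := FiniteField.X_pow_card_sub_X_ne_zero 𝕜 hQ1
    apply Finset.eq_of_subset_of_card_le
    · intro y hy
      obtain ⟨x, _, rfl⟩ := Finset.mem_image.1 hy
      rw [Multiset.mem_toFinset, mem_roots hne]
      simp [IsRoot, hpow]
    · rw [hKKc]
      refine (Multiset.toFinset_card_le _).trans ((card_roots' _).trans ?_)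
      rw [FiniteField.X_pow_card_sub_X_natDegree_eq 𝕜 hQ1]
  have hKK : ∀ x, x ∈ KK ↔ x ^ (q ^ n) = x := by
    intro x
    rw [hKK', Multiset.mem_toFinset, mem_roots (FiniteField.X_pow_card_sub_X_ne_zero 𝕜 hQ1)]
    simp [IsRoot, sub_eq_zero]
  have hex : ∀ y ∈ KK, ∃ x, φ x = y := by
    intro y hy
    obtain ⟨x, _, rfl⟩ := Finset.mem_image.1 hy
    exact ⟨x, rfl⟩
  have hmem : ∀ x, φ x ∈ KK := fun x => Finset.mem_image_of_mem _ (Finset.mem_univ _)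
  have hcas' : Cas d (fun j => φ (u j)) (fun j => φ (w j)) := by
    rcases hcas with ⟨t, htd, hwt, hw0, ht, hu⟩ | ⟨hu, k, hkd, hw0, hwk, hwj⟩
    · exact Or.inl ⟨t, htd, by simp [hwt], fun j hj => by simp [hw0 j hj], ht, by simpa using hu⟩
    · exact Or.inr ⟨fun j hj => by simp [hu j hj], k, hkd, by simpa using hw0, by simpa using hwk, fun j hj => by simp [hwj j hj]⟩
  have tr1 : ∀ s : K, {y | y ∈ Vs q d (fun j => φ (u j)) (fun j => φ (w j)) (φ s) ∧ y ^ (q ^ n) = y}.ncard =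
      Nat.card {x : K // ev q u (d+1) x = s * ev q w d x} := by
    intro s
    apply transfer φ
    · intro x
      rw [and_iff_left (hpow x), Vs, Set.mem_ofPred_eq, ev_map, ev_map, ← map_mul]
      exact hφ.eq_iff
    · intro y hy; exact hex y ((hKK y).2 hy.2)
  have gd : ∀ s : K, φ (u 0) - φ s * φ (w 0) ≠ 0 ↔ u 0 - s * w 0 ≠ 0 := by
    intro s
    rw [← map_mul, ← map_sub, Ne, map_eq_zero]
  have tr2 : {s | s ∈ KK ∧ φ (u 0) - s * φ (w 0) ≠ 0 ∧
      {y | y ∈ Vs q d (fun j => φ (u j)) (fun j => φ (w j)) s ∧ y ^ (q ^ n) = y}.ncard = c}.ncard =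
      Nat.card {s : K // u 0 - s * w 0 ≠ 0 ∧ Nat.card {x : K // ev q u (d+1) x = s * ev q w d x} = c} := by
    apply transfer φ
    · intro s
      rw [tr1, gd, and_iff_right (hmem s)]
    · intro y hy; exact hex y hy.1
  obtain ⟨h, hh, hG, h1, hm⟩ := main2 (u := fun j => φ (u j)) (w := fun j => φ (w j)) hp he hq hd (by simp [hud]) hcas'
    (Q := q ^ n) (a := e * n) (by rw [hq, pow_mul]) (Nat.mul_pos he (by omega)) (fun j => hpow _) (fun j => hpow _) KK hKK c hc
    (by
      rcases hψ with ⟨s, hs, hsc⟩ | ⟨h0, hs⟩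
      · exact Or.inl ⟨φ s, hmem s, (gd s).2 hs, (tr1 s).trans hsc⟩
      · refine Or.inr ⟨by simp [h0], Eq.trans ?_ hs⟩
        apply transfer φ
        · intro x
          rw [and_iff_left (hpow x), ev_map, map_eq_zero]
        · intro y hy; exact hex y ((hKK y).2 hy.2))
    (by
      intro hd2
      have := big_num q n d hq2 hd2 hR
      have e1 : (p : ℝ) ^ (e * n) = (q : ℝ) ^ n := by rw [hq, pow_mul]; push_cast; rfl
      rw [e1]; exact this)
  rw [tr2] at hm
  have e1 : (p : ℝ) ^ (e * n) = (q : ℝ) ^ n := by rw [hq, pow_mul]; push_cast; rfl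
  rw [e1] at hm
  refine fin_num q n d h _ hq2 hd hn hh hG h1 _ ?_ hm
  obtain ⟨hf, hle⟩ := ev_roots (q := q) (d := d) (u := fun j => φ (u j)) (w := fun j => φ (w j)) hp he hq hcas'
  have hsub : (KK : Set 𝕜) ⊆ {x | x ∈ KK ∧ ev q (fun j => φ (w j)) d x ≠ 0} ∪ {y | ev q (fun j => φ (w j)) d y = 0} := by
    intro x hx
    by_cases h0 : ev q (fun j => φ (w j)) d x = 0
    · exact Or.inr h0
    · exact Or.inl ⟨hx, h0⟩
  have hf2 : {x | x ∈ KK ∧ ev q (fun j => φ (w j)) d x ≠ 0}.Finite := KK.finite_toSet.subset (fun x hx => hx.1)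
  have h3 := (Set.ncard_le_ncard hsub (hf2.union hf)).trans (Set.ncard_union_le _ _)
  rw [Set.ncard_coe_finset, hKKc] at h3
  omega

end Chb

open Chb
namespace Chb
end Chb

theorem stmt_4 (p e q n k t : ℕ) (hp : p.Prime) (he : 1 ≤ e) (hq : q = p ^ e)
    (ht : 1 ≤ t) (htn : t < n) (hkn : k < n)
    (K : Type) [Field K] [Fintype K] (hcard : Fintype.card K = q ^ n)
    (a : ℕ → K) (hak : a k ≠ 0) (hat : a t = 0) (ha0 : a 0 ≠ 0)
    (f : K → K) (hf : f = fun x => ∑ j ∈ Finset.range (k + 1), a j * x ^ q ^ j)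
    (d : ℕ) (hd : d = max k t)
    (N : ℕ → ℕ)
    (hN : ∀ i, N i =
      Nat.card {m : K // Nat.log q (Nat.card {x : K // f x = m * x ^ q ^ t}) = i}) :
    ∀ i, 1 ≤ i → N i = 0 ∨
      (N i : ℝ) > ((q : ℝ) ^ n + 1) / (q : ℝ) ^ (d ^ 2)
        - (2 * ((d : ℝ) - 1) * (q : ℝ) ^ (d ^ 2) / ((q : ℝ) ^ d - 1)) *
            Real.sqrt ((q : ℝ) ^ n)
        - 1 := by

  intro i hi
  classical
  have hq2 : 2 ≤ q := by rw [hq]; exact hp.two_le.trans (Nat.le_self_pow (by omega) p)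
  have hn2 : 2 ≤ n := by omega
  rcases Nat.eq_zero_or_pos (N i) with h0 | hpos
  · exact Or.inl h0
  right
  by_cases hR : (1 : ℝ) > ((q : ℝ) ^ n + 1) / (q : ℝ) ^ (d ^ 2)
        - (2 * ((d : ℝ) - 1) * (q : ℝ) ^ (d ^ 2) / ((q : ℝ) ^ d - 1)) * Real.sqrt ((q : ℝ) ^ n) - 1
  · have : (1 : ℝ) ≤ N i := by exact_mod_cast hpos
    linarith
  have hNi := hN i
  rw [hNi] at hpos
  obtain ⟨⟨m0, hm0⟩⟩ := (Nat.card_pos_iff.1 hpos).1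
  obtain ⟨c, hc⟩ : ∃ c, c = Nat.card {x : K // f x = m0 * x ^ q ^ t} := ⟨_, rfl⟩
  rw [← hc] at hm0
  have hc2 : 2 ≤ c := by
    by_contra hcon
    have : Nat.log q c = 0 := Nat.log_of_lt (by omega)
    omega
  have key : ∀ (u w : ℕ → K) (g : K → K), Function.Injective g → u d = 1 → Cas d u w →
      (∀ s x, u 0 - s * w 0 ≠ 0 → (ev q u (d+1) x = s * ev q w d x ↔ f x = g s * x ^ q ^ t)) →
      ((∃ s : K, u 0 - s * w 0 ≠ 0 ∧ g s = m0) ∨ (u 0 = 0 ∧ m0 = 0 ∧ ∀ x, ev q w d x = f x)) →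
      (N i : ℝ) > ((q : ℝ) ^ n + 1) / (q : ℝ) ^ (d ^ 2)
        - (2 * ((d : ℝ) - 1) * (q : ℝ) ^ (d ^ 2) / ((q : ℝ) ^ d - 1)) * Real.sqrt ((q : ℝ) ^ n) - 1 := by
    intro u w g hg hud hcas heq hsol
    have hcc : ∀ s, u 0 - s * w 0 ≠ 0 → Nat.card {x : K // ev q u (d+1) x = s * ev q w d x} = Nat.card {x : K // f x = g s * x ^ q ^ t} := by
      intro s hs
      exact Nat.card_congr (Equiv.subtypeEquivRight (fun x => heq s x hs))
    have hmain := main3 hp he hq (by omega : 1 ≤ d) hn2 hcard hud hcas c hc2 (by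
      rcases hsol with ⟨s, hs, hgs⟩ | ⟨h1, h2, h3⟩
      · refine Or.inl ⟨s, hs, ?_⟩
        rw [hcc s hs, hgs, hc]
      · refine Or.inr ⟨h1, ?_⟩
        rw [hc]
        refine Nat.card_congr (Equiv.subtypeEquivRight (fun x => ?_))
        rw [h3, h2, zero_mul]) hR
    have hle : Nat.card {s : K // u 0 - s * w 0 ≠ 0 ∧ Nat.card {x : K // ev q u (d+1) x = s * ev q w d x} = c} ≤ N i := by
      rw [hNi]
      refine Nat.card_le_card_of_injective (fun s => ⟨g s.1, ?_⟩) ?_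
      · rw [← hcc s.1 s.2.1, s.2.2, hm0]
      · intro s s' h
        exact Subtype.ext (hg (congrArg Subtype.val h))
    have hle' : (Nat.card {s : K // u 0 - s * w 0 ≠ 0 ∧ Nat.card {x : K // ev q u (d+1) x = s * ev q w d x} = c} : ℝ) ≤ N i := by
      exact_mod_cast hle
    linarith
  rcases lt_trichotomy t k with htk | htk | htk
  · have hdk : d = k := by omega
    subst hdk
    have hw1 : ∀ x : K, ev q (fun j => if j = t then (1 : K) else 0) d x = x ^ q ^ t := fun x =>
      ev_single _ htk (by simp) (fun j _ hj => by simp [hj]) x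
    refine key (fun j => a j / a d) (fun j => if j = t then 1 else 0) (fun s => a d * s) (mul_right_injective₀ hak)
      (div_self hak) (Or.inl ⟨t, htk, by simp, fun j hj => by simp [hj], ht, div_ne_zero ha0 hak⟩) ?_ ?_
    · intro s x _
      rw [hw1]
      have h1 : ev q (fun j => a j / a d) (d+1) x = f x / a d := by
        rw [hf, ev, Finset.sum_div]
        refine Finset.sum_congr rfl fun j _ => ?_
        rw [smul_eq_mul]; ring
      rw [h1, div_eq_iff hak]
      constructor
      · intro h; rw [h]; ring
      · intro h; rw [h]; ring
    · refine Or.inl ⟨m0 / a d, ?_, mul_div_cancel₀ _ hak⟩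
      have : ¬ (0 = t) := by omega
      simp [this, ha0, hak]
  · exact absurd (htk ▸ hat) hak
  · have hdt : d = t := by omega
    subst hdt
    have hw1 : ∀ x : K, ev q (fun j => if j ≤ k then a j else 0) d x = f x := by
      intro x
      rw [hf, ev]
      symm
      apply Finset.sum_subset_zero_on_sdiff
      · exact Finset.range_subset_range.2 htk
      · intro j hj
        have : ¬ j ≤ k := by simp at hj; omega
        simp [this]
      · intro j hj
        have : j ≤ k := by simp at hj; omega
        simp [this]
    have hu1 : ∀ x : K, ev q (fun j => if j = d then (1 : K) else 0) (d+1) x = x ^ q ^ d := fun x =>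
      ev_single _ (by omega) (by simp) (fun j _ hj => by simp [hj]) x
    have h0d : ¬ (0 = d) := by omega
    refine key (fun j => if j = d then 1 else 0) (fun j => if j ≤ k then a j else 0) (fun s => s⁻¹) inv_injective
      (by simp) (Or.inr ⟨fun j hj => by simp [hj.ne], k, htk, by simpa using ha0, by simpa using hak, fun j hj => by simp [hj]⟩) ?_ ?_
    · intro s x hs
      have hs0 : s ≠ 0 := by
        rintro rfl
        simp [h0d] at hs
      rw [hw1, hu1]
      constructor
      · intro h; rw [h, inv_mul_cancel_left₀ hs0]
      · intro h; rw [h, mul_inv_cancel_left₀ hs0]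
    · by_cases hm : m0 = 0
      · exact Or.inr ⟨by simp [h0d], hm, hw1⟩
      · refine Or.inl ⟨m0⁻¹, ?_, inv_inv _⟩
        simp [h0d, ha0, hm]
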